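/- Let 1 < p < 2, p ≤ q, assume (p−1)²(q−1) > 1, set κ₁ = p−1, κ₂ = q(p−1)−1, let a_j, ℓ, b_ℓ and the metric d and set D_ε be as in the context with κ₁a_ℓ < 1, and let 0 < ε ≤ 1, f⃗₁ ∈ Y_{κ₁}(ε), f⃗₂ ∈ Y_{κ₂}(ε). Then every (u₁, u₂) ∈ D_ε satisfies ‖u₁‖_{Z²(κ₁)} + ‖u₂‖_{X²(κ₂)} ≤ C ε, and moreover d₁(u₁, w_{ℓ+1}) ≤ ε^{(p−1)b_ℓ} and d₂(u₂, v_ℓ) ≤ C ε^{(p−1)b_ℓ}, where C depends only on p and q. -/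

import Mathlib

open Real MeasureTheory Filter

noncomputable section

/-- Partial derivative with respect to the first (radial) variable. -/
def pdr (u : ℝ → ℝ → ℝ) : ℝ → ℝ → ℝ := fun r t => deriv (fun r' => u r' t) r

/-- Partial derivative with respect to the second (time) variable. -/
def pdt (u : ℝ → ℝ → ℝ) : ℝ → ℝ → ℝ := fun r t => deriv (fun t' => u r t') t

/-- `[u(r,t)]₁ = |u| + r (|∂_r u| + |∂_t u|)`. -/
def bracket1 (u : ℝ → ℝ → ℝ) (r t : ℝ) : ℝ :=
  |u r t| + r * (|pdr u r t| + |pdt u r t|)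

/-- `[u(r,t)]₂ = |u| + (1+r)(|∂_r u| + |∂_t u|) + r (|∂_r² u| + |∂_r∂_t u| + |∂_t² u|)`. -/
def bracket2 (u : ℝ → ℝ → ℝ) (r t : ℝ) : ℝ :=
  |u r t| + (1 + r) * (|pdr u r t| + |pdt u r t|) +
    r * (|pdr (pdr u) r t| + |pdr (pdt u) r t| + |pdt (pdt u) r t|)

def bracketS (s : ℕ) (u : ℝ → ℝ → ℝ) (r t : ℝ) : ℝ :=
  if s = 1 then bracket1 u r t else bracket2 u r t

/-- Membership in the class `X^s`: `u ∈ C^{s-1}(ℝ × [0,∞))`, `r u ∈ C^s(ℝ × [0,∞))`,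
and `u` is even in `r`. -/
def memX (s : ℕ) (u : ℝ → ℝ → ℝ) : Prop :=
  ContDiffOn ℝ ((s - 1 : ℕ) : ℕ∞) (fun z : ℝ × ℝ => u z.1 z.2) (Set.univ ×ˢ Set.Ici (0:ℝ)) ∧
  ContDiffOn ℝ ((s : ℕ) : ℕ∞) (fun z : ℝ × ℝ => z.1 * u z.1 z.2) (Set.univ ×ˢ Set.Ici (0:ℝ)) ∧
  ∀ r t : ℝ, 0 ≤ t → u (-r) t = u r t

/-- The set of values whose supremum is `‖u‖_{X^s(ν)}`. -/
def XSet (s : ℕ) (ν : ℝ) (u : ℝ → ℝ → ℝ) : Set ℝ :=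
  {x | ∃ r t : ℝ, 0 < r ∧ 0 ≤ t ∧ x = bracketS s u r t * (1 + |r - t|) ^ ν}

/-- `‖u‖_{X^s(ν)}`. -/
def Xnorm (s : ℕ) (ν : ℝ) (u : ℝ → ℝ → ℝ) : ℝ := sSup (XSet s ν u)

/-- `u ∈ X^s(ν)`. -/
def memXnu (s : ℕ) (ν : ℝ) (u : ℝ → ℝ → ℝ) : Prop := memX s u ∧ BddAbove (XSet s ν u)

/-- The set of values whose supremum is `‖u‖_{Z^s(ν)}`. -/
def ZSet (s : ℕ) (ν : ℝ) (u : ℝ → ℝ → ℝ) : Set ℝ :=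
  {x | ∃ r t : ℝ, 0 < r ∧ 0 ≤ t ∧
    x = bracketS s u r t * (1 + r + t) ^ (ν - 1) * (1 + |r - t|)}

/-- `‖u‖_{Z^s(ν)}`. -/
def Znorm (s : ℕ) (ν : ℝ) (u : ℝ → ℝ → ℝ) : ℝ := sSup (ZSet s ν u)

/-- `u ∈ Z^s(ν)`. -/
def memZnu (s : ℕ) (ν : ℝ) (u : ℝ → ℝ → ℝ) : Prop := memX s u ∧ BddAbove (ZSet s ν u)

/-- `|||f⃗(r)|||`. -/
def tripleNorm (f g : ℝ → ℝ) (r : ℝ) : ℝ :=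
  |f r| + (1 + r) * (|deriv f r| + |g r|) + r * (|deriv (deriv f) r| + |deriv g r|)

def tnorm (fg : (ℝ → ℝ) × (ℝ → ℝ)) (r : ℝ) : ℝ := tripleNorm fg.1 fg.2 r

/-- `f⃗ ∈ Y_ν(ε)`. -/
def memY (ν ε : ℝ) (fg : (ℝ → ℝ) × (ℝ → ℝ)) : Prop :=
  ContDiff ℝ 1 fg.1 ∧ Continuous fg.2 ∧
  (∀ r : ℝ, fg.1 (-r) = fg.1 r) ∧ (∀ r : ℝ, fg.2 (-r) = fg.2 r) ∧
  ContDiff ℝ 2 (fun r : ℝ => r * fg.1 r) ∧ ContDiff ℝ 1 (fun r : ℝ => r * fg.2 r) ∧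
  ∀ r : ℝ, 0 < r → (1 + r) ^ ν * tnorm fg r ≤ ε

/-- Solution operator `K[f⃗]` of the radial homogeneous wave equation. -/
def Kop (fg : (ℝ → ℝ) × (ℝ → ℝ)) : ℝ → ℝ → ℝ := fun r t =>
  (1 / (2 * r)) * ((∫ l in (r - t)..(r + t), l * fg.2 l) +
    deriv (fun s : ℝ => ∫ l in (r - s)..(r + s), l * fg.1 l) t)

/-- Duhamel operator `L(F)` for the initial value problem with zero data. -/
def Lop (F : ℝ → ℝ → ℝ) : ℝ → ℝ → ℝ := fun r t =>
  (1 / (2 * r)) * ∫ s in (0:ℝ)..t, (∫ l in (r - (t - s))..(r + (t - s)), l * F l s)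

/-- Operator `R(F)` associated with the final value problem. -/
def Rop (F : ℝ → ℝ → ℝ) : ℝ → ℝ → ℝ := fun r t =>
  (1 / (2 * r)) * ∫ s in Set.Ioi t, (∫ l in ((s - t) - r)..((s - t) + r), l * F l s)

/-- Values whose supremum is `M₀(F)`. -/
def M0Set (α β γ δ : ℝ) (F : ℝ → ℝ → ℝ) : Set ℝ :=
  {x | ∃ r t : ℝ, 0 < r ∧ 0 ≤ t ∧
    x = |F r t| * r ^ α * (1 + r) ^ β * (1 + r + t) ^ γ * (1 + |r - t|) ^ δ}

/-- Values whose supremum is the second summand of `M₁(F)`. -/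
def M1Set (α β γ δ : ℝ) (F : ℝ → ℝ → ℝ) : Set ℝ :=
  {x | ∃ r t : ℝ, 0 < r ∧ 0 ≤ t ∧
    x = |pdr F r t| * r ^ (α + 1) * (1 + r) ^ (β - 1) * (1 + r + t) ^ γ * (1 + |r - t|) ^ δ}

/-- `M_s(F)` for `s = 0, 1`. -/
def Mnorm (s : ℕ) (α β γ δ : ℝ) (F : ℝ → ℝ → ℝ) : ℝ :=
  if s = 0 then sSup (M0Set α β γ δ F)
  else sSup (M0Set α β γ δ F) + sSup (M1Set α β γ δ F)

/-- Finiteness of `M_s(F)`. -/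
def MFinite (s : ℕ) (α β γ δ : ℝ) (F : ℝ → ℝ → ℝ) : Prop :=
  BddAbove (M0Set α β γ δ F) ∧ (s = 0 ∨ BddAbove (M1Set α β γ δ F))

/-- Energy norm `‖w(t)‖_E` of the radial function `w(|x|,t)` on `ℝ³`. -/
def energy (w : ℝ → ℝ → ℝ) (t : ℝ) : ℝ :=
  Real.sqrt ((1 / 2) * ∫ x : EuclideanSpace ℝ (Fin 3),
    ((pdt w ‖x‖ t) ^ 2 + (pdr w ‖x‖ t) ^ 2))

/-- The nonlinearity `|∂_t u|^p`. -/
def NLt (p : ℝ) (u : ℝ → ℝ → ℝ) : ℝ → ℝ → ℝ := fun r t => |pdt u r t| ^ p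

/-- `(u₁,u₂)` solves the radially symmetric system (S). -/
def solvesS (p q : ℝ) (u₁ u₂ : ℝ → ℝ → ℝ) : Prop :=
  ∀ r t : ℝ, 0 < r → 0 ≤ t →
    pdt (pdt u₁) r t - (pdr (pdr u₁) r t + (2 / r) * pdr u₁ r t) = |pdt u₂ r t| ^ p ∧
    pdt (pdt u₂) r t - (pdr (pdr u₂) r t + (2 / r) * pdr u₂ r t) = |pdt u₁ r t| ^ q

/-- Initial data `(u(·,0), ∂_t u(·,0))` of a function `u(r,t)`. -/
def datum (u : ℝ → ℝ → ℝ) : (ℝ → ℝ) × (ℝ → ℝ) := (fun r => u r 0, fun r => pdt u r 0)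

/-- The sequence `a₀ = 1`, `a_{j+1} = κ₁ (a_j - 1) + κ₂`. -/
def aseq (κ₁ κ₂ : ℝ) : ℕ → ℝ
  | 0 => 1
  | n + 1 => κ₁ * (aseq κ₁ κ₂ n - 1) + κ₂

/-- Auxiliary iteration producing the pairs `((w_j, v_j), (w_{j+1}, v_{j+1}))`. -/
def iterAux (p q : ℝ) (fg1 fg2 : (ℝ → ℝ) × (ℝ → ℝ)) :
    ℕ → ((ℝ → ℝ → ℝ) × (ℝ → ℝ → ℝ)) × ((ℝ → ℝ → ℝ) × (ℝ → ℝ → ℝ))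
  | 0 =>
    ((Kop fg1, Kop fg2),
     (Kop fg1 + Lop (NLt p (Kop fg2)),
      Kop fg2 + Rop (NLt q (Kop fg1 + Lop (NLt p (Kop fg2))))))
  | n + 1 =>
    let prev := iterAux p q fg1 fg2 n
    let wnext := prev.2.1 + Lop (NLt p prev.2.2 - NLt p prev.1.2)
    (prev.2, (wnext, prev.2.2 + Rop (NLt q wnext - NLt q prev.2.1)))

/-- The iterate `w_j`. -/
def witer (p q : ℝ) (fg1 fg2 : (ℝ → ℝ) × (ℝ → ℝ)) (j : ℕ) : ℝ → ℝ → ℝ :=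
  (iterAux p q fg1 fg2 j).1.1

/-- The iterate `v_j`. -/
def viter (p q : ℝ) (fg1 fg2 : (ℝ → ℝ) × (ℝ → ℝ)) (j : ℕ) : ℝ → ℝ → ℝ :=
  (iterAux p q fg1 fg2 j).1.2

/-- The starred iterates `(w_j^*, v_j^*)` built from a solution `(u₁,u₂)`. -/
def starIter (p q : ℝ) (φ1 : (ℝ → ℝ) × (ℝ → ℝ)) (u₁ u₂ : ℝ → ℝ → ℝ) :
    ℕ → (ℝ → ℝ → ℝ) × (ℝ → ℝ → ℝ)
  | 0 => (Kop φ1, u₂ - Rop (NLt q u₁))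
  | n + 1 =>
    let w := Kop φ1 + Lop (NLt p (starIter p q φ1 u₁ u₂ n).2)
    (w, (u₂ - Rop (NLt q u₁)) + Rop (NLt q w))

/-- The quantity `d₁(w, 0) = ‖w‖_{Z²(κ₁ a_{ℓ+1})} + ‖w‖_{Z¹(κ₁ a_{ℓ+1})}^{p-1}` (applied to
differences). -/
def dOne (p q : ℝ) (ℓ : ℕ) (w : ℝ → ℝ → ℝ) : ℝ :=
  Znorm 2 ((p - 1) * aseq (p - 1) (q * (p - 1) - 1) (ℓ + 1)) w +
    Znorm 1 ((p - 1) * aseq (p - 1) (q * (p - 1) - 1) (ℓ + 1)) w ^ (p - 1)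

/-- The quantity `d₂(w, 0) = ‖w‖_{Z²(a_{ℓ+1})} + ‖w‖_{Z¹(a_{ℓ+1})}^{p-1}` (applied to
differences). -/
def dTwo (p q : ℝ) (ℓ : ℕ) (w : ℝ → ℝ → ℝ) : ℝ :=
  Znorm 2 (aseq (p - 1) (q * (p - 1) - 1) (ℓ + 1)) w +
    Znorm 1 (aseq (p - 1) (q * (p - 1) - 1) (ℓ + 1)) w ^ (p - 1)

/-- Membership in the metric ball `D_ε` around `(w_{ℓ+1}, v_{ℓ+1})`. -/
def memD (p q ε : ℝ) (ℓ : ℕ) (fg1 fg2 : (ℝ → ℝ) × (ℝ → ℝ)) (u₁ u₂ : ℝ → ℝ → ℝ) : Prop :=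
  memX 2 u₁ ∧ memX 2 u₂ ∧
  BddAbove (ZSet 2 ((p - 1) * aseq (p - 1) (q * (p - 1) - 1) (ℓ + 1))
    (u₁ - witer p q fg1 fg2 (ℓ + 1))) ∧
  BddAbove (ZSet 1 ((p - 1) * aseq (p - 1) (q * (p - 1) - 1) (ℓ + 1))
    (u₁ - witer p q fg1 fg2 (ℓ + 1))) ∧
  BddAbove (ZSet 2 (aseq (p - 1) (q * (p - 1) - 1) (ℓ + 1))
    (u₂ - viter p q fg1 fg2 (ℓ + 1))) ∧
  BddAbove (ZSet 1 (aseq (p - 1) (q * (p - 1) - 1) (ℓ + 1))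
    (u₂ - viter p q fg1 fg2 (ℓ + 1))) ∧
  dOne p q ℓ (u₁ - witer p q fg1 fg2 (ℓ + 1)) + dTwo p q ℓ (u₂ - viter p q fg1 fg2 (ℓ + 1))
    ≤ ε ^ ((p - 1) * (q + (ℓ : ℝ) * (p + q - 2)))

/-- A function together with candidate first and second order derivatives. -/
structure Jet where
  u : ℝ → ℝ → ℝ
  ur : ℝ → ℝ → ℝ
  ut : ℝ → ℝ → ℝ
  urr : ℝ → ℝ → ℝ
  urt : ℝ → ℝ → ℝ
  utt : ℝ → ℝ → ℝ

/-- The open-closed quarter plane. -/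
def QP : Set (ℝ × ℝ) := Set.Ioi (0:ℝ) ×ˢ Set.Ici (0:ℝ)

structure IsJet (J : Jet) : Prop where
  dr : ∀ r t : ℝ, 0 < r → 0 ≤ t → HasDerivAt (fun x => J.u x t) (J.ur r t) r
  dt : ∀ r t : ℝ, 0 < r → 0 ≤ t → HasDerivWithinAt (fun s => J.u r s) (J.ut r t) (Set.Ici 0) t
  drr : ∀ r t : ℝ, 0 < r → 0 ≤ t → HasDerivAt (fun x => J.ur x t) (J.urr r t) r
  drt : ∀ r t : ℝ, 0 < r → 0 ≤ t → HasDerivAt (fun x => J.ut x t) (J.urt r t) r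
  dtt : ∀ r t : ℝ, 0 < r → 0 ≤ t → HasDerivWithinAt (fun s => J.ut r s) (J.utt r t) (Set.Ici 0) t
  cu : ContinuousOn (fun z : ℝ × ℝ => J.u z.1 z.2) QP
  cr : ContinuousOn (fun z : ℝ × ℝ => J.ur z.1 z.2) QP
  ct : ContinuousOn (fun z : ℝ × ℝ => J.ut z.1 z.2) QP
  crr : ContinuousOn (fun z : ℝ × ℝ => J.urr z.1 z.2) QP
  crt : ContinuousOn (fun z : ℝ × ℝ => J.urt z.1 z.2) QP
  ctt : ContinuousOn (fun z : ℝ × ℝ => J.utt z.1 z.2) QP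
  even : ∀ r t : ℝ, 0 ≤ t → J.u (-r) t = J.u r t

def Jet.zero : Jet := ⟨0, 0, 0, 0, 0, 0⟩
def Jet.add (J K : Jet) : Jet :=
  ⟨J.u + K.u, J.ur + K.ur, J.ut + K.ut, J.urr + K.urr, J.urt + K.urt, J.utt + K.utt⟩
def Jet.sub (J K : Jet) : Jet :=
  ⟨J.u - K.u, J.ur - K.ur, J.ut - K.ut, J.urr - K.urr, J.urt - K.urt, J.utt - K.utt⟩

def Jet.b1 (J : Jet) (r t : ℝ) : ℝ := |J.u r t| + r * (|J.ur r t| + |J.ut r t|)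
def Jet.b2 (J : Jet) (r t : ℝ) : ℝ :=
  |J.u r t| + (1 + r) * (|J.ur r t| + |J.ut r t|) +
    r * (|J.urr r t| + |J.urt r t| + |J.utt r t|)

lemma isJet_zero : IsJet Jet.zero := by
  constructor <;> simp [Jet.zero] <;> intros <;>
  first | exact hasDerivAt_const _ _ | exact hasDerivWithinAt_const _ _ _ | exact continuousOn_const

lemma IsJet.add {J K : Jet} (hJ : IsJet J) (hK : IsJet K) : IsJet (J.add K) where
  dr r t hr ht := (hJ.dr r t hr ht).add (hK.dr r t hr ht)
  dt r t hr ht := (hJ.dt r t hr ht).add (hK.dt r t hr ht)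
  drr r t hr ht := (hJ.drr r t hr ht).add (hK.drr r t hr ht)
  drt r t hr ht := (hJ.drt r t hr ht).add (hK.drt r t hr ht)
  dtt r t hr ht := (hJ.dtt r t hr ht).add (hK.dtt r t hr ht)
  cu := hJ.cu.add hK.cu
  cr := hJ.cr.add hK.cr
  ct := hJ.ct.add hK.ct
  crr := hJ.crr.add hK.crr
  crt := hJ.crt.add hK.crt
  ctt := hJ.ctt.add hK.ctt
  even r t ht := by simp [Jet.add, hJ.even r t ht, hK.even r t ht]

lemma IsJet.sub {J K : Jet} (hJ : IsJet J) (hK : IsJet K) : IsJet (J.sub K) where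
  dr r t hr ht := (hJ.dr r t hr ht).sub (hK.dr r t hr ht)
  dt r t hr ht := (hJ.dt r t hr ht).sub (hK.dt r t hr ht)
  drr r t hr ht := (hJ.drr r t hr ht).sub (hK.drr r t hr ht)
  drt r t hr ht := (hJ.drt r t hr ht).sub (hK.drt r t hr ht)
  dtt r t hr ht := (hJ.dtt r t hr ht).sub (hK.dtt r t hr ht)
  cu := hJ.cu.sub hK.cu
  cr := hJ.cr.sub hK.cr
  ct := hJ.ct.sub hK.ct
  crr := hJ.crr.sub hK.crr
  crt := hJ.crt.sub hK.crt
  ctt := hJ.ctt.sub hK.ctt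
  even r t ht := by simp [Jet.sub, hJ.even r t ht, hK.even r t ht]

lemma Jet.b1_add (J K : Jet) {r t : ℝ} (hr : 0 < r) :
    (J.add K).b1 r t ≤ J.b1 r t + K.b1 r t := by
  simp only [Jet.b1, Jet.add, Pi.add_apply]
  have h1 := abs_add_le (J.u r t) (K.u r t)
  have h2 := mul_le_mul_of_nonneg_left (abs_add_le (J.ur r t) (K.ur r t)) hr.le
  have h3 := mul_le_mul_of_nonneg_left (abs_add_le (J.ut r t) (K.ut r t)) hr.le
  linarith

lemma Jet.b2_add (J K : Jet) {r t : ℝ} (hr : 0 < r) :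
    (J.add K).b2 r t ≤ J.b2 r t + K.b2 r t := by
  simp only [Jet.b2, Jet.add, Pi.add_apply]
  have h0 : 0 ≤ 1 + r := by linarith
  have h1 := abs_add_le (J.u r t) (K.u r t)
  have h2 := mul_le_mul_of_nonneg_left (abs_add_le (J.ur r t) (K.ur r t)) h0
  have h3 := mul_le_mul_of_nonneg_left (abs_add_le (J.ut r t) (K.ut r t)) h0
  have h4 := mul_le_mul_of_nonneg_left (abs_add_le (J.urr r t) (K.urr r t)) hr.le
  have h5 := mul_le_mul_of_nonneg_left (abs_add_le (J.urt r t) (K.urt r t)) hr.le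
  have h6 := mul_le_mul_of_nonneg_left (abs_add_le (J.utt r t) (K.utt r t)) hr.le
  linarith

lemma Jet.b1_nonneg (J : Jet) {r t : ℝ} (hr : 0 < r) : 0 ≤ J.b1 r t := by
  unfold Jet.b1; positivity

lemma Jet.b2_nonneg (J : Jet) {r t : ℝ} (hr : 0 < r) : 0 ≤ J.b2 r t := by
  unfold Jet.b2; positivity

lemma Jet.b1_le_b2 (J : Jet) {r t : ℝ} (hr : 0 < r) : J.b1 r t ≤ J.b2 r t := by
  unfold Jet.b1 Jet.b2
  have : 0 ≤ r * (|J.urr r t| + |J.urt r t| + |J.utt r t|) := by positivity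
  have : 0 ≤ (|J.ur r t| + |J.ut r t|) := by positivity
  nlinarith

lemma Jet.ext_add_sub (J K : Jet) : (J.sub K).add K = J := by
  cases J; cases K; simp [Jet.sub, Jet.add]

lemma Jet.add_sub_cancel (J K : Jet) : (J.add K).sub J = K := by
  cases J; cases K; simp [Jet.sub, Jet.add]

lemma Jet.sub_zero (J : Jet) : J.sub Jet.zero = J := by
  cases J; simp [Jet.sub, Jet.zero]

lemma Jet.zero_b2 (r t : ℝ) : Jet.zero.b2 r t = 0 := by simp [Jet.zero, Jet.b2]

/-! Comparison of `deriv` with jets. -/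

lemma IsJet.pdr_eq {J : Jet} (hJ : IsJet J) {r t : ℝ} (hr : 0 < r) (ht : 0 ≤ t) :
    pdr J.u r t = J.ur r t := (hJ.dr r t hr ht).deriv

lemma IsJet.pdt_eq {J : Jet} (hJ : IsJet J) {r t : ℝ} (hr : 0 < r) (ht : 0 < t) :
    pdt J.u r t = J.ut r t :=
  ((hJ.dt r t hr ht.le).hasDerivAt (Ici_mem_nhds ht)).deriv

lemma IsJet.pdrr_eq {J : Jet} (hJ : IsJet J) {r t : ℝ} (hr : 0 < r) (ht : 0 ≤ t) :
    pdr (pdr J.u) r t = J.urr r t := by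
  have h : (fun x => pdr J.u x t) =ᶠ[nhds r] fun x => J.ur x t := by
    filter_upwards [Ioi_mem_nhds hr] with x hx
    exact hJ.pdr_eq hx ht
  exact h.deriv_eq.trans (hJ.drr r t hr ht).deriv

lemma IsJet.pdrt_eq {J : Jet} (hJ : IsJet J) {r t : ℝ} (hr : 0 < r) (ht : 0 < t) :
    pdr (pdt J.u) r t = J.urt r t := by
  have h : (fun x => pdt J.u x t) =ᶠ[nhds r] fun x => J.ut x t := by
    filter_upwards [Ioi_mem_nhds hr] with x hx
    exact hJ.pdt_eq hx ht
  exact h.deriv_eq.trans (hJ.drt r t hr ht.le).deriv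

lemma IsJet.pdtt_eq {J : Jet} (hJ : IsJet J) {r t : ℝ} (hr : 0 < r) (ht : 0 < t) :
    pdt (pdt J.u) r t = J.utt r t := by
  have h : (fun x => pdt J.u r x) =ᶠ[nhds t] fun x => J.ut r x := by
    filter_upwards [Ioi_mem_nhds ht] with x hx
    exact hJ.pdt_eq hr hx
  exact h.deriv_eq.trans ((hJ.dtt r t hr ht.le).hasDerivAt (Ici_mem_nhds ht)).deriv

lemma IsJet.pdt_zero {J : Jet} (hJ : IsJet J) {r : ℝ} (hr : 0 < r) :
    pdt J.u r 0 = J.ut r 0 ∨ pdt J.u r 0 = 0 := by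
  by_cases h : DifferentiableAt ℝ (fun s => J.u r s) 0
  · left
    have h1 : HasDerivWithinAt (fun s => J.u r s) (pdt J.u r 0) (Set.Ici 0) 0 :=
      h.hasDerivAt.hasDerivWithinAt
    exact (uniqueDiffOn_Ici (0:ℝ) 0 Set.self_mem_Ici).eq_deriv _ h1 (hJ.dt r 0 hr le_rfl)
  · right
    exact deriv_zero_of_not_differentiableAt h

lemma junk_deriv {f g : ℝ → ℝ} {r g' : ℝ} (hg : HasDerivAt g g' r)
    (hfg : ∀ᶠ x in nhds r, f x = g x ∨ f x = 0) : |deriv f r| ≤ |g'| := by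
  by_cases h : DifferentiableAt ℝ f r
  swap
  · rw [deriv_zero_of_not_differentiableAt h]; simp
  have hf := h.hasDerivAt
  set d := deriv f r
  by_cases hgr : g r = 0
  · have hfr : f r = 0 := by rcases hfg.self_of_nhds with h | h <;> simp [h, hgr]
    have h1 := (hasDerivAt_iff_tendsto_slope.1 hf).abs
    have h2 := (hasDerivAt_iff_tendsto_slope.1 hg).abs
    refine le_of_tendsto_of_tendsto h1 h2 ?_
    have := (nhdsWithin_le_nhds (s := {r}ᶜ)) hfg
    filter_upwards [this] with x hx
    simp only [slope_def_field, hgr, hfr, sub_zero, abs_div]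
    rcases hx with h | h <;> rw [h]
    simp; positivity
  · have h1 : HasDerivAt (fun x => f x * f x) (d * f r + f r * d) r := hf.mul hf
    have h2 : HasDerivAt (fun x => f x * g x) (d * g r + f r * g') r := hf.mul hg
    have h3 : (fun x => f x * f x) =ᶠ[nhds r] fun x => f x * g x := by
      filter_upwards [hfg] with x hx
      rcases hx with h | h <;> rw [h]; simp
    have h4 := (h1.congr_of_eventuallyEq h3.symm).unique h2
    rcases hfg.self_of_nhds with h | h
    · rw [h] at h4
      have : d = g' := by
        have : (d - g') * g r = 0 := by linarith
        rcases mul_eq_zero.1 this with h | h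
        · linarith
        · exact absurd h hgr
      rw [this]
    · rw [h] at h4
      have : d * g r = 0 := by linarith
      rcases mul_eq_zero.1 this with h | h
      · rw [h]; simp
      · exact absurd h hgr

lemma IsJet.pdtt_zero {J : Jet} (hJ : IsJet J) {r : ℝ} (hr : 0 < r) :
    |pdt (pdt J.u) r 0| ≤ |J.utt r 0| := by
  by_cases h : DifferentiableAt ℝ (fun s => pdt J.u r s) 0
  swap
  · have : pdt (pdt J.u) r 0 = 0 := deriv_zero_of_not_differentiableAt h
    rw [this]; simp
  have h0 : pdt J.u r 0 = J.ut r 0 := by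
    have h1 : Tendsto (fun s => pdt J.u r s) (nhdsWithin 0 (Set.Ioi 0)) (nhds (pdt J.u r 0)) :=
      h.continuousAt.continuousWithinAt
    have h2 : Tendsto (fun s => J.ut r s) (nhdsWithin 0 (Set.Ioi 0)) (nhds (J.ut r 0)) :=
      (hJ.dtt r 0 hr le_rfl).continuousWithinAt.mono Set.Ioi_subset_Ici_self
    refine tendsto_nhds_unique (h1.congr' ?_) h2
    filter_upwards [self_mem_nhdsWithin] with s hs
    exact hJ.pdt_eq hr hs
  have h1 : HasDerivWithinAt (fun s => pdt J.u r s) (pdt (pdt J.u) r 0) (Set.Ici 0) 0 :=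
    h.hasDerivAt.hasDerivWithinAt
  have h2 : HasDerivWithinAt (fun s => pdt J.u r s) (J.utt r 0) (Set.Ici 0) 0 := by
    refine (hJ.dtt r 0 hr le_rfl).congr_of_mem (fun s hs => ?_) Set.self_mem_Ici
    rcases (show (0:ℝ) ≤ s from hs).eq_or_lt with h | h
    · rw [← h, h0]
    · exact hJ.pdt_eq hr h
  rw [(uniqueDiffOn_Ici (0:ℝ) 0 Set.self_mem_Ici).eq_deriv _ h1 h2]

lemma IsJet.abs_pdt_le {J : Jet} (hJ : IsJet J) {r t : ℝ} (hr : 0 < r) (ht : 0 ≤ t) :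
    |pdt J.u r t| ≤ |J.ut r t| := by
  rcases ht.eq_or_lt with h | h
  · subst h
    rcases hJ.pdt_zero hr with h | h <;> rw [h]
    simp
  · rw [hJ.pdt_eq hr h]

lemma IsJet.bracket1_le {J : Jet} (hJ : IsJet J) {r t : ℝ} (hr : 0 < r) (ht : 0 ≤ t) :
    bracket1 J.u r t ≤ J.b1 r t := by
  unfold bracket1 Jet.b1
  rw [hJ.pdr_eq hr ht]
  have h1 := hJ.abs_pdt_le hr ht
  gcongr

lemma IsJet.bracket2_le {J : Jet} (hJ : IsJet J) {r t : ℝ} (hr : 0 < r) (ht : 0 ≤ t) :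
    bracket2 J.u r t ≤ J.b2 r t := by
  unfold bracket2 Jet.b2
  rw [hJ.pdr_eq hr ht, hJ.pdrr_eq hr ht]
  have h1 := hJ.abs_pdt_le hr ht
  have h2 : |pdr (pdt J.u) r t| ≤ |J.urt r t| := by
    rcases ht.eq_or_lt with h | h
    · subst h
      refine junk_deriv (hJ.drt r 0 hr le_rfl) ?_
      filter_upwards [Ioi_mem_nhds hr] with x hx
      exact hJ.pdt_zero hx
    · rw [hJ.pdrt_eq hr h]
  have h3 : |pdt (pdt J.u) r t| ≤ |J.utt r t| := by
    rcases ht.eq_or_lt with h | h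
    · subst h
      exact hJ.pdtt_zero hr
    · rw [hJ.pdtt_eq hr h]
  gcongr

lemma IsJet.bracket1_eq {J : Jet} (hJ : IsJet J) {r t : ℝ} (hr : 0 < r) (ht : 0 < t) :
    bracket1 J.u r t = J.b1 r t := by
  unfold bracket1 Jet.b1
  rw [hJ.pdr_eq hr ht.le, hJ.pdt_eq hr ht]

lemma IsJet.bracket2_eq {J : Jet} (hJ : IsJet J) {r t : ℝ} (hr : 0 < r) (ht : 0 < t) :
    bracket2 J.u r t = J.b2 r t := by
  unfold bracket2 Jet.b2
  rw [hJ.pdr_eq hr ht.le, hJ.pdt_eq hr ht, hJ.pdrr_eq hr ht.le, hJ.pdrt_eq hr ht, hJ.pdtt_eq hr ht]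

lemma slice_cont {f : ℝ × ℝ → ℝ} (hf : ContinuousOn f QP) {r : ℝ} (hr : 0 < r) :
    ContinuousWithinAt (fun t => f (r, t)) (Set.Ici 0) 0 := by
  have h1 : ContinuousWithinAt f QP (r, 0) := hf _ ⟨hr, Set.self_mem_Ici⟩
  exact h1.comp (t := QP) (f := fun t : ℝ => (r, t)) (s := Set.Ici 0) (x := 0)
    (by fun_prop) (fun t ht => ⟨hr, ht⟩)

/-- Pass from bounds for positive times to nonnegative times. -/
lemma extend_zero {b : ℝ × ℝ → ℝ} (hb : ContinuousOn b QP) {W : ℝ → ℝ → ℝ}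
    (hW : ∀ r, 0 < r → ContinuousWithinAt (fun t => W r t) (Set.Ici 0) 0)
    (h : ∀ r t, 0 < r → 0 < t → b (r, t) ≤ W r t) {r t : ℝ} (hr : 0 < r) (ht : 0 ≤ t) :
    b (r, t) ≤ W r t := by
  rcases ht.eq_or_lt with h0 | h0
  · subst h0
    have h1 := (slice_cont hb hr).mono Set.Ioi_subset_Ici_self
    have h2 := (hW r hr).mono Set.Ioi_subset_Ici_self
    refine le_of_tendsto_of_tendsto h1 h2 ?_
    filter_upwards [self_mem_nhdsWithin] with s hs
    exact h r s hr hs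
  · exact h r t hr h0

lemma IsJet.cb1 {J : Jet} (hJ : IsJet J) : ContinuousOn (fun z : ℝ × ℝ => J.b1 z.1 z.2) QP := by
  unfold Jet.b1
  exact hJ.cu.abs.add (continuousOn_fst.mul (hJ.cr.abs.add hJ.ct.abs))

lemma IsJet.cb2 {J : Jet} (hJ : IsJet J) : ContinuousOn (fun z : ℝ × ℝ => J.b2 z.1 z.2) QP := by
  unfold Jet.b2
  exact (hJ.cu.abs.add ((continuousOn_const.add continuousOn_fst).mul (hJ.cr.abs.add hJ.ct.abs))).add
    (continuousOn_fst.mul ((hJ.crr.abs.add hJ.crt.abs).add hJ.ctt.abs))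

/-! Jets of functions in the class `X²`. -/

lemma QP_unique : UniqueDiffOn ℝ QP :=
  (isOpen_Ioi.uniqueDiffOn).prod (uniqueDiffOn_Ici 0)

lemma partials {f : ℝ × ℝ → ℝ} {n : ℕ} (hf : ContDiffOn ℝ ((n+1 : ℕ) : ℕ∞) f QP) :
    ∃ fr ft : ℝ × ℝ → ℝ, ContDiffOn ℝ (n : ℕ∞) fr QP ∧ ContDiffOn ℝ (n : ℕ∞) ft QP ∧
      ∀ r t : ℝ, 0 < r → 0 ≤ t → HasDerivAt (fun x => f (x, t)) (fr (r, t)) r ∧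
        HasDerivWithinAt (fun s => f (r, s)) (ft (r, t)) (Set.Ici 0) t := by
  have hd : ContDiffOn ℝ (n : ℕ∞) (fderivWithin ℝ f QP) QP :=
    hf.fderivWithin QP_unique (by norm_cast)
  have hdiff : DifferentiableOn ℝ f QP := hf.differentiableOn (by simp)
  refine ⟨fun z => fderivWithin ℝ f QP z (1, 0), fun z => fderivWithin ℝ f QP z (0, 1),
    hd.clm_apply contDiffOn_const, hd.clm_apply contDiffOn_const, fun r t hr ht => ?_⟩
  have h1 : HasFDerivWithinAt f (fderivWithin ℝ f QP (r, t)) QP (r, t) :=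
    (hdiff (r, t) ⟨hr, ht⟩).hasFDerivWithinAt
  constructor
  · have h2 : HasDerivWithinAt (fun x : ℝ => (x, t)) (1, 0) (Set.Ioi 0) r :=
      ((hasDerivAt_id r).prodMk (hasDerivAt_const r t)).hasDerivWithinAt
    have h3 := h1.comp_hasDerivWithinAt r h2 (fun x hx => (⟨hx, ht⟩ : (x, t) ∈ QP))
    exact h3.hasDerivAt (Ioi_mem_nhds hr)
  · have h2 : HasDerivWithinAt (fun x : ℝ => (r, x)) (0, 1) (Set.Ici 0) t :=
      ((hasDerivAt_const t r).prodMk (hasDerivAt_id t)).hasDerivWithinAt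
    exact h1.comp_hasDerivWithinAt t h2 (fun x hx => (⟨hr, hx⟩ : (r, x) ∈ QP))

lemma memX.jet {u : ℝ → ℝ → ℝ} (hu : memX 2 u) : ∃ J : Jet, IsJet J ∧ J.u = u := by
  obtain ⟨-, h2, h3⟩ := hu
  have hc : ContDiffOn ℝ ((1+1 : ℕ) : ℕ∞) (fun z : ℝ × ℝ => u z.1 z.2) QP := by
    have h4 : ContDiffOn ℝ ((1+1 : ℕ) : ℕ∞) (fun z : ℝ × ℝ => z.1 * u z.1 z.2) QP :=
      h2.mono (fun z hz => ⟨trivial, hz.2⟩)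
    have h5 : ContDiffOn ℝ ((1+1 : ℕ) : ℕ∞) (fun z : ℝ × ℝ => (z.1 * u z.1 z.2) / z.1) QP :=
      h4.div contDiff_fst.contDiffOn (fun z hz => (show (0:ℝ) < z.1 from hz.1).ne')
    refine h5.congr (fun z hz => ?_)
    have : z.1 ≠ 0 := (show (0:ℝ) < z.1 from hz.1).ne'
    field_simp
  obtain ⟨fr, ft, hr, ht, hd⟩ := partials (n := 1) hc
  obtain ⟨frr, _, hrr, _, hd1⟩ := partials (n := 0) hr
  obtain ⟨frt, ftt, hrt, htt, hd2⟩ := partials (n := 0) ht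
  refine ⟨⟨u, fun r t => fr (r, t), fun r t => ft (r, t), fun r t => frr (r, t),
    fun r t => frt (r, t), fun r t => ftt (r, t)⟩, ?_, rfl⟩
  exact ⟨fun r t h h' => (hd r t h h').1, fun r t h h' => (hd r t h h').2,
    fun r t h h' => (hd1 r t h h').1, fun r t h h' => (hd2 r t h h').1,
    fun r t h h' => (hd2 r t h h').2, hc.continuousOn, hr.continuousOn, ht.continuousOn,
    hrr.continuousOn, hrt.continuousOn, htt.continuousOn, h3⟩

def wZ (ν r t : ℝ) : ℝ := (1 + r + t) ^ (1 - ν) / (1 + |r - t|)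
def wX (ν r t : ℝ) : ℝ := (1 + |r - t|) ^ (-ν)

/-- Weight functions that do not change much below `r` when `r ≤ 1` or `2 r ≤ t`. -/
def ShiftW (W : ℝ → ℝ → ℝ) (K : ℝ) : Prop :=
  1 ≤ K ∧ (∀ r t, 0 ≤ r → 0 ≤ t → 0 ≤ W r t) ∧
  ∀ ρ r t, 0 ≤ ρ → ρ ≤ r → 0 ≤ t → (r ≤ 1 ∨ 2 * r ≤ t) → W ρ t ≤ K * W r t

structure Wave where
  h : ℝ → ℝ → ℝ
  H : ℝ → ℝ → ℝ
  m0 : ℝ → ℝ → ℝ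
  m1 : ℝ → ℝ → ℝ
  m2 : ℝ → ℝ → ℝ
  p0 : ℝ → ℝ → ℝ
  p1 : ℝ → ℝ → ℝ
  p2 : ℝ → ℝ → ℝ

structure IsWave (w : Wave) : Prop where
  dm0r : ∀ r t, HasDerivAt (fun x => w.m0 x t) (w.m1 r t) r
  dp0r : ∀ r t, HasDerivAt (fun x => w.p0 x t) (w.p1 r t) r
  dm1r : ∀ r t, HasDerivAt (fun x => w.m1 x t) (w.m2 r t) r
  dp1r : ∀ r t, HasDerivAt (fun x => w.p1 x t) (w.p2 r t) r
  dm0t : ∀ r t, HasDerivAt (fun s => w.m0 r s) (w.h r t + w.m1 r t) t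
  dp0t : ∀ r t, HasDerivAt (fun s => w.p0 r s) (w.h r t - w.p1 r t) t
  dm1t : ∀ r t, HasDerivAt (fun s => w.m1 r s) (w.H r t + w.m2 r t) t
  dp1t : ∀ r t, HasDerivAt (fun s => w.p1 r s) (w.H r t - w.p2 r t) t
  cm0 : Continuous (fun z : ℝ × ℝ => w.m0 z.1 z.2)
  cm1 : Continuous (fun z : ℝ × ℝ => w.m1 z.1 z.2)
  cm2 : Continuous (fun z : ℝ × ℝ => w.m2 z.1 z.2)
  cp0 : Continuous (fun z : ℝ × ℝ => w.p0 z.1 z.2)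
  cp1 : Continuous (fun z : ℝ × ℝ => w.p1 z.1 z.2)
  cp2 : Continuous (fun z : ℝ × ℝ => w.p2 z.1 z.2)
  cH : Continuous (fun z : ℝ × ℝ => w.H z.1 z.2)
  sym0 : ∀ r t, w.m0 (-r) t = w.p0 r t
  sym1 : ∀ r t, w.m1 (-r) t = - w.p1 r t

def Wave.P (w : Wave) (r t : ℝ) : ℝ := (w.m0 r t - w.p0 r t) / 2
def Wave.Pr (w : Wave) (r t : ℝ) : ℝ := (w.m1 r t - w.p1 r t) / 2
def Wave.Pt (w : Wave) (r t : ℝ) : ℝ := (w.m1 r t + w.p1 r t) / 2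
def Wave.Prr (w : Wave) (r t : ℝ) : ℝ := (w.m2 r t - w.p2 r t) / 2
def Wave.Prt (w : Wave) (r t : ℝ) : ℝ := (w.m2 r t + w.p2 r t) / 2
def Wave.Ptt (w : Wave) (r t : ℝ) : ℝ := w.H r t + (w.m2 r t - w.p2 r t) / 2

def Wave.jet (w : Wave) (u : ℝ → ℝ → ℝ) : Jet where
  u := u
  ur := fun r t => w.Pr r t / r - w.P r t / r ^ 2
  ut := fun r t => w.Pt r t / r
  urr := fun r t => w.Prr r t / r - 2 * w.Pr r t / r ^ 2 + 2 * w.P r t / r ^ 3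
  urt := fun r t => w.Prt r t / r - w.Pt r t / r ^ 2
  utt := fun r t => w.Ptt r t / r

lemma IsWave.dPr {w : Wave} (hw : IsWave w) (r t : ℝ) :
    HasDerivAt (fun x => w.P x t) (w.Pr r t) r :=
  ((hw.dm0r r t).sub (hw.dp0r r t)).div_const 2

lemma IsWave.dPt {w : Wave} (hw : IsWave w) (r t : ℝ) :
    HasDerivAt (fun x => w.P r x) (w.Pt r t) t := by
  have := ((hw.dm0t r t).sub (hw.dp0t r t)).div_const 2
  exact this.congr_deriv (by unfold Wave.Pt; ring)

lemma IsWave.dPrr {w : Wave} (hw : IsWave w) (r t : ℝ) :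
    HasDerivAt (fun x => w.Pr x t) (w.Prr r t) r :=
  ((hw.dm1r r t).sub (hw.dp1r r t)).div_const 2

lemma IsWave.dPrt {w : Wave} (hw : IsWave w) (r t : ℝ) :
    HasDerivAt (fun x => w.Pt x t) (w.Prt r t) r :=
  ((hw.dm1r r t).add (hw.dp1r r t)).div_const 2

lemma IsWave.dPtt {w : Wave} (hw : IsWave w) (r t : ℝ) :
    HasDerivAt (fun x => w.Pt r x) (w.Ptt r t) t := by
  have := ((hw.dm1t r t).add (hw.dp1t r t)).div_const 2
  exact this.congr_deriv (by unfold Wave.Ptt; ring)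

lemma IsWave.P_odd {w : Wave} (hw : IsWave w) (r t : ℝ) : w.P (-r) t = - w.P r t := by
  have h := hw.sym0 (-r) t
  rw [neg_neg] at h
  unfold Wave.P; rw [hw.sym0, ← h]; ring

lemma IsWave.P_zero {w : Wave} (hw : IsWave w) (t : ℝ) : w.P 0 t = 0 := by
  have := hw.P_odd 0 t
  rw [neg_zero] at this; linarith

lemma IsWave.Pt_zero {w : Wave} (hw : IsWave w) (t : ℝ) : w.Pt 0 t = 0 := by
  have := hw.sym1 0 t
  rw [neg_zero] at this
  unfold Wave.Pt; linarith

lemma qp_div {f g : ℝ × ℝ → ℝ} (hf : Continuous f) (hg : Continuous g)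
    (h : ∀ z ∈ QP, g z ≠ 0) : ContinuousOn (fun z => f z / g z) QP :=
  hf.continuousOn.div hg.continuousOn h

lemma IsWave.isJet {w : Wave} (hw : IsWave w) {u : ℝ → ℝ → ℝ}
    (hu : ∀ r t, 0 ≤ t → u r t = 1 / (2 * r) * (w.m0 r t - w.p0 r t)) : IsJet (w.jet u) := by
  have hu' : ∀ r t, 0 ≤ t → u r t = w.P r t / r := by
    intro r t ht
    rw [hu r t ht, Wave.P]
    by_cases hr : r = 0
    · simp [hr]
    · field_simp
  have hne : ∀ z ∈ QP, z.1 ≠ 0 := fun z hz => (show (0:ℝ) < z.1 from hz.1).ne'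
  have hne2 : ∀ z ∈ QP, z.1 ^ 2 ≠ 0 := fun z hz => pow_ne_zero _ (hne z hz)
  have hne3 : ∀ z ∈ QP, z.1 ^ 3 ≠ 0 := fun z hz => pow_ne_zero _ (hne z hz)
  have c0 := hw.cm0
  have c1 := hw.cm1
  have c2 := hw.cm2
  have c3 := hw.cp0
  have c4 := hw.cp1
  have c5 := hw.cp2
  have c6 := hw.cH
  have cP : Continuous (fun z : ℝ × ℝ => w.P z.1 z.2) := by unfold Wave.P; fun_prop
  have cPr : Continuous (fun z : ℝ × ℝ => w.Pr z.1 z.2) := by unfold Wave.Pr; fun_prop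
  have cPt : Continuous (fun z : ℝ × ℝ => w.Pt z.1 z.2) := by unfold Wave.Pt; fun_prop
  have cPrr : Continuous (fun z : ℝ × ℝ => w.Prr z.1 z.2) := by unfold Wave.Prr; fun_prop
  have cPrt : Continuous (fun z : ℝ × ℝ => w.Prt z.1 z.2) := by unfold Wave.Prt; fun_prop
  have cPtt : Continuous (fun z : ℝ × ℝ => w.Ptt z.1 z.2) := by unfold Wave.Ptt; fun_prop
  constructor
  · intro r t hr ht
    have h1 : HasDerivAt (fun x => w.P x t / x) ((w.Pr r t * r - w.P r t * 1) / r ^ 2) r :=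
      (hw.dPr r t).div (hasDerivAt_id r) hr.ne'
    have h2 : (fun x => u x t) = fun x => w.P x t / x := by
      funext x; exact hu' x t ht
    show HasDerivAt (fun x => u x t) (w.Pr r t / r - w.P r t / r ^ 2) r
    rw [h2]
    convert h1 using 1
    field_simp
  · intro r t hr ht
    have h1 : HasDerivWithinAt (fun s => w.P r s / r) (w.Pt r t / r) (Set.Ici 0) t :=
      ((hw.dPt r t).div_const r).hasDerivWithinAt
    exact h1.congr_of_mem (fun s hs => hu' r s hs) ht
  · intro r t hr ht
    have h1 : HasDerivAt (fun x => w.Pr x t / x) ((w.Prr r t * r - w.Pr r t * 1) / r ^ 2) r :=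
      (hw.dPrr r t).div (hasDerivAt_id r) hr.ne'
    have h2 : HasDerivAt (fun x => w.P x t / x ^ 2)
      ((w.Pr r t * r ^ 2 - w.P r t * (2 * r)) / (r ^ 2) ^ 2) r := by
      have h3 : HasDerivAt (fun x : ℝ => x ^ 2) (2 * r) r := by
        simpa using hasDerivAt_pow 2 r
      exact (hw.dPr r t).div h3 (by positivity)
    have h3 := h1.sub h2
    show HasDerivAt (fun x => w.Pr x t / x - w.P x t / x ^ 2)
      (w.Prr r t / r - 2 * w.Pr r t / r ^ 2 + 2 * w.P r t / r ^ 3) r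
    exact h3.congr_deriv (by field_simp; ring)
  · intro r t hr ht
    have h1 : HasDerivAt (fun x => w.Pt x t / x) ((w.Prt r t * r - w.Pt r t * 1) / r ^ 2) r :=
      (hw.dPrt r t).div (hasDerivAt_id r) hr.ne'
    show HasDerivAt (fun x => w.Pt x t / x) (w.Prt r t / r - w.Pt r t / r ^ 2) r
    convert h1 using 1
    field_simp
  · intro r t hr ht
    exact ((hw.dPtt r t).div_const r).hasDerivWithinAt
  · refine (qp_div cP continuous_fst hne).congr (fun z hz => hu' z.1 z.2 hz.2)
  · exact (qp_div cPr continuous_fst hne).sub (qp_div cP (by fun_prop) hne2)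
  · exact qp_div cPt continuous_fst hne
  · exact ((qp_div cPrr continuous_fst hne).sub
      (qp_div (f := fun z => 2 * w.Pr z.1 z.2) (by fun_prop) (by fun_prop) hne2)).add
      (qp_div (f := fun z => 2 * w.P z.1 z.2) (by fun_prop) (by fun_prop) hne3)
  · exact (qp_div cPrt continuous_fst hne).sub (qp_div cPt (by fun_prop) hne2)
  · exact qp_div cPtt continuous_fst hne
  · intro r t ht
    show u (-r) t = u r t
    rw [hu' _ _ ht, hu' _ _ ht, hw.P_odd]
    exact neg_div_neg_eq _ _

lemma mvt0 {f f' : ℝ → ℝ} (hf : ∀ x, HasDerivAt f (f' x) x) (h0 : f 0 = 0) {r : ℝ} (hr : 0 < r) :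
    ∃ c, 0 < c ∧ c < r ∧ f r = f' c * r := by
  obtain ⟨c, hc, h⟩ := exists_hasDerivAt_eq_slope f f' hr
    (fun x _ => (hf x).continuousAt.continuousWithinAt) (fun x _ => hf x)
  refine ⟨c, hc.1, hc.2, ?_⟩
  rw [h, h0, sub_zero, sub_zero, div_mul_cancel₀ _ hr.ne']

/-- The bound lemma for functions of the form `P / r`. -/
lemma IsWave.bounds {w : Wave} (hw : IsWave w) {u : ℝ → ℝ → ℝ}
    (hu : ∀ r t, 0 ≤ t → u r t = 1 / (2 * r) * (w.m0 r t - w.p0 r t))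
    {W : ℝ → ℝ → ℝ} {K A1 A2 : ℝ} (hW : ShiftW W K) (hA1 : 0 ≤ A1) (hA2 : 0 ≤ A2)
    (hm1 : ∀ r t, 0 < r → 0 ≤ t → |w.m1 r t| ≤ A1 * W r t)
    (hp1 : ∀ r t, 0 < r → 0 ≤ t → |w.p1 r t| ≤ A1 * W r t)
    (hm2 : ∀ r t, 0 < r → 0 ≤ t → |w.m2 r t| ≤ A2 * W r t)
    (hp2 : ∀ r t, 0 < r → 0 ≤ t → |w.p2 r t| ≤ A2 * W r t)
    (hH : ∀ r t, 0 < r → 0 ≤ t → |w.H r t| ≤ A2 * W r t)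
    (hP : ∀ r t, 1 ≤ r → 0 ≤ t → t ≤ 2 * r → |w.P r t| ≤ A1 * (r * W r t)) :
    ∀ r t, 0 < r → 0 ≤ t → (w.jet u).b1 r t ≤ (2 * K + 2) * A1 * W r t ∧
      (w.jet u).b2 r t ≤ (20 * K + 20) * (A1 + A2) * W r t := by
  obtain ⟨hK, hW0, hWs⟩ := hW
  have hu' : ∀ r t, 0 ≤ t → u r t = w.P r t / r := by
    intro r t ht
    rw [hu r t ht, Wave.P]
    by_cases hr : r = 0
    · simp [hr]
    · field_simp
  have habs : ∀ a b c : ℝ, |a| ≤ c → |b| ≤ c → |(a - b) / 2| ≤ c ∧ |(a + b) / 2| ≤ c := by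
    intro a b c h1 h2
    rw [abs_le] at h1 h2
    constructor <;> rw [abs_le] <;> constructor <;> linarith
  have hPr : ∀ r t, 0 < r → 0 ≤ t → |w.Pr r t| ≤ A1 * W r t := fun r t h h' =>
    (habs _ _ _ (hm1 r t h h') (hp1 r t h h')).1
  have hPt : ∀ r t, 0 < r → 0 ≤ t → |w.Pt r t| ≤ A1 * W r t := fun r t h h' =>
    (habs _ _ _ (hm1 r t h h') (hp1 r t h h')).2
  have hPrr : ∀ r t, 0 < r → 0 ≤ t → |w.Prr r t| ≤ A2 * W r t := fun r t h h' =>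
    (habs _ _ _ (hm2 r t h h') (hp2 r t h h')).1
  have hPrt : ∀ r t, 0 < r → 0 ≤ t → |w.Prt r t| ≤ A2 * W r t := fun r t h h' =>
    (habs _ _ _ (hm2 r t h h') (hp2 r t h h')).2
  intro r t hr ht
  have hWr := hW0 r t hr.le ht
  have hPtt : |w.Ptt r t| ≤ 2 * (A2 * W r t) := by
    have h1 := hPrr r t hr ht
    have h2 := hH r t hr ht
    have h3 : w.Ptt r t = w.H r t + w.Prr r t := rfl
    rw [h3]
    calc _ ≤ |w.H r t| + |w.Prr r t| := abs_add_le _ _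
      _ ≤ _ := by linarith
  set X1 := A1 * W r t with hX1
  set X2 := A2 * W r t with hX2
  have hX1n : 0 ≤ X1 := by positivity
  have hX2n : 0 ≤ X2 := by positivity
  -- the size of `P`
  have hPb : |w.P r t| ≤ r * (K * X1) := by
    by_cases hc : r ≤ 1 ∨ 2 * r ≤ t
    · obtain ⟨c, hc0, hcr, hceq⟩ := mvt0 (fun x => hw.dPr x t) (hw.P_zero t) hr
      rw [hceq, abs_mul, abs_of_pos hr, mul_comm]
      have h1 := hPr c t hc0 ht
      have h2 := hWs c r t hc0.le hcr.le ht hc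
      have h3 : A1 * W c t ≤ K * X1 := by
        calc A1 * W c t ≤ A1 * (K * W r t) := by gcongr
          _ = K * X1 := by rw [hX1]; ring
      gcongr
      linarith
    · push Not at hc
      have h1 := hP r t hc.1.le ht hc.2.le
      have h2 : X1 ≤ K * X1 := le_mul_of_one_le_left hX1n hK
      calc |w.P r t| ≤ r * X1 := by rw [hX1]; linarith
        _ ≤ _ := by gcongr
  have hub : |u r t| ≤ K * X1 := by
    rw [hu' r t ht, abs_div, abs_of_pos hr, div_le_iff₀ hr]; linarith
  set U := w.Pr r t / r - w.P r t / r ^ 2 with hU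
  have hrU : r * |U| ≤ (1 + K) * X1 := by
    have h1 : r * |U| = |w.Pr r t - w.P r t / r| := by
      rw [← abs_of_pos hr, ← abs_mul, hU, abs_of_pos hr]
      congr 1; field_simp
    have h2 : |w.P r t / r| ≤ K * X1 := by
      rw [abs_div, abs_of_pos hr, div_le_iff₀ hr]; linarith
    rw [h1]
    calc _ ≤ |w.Pr r t| + |w.P r t / r| := abs_sub _ _
      _ ≤ _ := by linarith [hPr r t hr ht]
  set V := w.Pt r t / r with hV
  have hrV : r * |V| ≤ X1 := by
    have h1 : r * |V| = |w.Pt r t| := by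
      rw [← abs_of_pos hr, ← abs_mul, hV, abs_of_pos hr]
      congr 1; field_simp
    rw [h1]; exact hPt r t hr ht
  have hUb : |U| ≤ (1 + K) * (X1 + X2) := by
    rcases le_total r 1 with h1 | h1
    · have hd : ∀ x, HasDerivAt (fun x => x * w.Pr x t - w.P x t) (x * w.Prr x t) x := by
        intro x
        have := ((hasDerivAt_id x).mul (hw.dPrr x t)).sub (hw.dPr x t)
        exact this.congr_deriv (by simp)
      obtain ⟨c, hc0, hcr, hceq⟩ := mvt0 hd (by simp [hw.P_zero]) hr
      have h2 : U = c * w.Prr c t / r := by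
        have : U = (r * w.Pr r t - w.P r t) / r ^ 2 := by rw [hU]; field_simp
        rw [this, hceq]; field_simp
      have h3 : |w.Prr c t| ≤ K * X2 := by
        calc |w.Prr c t| ≤ A2 * W c t := hPrr c t hc0 ht
          _ ≤ A2 * (K * W r t) := by gcongr; exact hWs c r t hc0.le hcr.le ht (Or.inl h1)
          _ = K * X2 := by rw [hX2]; ring
      have h4 : |U| ≤ K * X2 := by
        rw [h2, abs_div, abs_mul, abs_of_pos hr, abs_of_pos hc0, div_le_iff₀ hr]
        calc c * |w.Prr c t| ≤ r * (K * X2) := by gcongr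
          _ = _ := by ring
      nlinarith
    · have : |U| ≤ r * |U| := le_mul_of_one_le_left (abs_nonneg _) h1
      nlinarith
  have hVb : |V| ≤ K * (X1 + X2) := by
    rcases le_total r 1 with h1 | h1
    · obtain ⟨c, hc0, hcr, hceq⟩ := mvt0 (fun x => hw.dPrt x t) (hw.Pt_zero t) hr
      have h2 : V = w.Prt c t := by rw [hV, hceq]; field_simp
      have h3 : |w.Prt c t| ≤ K * X2 := by
        calc |w.Prt c t| ≤ A2 * W c t := hPrt c t hc0 ht
          _ ≤ A2 * (K * W r t) := by gcongr; exact hWs c r t hc0.le hcr.le ht (Or.inl h1)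
          _ = K * X2 := by rw [hX2]; ring
      rw [h2]; nlinarith
    · have : |V| ≤ r * |V| := le_mul_of_one_le_left (abs_nonneg _) h1
      nlinarith
  have hrr : r * |w.Prr r t / r - 2 * w.Pr r t / r ^ 2 + 2 * w.P r t / r ^ 3| ≤ X2 + 2 * |U| := by
    have h1 : r * |w.Prr r t / r - 2 * w.Pr r t / r ^ 2 + 2 * w.P r t / r ^ 3|
        = |w.Prr r t - 2 * U| := by
      rw [← abs_of_pos hr, ← abs_mul, hU, abs_of_pos hr]
      congr 1; field_simp; ring
    rw [h1]
    calc _ ≤ |w.Prr r t| + |2 * U| := abs_sub _ _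
      _ ≤ _ := by rw [abs_mul, abs_two]; linarith [hPrr r t hr ht]
  have hrt : r * |w.Prt r t / r - w.Pt r t / r ^ 2| ≤ X2 + |V| := by
    have h1 : r * |w.Prt r t / r - w.Pt r t / r ^ 2| = |w.Prt r t - V| := by
      rw [← abs_of_pos hr, ← abs_mul, hV, abs_of_pos hr]
      congr 1; field_simp
    rw [h1]
    calc _ ≤ |w.Prt r t| + |V| := abs_sub _ _
      _ ≤ _ := by linarith [hPrt r t hr ht]
  have htt : r * |w.Ptt r t / r| ≤ 2 * X2 := by
    have h1 : r * |w.Ptt r t / r| = |w.Ptt r t| := by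
      rw [← abs_of_pos hr, ← abs_mul, abs_of_pos hr]
      congr 1; field_simp
    rw [h1]; exact hPtt
  constructor
  · show |u r t| + r * (|U| + |V|) ≤ _
    rw [mul_assoc]; nlinarith
  · show |u r t| + (1 + r) * (|U| + |V|) +
      r * (|w.Prr r t / r - 2 * w.Pr r t / r ^ 2 + 2 * w.P r t / r ^ 3| +
        |w.Prt r t / r - w.Pt r t / r ^ 2| + |w.Ptt r t / r|) ≤ _
    have : (20 * K + 20) * (A1 + A2) * W r t = (20 * K + 20) * (X1 + X2) := by
      rw [hX1, hX2]; ring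
    rw [this]
    have e1 : 0 ≤ K * X1 := by positivity
    have e2 : 0 ≤ K * X2 := by positivity
    have e3 : (1 + K) * (X1 + X2) = X1 + X2 + K * X1 + K * X2 := by ring
    have e4 : K * (X1 + X2) = K * X1 + K * X2 := by ring
    have e5 : (20 * K + 20) * (X1 + X2) = 20 * (X1 + X2 + K * X1 + K * X2) := by ring
    have e6 : (1 + K) * X1 = X1 + K * X1 := by ring
    rw [e5, mul_add r, mul_add r, add_mul, mul_add r]
    linarith

/-! Properties of the weights. -/

lemma wZ_nonneg (ν r t : ℝ) (hr : 0 ≤ r) (ht : 0 ≤ t) : 0 ≤ wZ ν r t := by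
  unfold wZ; positivity

lemma wX_nonneg (ν r t : ℝ) : 0 ≤ wX ν r t := by
  unfold wX; positivity

lemma shift_aux {ρ r t : ℝ} (hρ : 0 ≤ ρ) (hr : ρ ≤ r) (ht : 0 ≤ t) (h : r ≤ 1 ∨ 2 * r ≤ t) :
    1 + r + t ≤ 2 * (1 + ρ + t) ∧ 1 + |r - t| ≤ 2 * (1 + |ρ - t|) := by
  constructor
  · rcases h with h | h <;> linarith
  · rcases h with h | h <;> rcases abs_cases (r - t) with h1 | h1 <;>
      rcases abs_cases (ρ - t) with h2 | h2 <;> linarith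

lemma rpow_comp {x y c e : ℝ} (hx : 0 < x) (hy : 0 < y) (hxy : x ≤ c * y) (hyx : y ≤ c * x)
    (hc : 0 < c) : x ^ e ≤ c ^ |e| * y ^ e := by
  rcases le_total 0 e with h | h
  · rw [abs_of_nonneg h, ← mul_rpow hc.le hy.le]
    exact rpow_le_rpow hx.le hxy h
  · rw [abs_of_nonpos h]
    have h1 : (y / c) ≤ x := by rw [div_le_iff₀ hc]; linarith
    have h2 : x ^ e ≤ (y / c) ^ e := rpow_le_rpow_of_nonpos (by positivity) h1 h
    rw [div_rpow hy.le hc.le] at h2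
    rw [rpow_neg hc.le]
    calc _ ≤ _ := h2
      _ = _ := by field_simp

lemma shift_wZ (ν : ℝ) : ShiftW (wZ ν) (2 ^ |1 - ν| * 2) := by
  refine ⟨?_, fun r t hr ht => wZ_nonneg ν r t hr ht, ?_⟩
  · have : (1:ℝ) ≤ 2 ^ |1 - ν| := one_le_rpow (by norm_num) (abs_nonneg _)
    linarith
  · intro ρ r t hρ hr ht h
    obtain ⟨h1, h2⟩ := shift_aux hρ hr ht h
    have hr0 : 0 ≤ r := hρ.trans hr
    unfold wZ
    have h3 : (1 + ρ + t) ^ (1 - ν) ≤ 2 ^ |1 - ν| * (1 + r + t) ^ (1 - ν) :=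
      rpow_comp (by positivity) (by positivity) (by linarith) h1 (by norm_num)
    rw [div_le_iff₀ (by positivity)]
    calc _ ≤ _ := h3
      _ = 2 ^ |1 - ν| * (1 + r + t) ^ (1 - ν) / (1 + |r - t|) * (1 + |r - t|) := by
        field_simp
      _ ≤ 2 ^ |1 - ν| * (1 + r + t) ^ (1 - ν) / (1 + |r - t|) * (2 * (1 + |ρ - t|)) := by gcongr
      _ = _ := by ring

lemma shift_wX {ν : ℝ} (hν : 0 ≤ ν) : ShiftW (wX ν) (2 ^ ν) := by
  refine ⟨one_le_rpow (by norm_num) hν, fun r t hr ht => wX_nonneg ν r t, ?_⟩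
  intro ρ r t hρ hr ht h
  obtain ⟨h1, h2⟩ := shift_aux hρ hr ht h
  unfold wX
  have h3 : ((1 + |r - t|) / 2) ≤ 1 + |ρ - t| := by linarith
  have h4 : (1 + |ρ - t|) ^ (-ν) ≤ ((1 + |r - t|) / 2) ^ (-ν) :=
    rpow_le_rpow_of_nonpos (by positivity) h3 (by linarith)
  rw [div_rpow (by positivity) (by norm_num), rpow_neg (by norm_num : (0:ℝ) ≤ 2)] at h4
  calc _ ≤ _ := h4
    _ = _ := by field_simp

lemma cont_wZ (ν : ℝ) {r : ℝ} (hr : 0 < r) :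
    ContinuousWithinAt (fun t => wZ ν r t) (Set.Ici 0) 0 := by
  apply ContinuousAt.continuousWithinAt
  unfold wZ
  refine ContinuousAt.div ?_ (by fun_prop) (by positivity)
  exact ContinuousAt.rpow_const (by fun_prop) (Or.inl (by simp; linarith))

lemma abs_rt_le {r t : ℝ} (hr : 0 ≤ r) (ht : 0 ≤ t) : |r - t| ≤ r + t := by
  rw [abs_le]; constructor <;> linarith

lemma wZ_anti {ν ν' r t : ℝ} (h : ν ≤ ν') (hr : 0 ≤ r) (ht : 0 ≤ t) : wZ ν' r t ≤ wZ ν r t := by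
  unfold wZ
  gcongr
  linarith

lemma wX_anti {ν ν' r t : ℝ} (h : ν ≤ ν') : wX ν' r t ≤ wX ν r t := by
  unfold wX
  apply rpow_le_rpow_of_exponent_le
  · linarith [abs_nonneg (r - t)]
  · linarith

lemma wX_eq (ν r t : ℝ) : wX ν r t = (1 + |r - t|) ^ (1 - ν) / (1 + |r - t|) := by
  have h : 0 < 1 + |r - t| := by positivity
  unfold wX
  rw [eq_div_iff h.ne', ← rpow_add_one h.ne']
  congr 1; ring

lemma wX_le_wZ {ν r t : ℝ} (h : ν ≤ 1) (hr : 0 ≤ r) (ht : 0 ≤ t) : wX ν r t ≤ wZ ν r t := by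
  rw [wX_eq, wZ]
  have := abs_rt_le hr ht
  gcongr ?_ / _
  exact rpow_le_rpow (by positivity) (by linarith) (by linarith)

lemma wZ_le_wX {ν r t : ℝ} (h : 1 ≤ ν) (hr : 0 ≤ r) (ht : 0 ≤ t) : wZ ν r t ≤ wX ν r t := by
  rw [wX_eq, wZ]
  have := abs_rt_le hr ht
  gcongr ?_ / _
  exact rpow_le_rpow_of_nonpos (by positivity) (by linarith) (by linarith)

lemma ZSet_bound {s : ℕ} {ν B : ℝ} {u : ℝ → ℝ → ℝ}
    (h : ∀ r t, 0 < r → 0 ≤ t → bracketS s u r t ≤ B * wZ ν r t) (x : ℝ) (hx : x ∈ ZSet s ν u) :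
    x ≤ B := by
  obtain ⟨r, t, hr, ht, rfl⟩ := hx
  have h1 := h r t hr ht
  have h2 : 0 < 1 + r + t := by positivity
  have h3 : 0 < 1 + |r - t| := by positivity
  calc bracketS s u r t * (1 + r + t) ^ (ν - 1) * (1 + |r - t|)
      ≤ B * wZ ν r t * (1 + r + t) ^ (ν - 1) * (1 + |r - t|) := by gcongr
    _ = B * ((1 + r + t) ^ (1 - ν) * (1 + r + t) ^ (ν - 1)) := by
      unfold wZ; field_simp
    _ = B := by rw [← rpow_add h2]; simp

lemma XSet_bound {s : ℕ} {ν B : ℝ} {u : ℝ → ℝ → ℝ}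
    (h : ∀ r t, 0 < r → 0 ≤ t → bracketS s u r t ≤ B * wX ν r t) (x : ℝ) (hx : x ∈ XSet s ν u) :
    x ≤ B := by
  obtain ⟨r, t, hr, ht, rfl⟩ := hx
  have h1 := h r t hr ht
  have h3 : 0 < 1 + |r - t| := by positivity
  calc bracketS s u r t * (1 + |r - t|) ^ ν
      ≤ B * wX ν r t * (1 + |r - t|) ^ ν := by gcongr
    _ = B * ((1 + |r - t|) ^ (-ν) * (1 + |r - t|) ^ ν) := by
      unfold wX; ring
    _ = B := by rw [← rpow_add h3]; simp

lemma Znorm_pointwise {s : ℕ} {ν : ℝ} {u : ℝ → ℝ → ℝ} (h : BddAbove (ZSet s ν u)) {r t : ℝ}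
    (hr : 0 < r) (ht : 0 ≤ t) : bracketS s u r t ≤ Znorm s ν u * wZ ν r t := by
  have h1 : bracketS s u r t * (1 + r + t) ^ (ν - 1) * (1 + |r - t|) ≤ Znorm s ν u :=
    le_csSup h ⟨r, t, hr, ht, rfl⟩
  have h2 : 0 < 1 + r + t := by positivity
  have h3 : 0 < 1 + |r - t| := by positivity
  have h4 := wZ_nonneg ν r t hr.le ht
  calc bracketS s u r t = bracketS s u r t * ((1 + r + t) ^ (ν - 1) * (1 + r + t) ^ (1 - ν)) := by
        rw [← rpow_add h2]; simp
    _ = bracketS s u r t * (1 + r + t) ^ (ν - 1) * (1 + |r - t|) * wZ ν r t := by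
      unfold wZ; field_simp
    _ ≤ _ := by gcongr

/-- `h` is continuous and has an `x`-derivative `h'` off `x = 0`. -/
structure GP (h h' : ℝ → ℝ → ℝ) : Prop where
  ch : Continuous (fun z : ℝ × ℝ => h z.1 z.2)
  dh : ∀ x s, x ≠ 0 → HasDerivAt (fun y => h y s) (h' x s) x
  ch' : ContinuousOn (fun z : ℝ × ℝ => h' z.1 z.2) {z | z.1 ≠ 0}

lemma lip_seg {f f' : ℝ → ℝ} (hf : Continuous f) (hd : ∀ x, x ≠ 0 → HasDerivAt f (f' x) x)
    {M a b : ℝ} (hab : a ≤ b) (hM : ∀ x, a < x → x < b → |f' x| ≤ M) :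
    |f b - f a| ≤ M * (b - a) := by
  have key : ∀ a' b' : ℝ, a' ≤ b' → a ≤ a' → b' ≤ b → (∀ x, a' < x → x < b' → x ≠ 0) →
      |f b' - f a'| ≤ M * (b' - a') := by
    intro a' b' h1 h2 h3 h4
    rcases h1.eq_or_lt with h | h
    · subst h; simp
    obtain ⟨c, hc, he⟩ := exists_hasDerivAt_eq_slope f f' h hf.continuousOn
      (fun x hx => hd x (h4 x hx.1 hx.2))
    have h5 : f b' - f a' = f' c * (b' - a') := by
      rw [he, div_mul_cancel₀]; linarith
    rw [h5, abs_mul, abs_of_pos (by linarith : 0 < b' - a')]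
    have := hM c (by linarith [hc.1]) (by linarith [hc.2])
    have : 0 ≤ b' - a' := by linarith
    gcongr
  by_cases h0 : a < 0 ∧ 0 < b
  · have h1 := key a 0 h0.1.le le_rfl h0.2.le (fun x _ hx => hx.ne)
    have h2 := key 0 b h0.2.le h0.1.le le_rfl (fun x hx _ => hx.ne')
    have h3 := abs_add_le (f b - f 0) (f 0 - f a)
    rw [sub_add_sub_cancel] at h3
    linarith
  · refine key a b hab le_rfl le_rfl (fun x h1 h2 h3 => h0 ?_)
    subst h3; exact ⟨h1, h2⟩

lemma lip_seg' {f f' : ℝ → ℝ} (hf : Continuous f) (hd : ∀ x, x ≠ 0 → HasDerivAt f (f' x) x)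
    {M a b : ℝ} (hM : ∀ x, min a b < x → x < max a b → |f' x| ≤ M) :
    |f b - f a| ≤ M * |b - a| := by
  rcases le_total a b with h | h
  · rw [abs_of_nonneg (sub_nonneg.2 h)]
    refine lip_seg hf hd h ?_
    rwa [min_eq_left h, max_eq_right h] at hM
  · rw [abs_sub_comm, abs_sub_comm b a, abs_of_nonneg (sub_nonneg.2 h)]
    refine lip_seg hf hd h ?_
    rwa [min_eq_right h, max_eq_left h] at hM

lemma GP.cont_line {h h' : ℝ → ℝ → ℝ} (H : GP h h') (c x : ℝ) :
    Continuous (fun s => h (x + c * s) s) :=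
  H.ch.comp (f := fun s : ℝ => (x + c * s, s)) (by fun_prop)

lemma GP.meas_line {h h' : ℝ → ℝ → ℝ} (H : GP h h') {c : ℝ} (hc : c ≠ 0) (x : ℝ) :
    Measurable (fun s => h' (x + c * s) s) := by
  apply measurable_of_continuousOn_compl_singleton (-x / c)
  refine H.ch'.comp (f := fun s : ℝ => (x + c * s, s)) (by fun_prop) ?_
  intro s hs h0
  apply hs
  simp only at h0
  show s = -x / c
  field_simp; linarith

lemma ae_line {c : ℝ} (hc : c ≠ 0) (x : ℝ) (S : Set ℝ) :
    ∀ᵐ s ∂(volume.restrict S), x + c * s ≠ 0 := by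
  apply ae_restrict_of_ae
  rw [ae_iff]
  refine measure_mono_null (t := {-x / c}) ?_ (by simp)
  intro s hs
  simp only [not_not, Set.mem_ofPred_eq] at hs
  show s = -x / c
  field_simp; linarith

lemma GP.param {h h' : ℝ → ℝ → ℝ} (H : GP h h') {c : ℝ} (hc : c ≠ 0) (S : Set ℝ)
    (hinteg : ∀ x, IntegrableOn (fun s => h (x + c * s) s) S)
    (hdom : ∀ x0, ∃ G : ℝ → ℝ, IntegrableOn G S ∧
      ∀ x s, |x - x0| < 1 → |h' (x + c * s) s| ≤ G s) :
    (∀ x, HasDerivAt (fun x => ∫ s in S, h (x + c * s) s) (∫ s in S, h' (x + c * s) s) x) ∧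
    Continuous (fun x => ∫ s in S, h' (x + c * s) s) := by
  constructor
  · intro x0
    obtain ⟨G, hG, hGb⟩ := hdom x0
    have h1 := hasDerivAt_integral_of_dominated_loc_of_lip (μ := volume.restrict S)
      (F := fun x s => h (x + c * s) s) (F' := fun s => h' (x0 + c * s) s) (x₀ := x0)
      (s := Metric.ball x0 1) (bound := G) (Metric.ball_mem_nhds x0 one_pos)
      (Eventually.of_forall fun x => (H.cont_line c x).aestronglyMeasurable)
      (hinteg x0) (H.meas_line hc x0).aestronglyMeasurable
      (Eventually.of_forall ?_) hG ?_
    · exact h1.2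
    · intro s
      apply LipschitzOnWith.of_dist_le_mul
      intro x hx y hy
      rw [dist_eq_norm, Real.norm_eq_abs, dist_eq_norm, Real.norm_eq_abs]
      rw [Metric.mem_ball, Real.dist_eq] at hx hy
      have h2 : Continuous fun y => h y s :=
        H.ch.comp (f := fun y : ℝ => (y, s)) (by fun_prop)
      have hG0 : |h' (x0 + c * s) s| ≤ G s := hGb x0 s (by simp)
      have h3 := lip_seg' h2 (fun x hx => H.dh x s hx) (M := |G s|) (a := y + c * s)
        (b := x + c * s) ?_
      · simpa using h3
      · intro z hz1 hz2
        have h4 := hGb (z - c * s) s ?_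
        · rw [sub_add_cancel] at h4
          exact h4.trans (le_abs_self _)
        · rw [abs_lt] at *
          rw [min_lt_iff] at hz1; rw [lt_max_iff] at hz2
          constructor
          · rcases hz1 with h | h <;> linarith
          · rcases hz2 with h | h <;> linarith
    · filter_upwards [ae_line hc x0 S] with s hs
      have h2 := (H.dh _ s hs).comp_add_const x0 (c * s)
      exact h2
  · rw [continuous_iff_continuousAt]
    intro x0
    obtain ⟨G, hG, hGb⟩ := hdom x0
    refine continuousAt_of_dominated (bound := G)
      (Eventually.of_forall fun x => (H.meas_line hc x).aestronglyMeasurable) ?_ hG ?_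
    · filter_upwards [Metric.ball_mem_nhds x0 one_pos] with x hx
      exact Eventually.of_forall fun s => hGb x s (by rwa [Metric.mem_ball, Real.dist_eq] at hx)
    · filter_upwards [ae_line hc x0 S] with s hs
      have h2 : ContinuousAt (fun z : ℝ × ℝ => h' z.1 z.2) (x0 + c * s, s) := by
        apply H.ch'.continuousAt
        exact (isOpen_ne_fun continuous_fst continuous_const).mem_nhds hs
      exact ContinuousAt.comp (f := fun x : ℝ => (x + c * s, s)) (x := x0) h2 (by fun_prop)

/-- Characteristic integral from time `0`. -/
def TT (c : ℝ) (h : ℝ → ℝ → ℝ) (x t : ℝ) : ℝ := ∫ s in (0:ℝ)..t, h (x + c * s) s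
def DD (c : ℝ) (h : ℝ → ℝ → ℝ) (r t : ℝ) : ℝ := TT c h (r - c * t) t

lemma GP.TT_param {h h' : ℝ → ℝ → ℝ} (H : GP h h') {c M : ℝ} (hc : c ≠ 0)
    (hM : ∀ x s, |h' x s| ≤ M) (t : ℝ) :
    (∀ x, HasDerivAt (fun x => TT c h x t) (TT c h' x t) x) ∧
    Continuous (fun x => TT c h' x t) := by
  have hI : ∀ x a b, IntegrableOn (fun s => h (x + c * s) s) (Set.Ioc a b) := fun x a b =>
    ((H.cont_line c x).integrableOn_Icc).mono_set Set.Ioc_subset_Icc_self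
  have hG : ∀ a b, ∀ x0 : ℝ, ∃ G : ℝ → ℝ, IntegrableOn G (Set.Ioc a b) ∧
      ∀ x s, |x - x0| < 1 → |h' (x + c * s) s| ≤ G s := fun a b x0 =>
    ⟨fun _ => M, integrableOn_const (by simp), fun x s _ => hM _ _⟩
  unfold TT
  rcases le_total 0 t with ht | ht
  · have := H.param hc (Set.Ioc 0 t) (fun x => hI x _ _) (hG _ _)
    simpa only [intervalIntegral.integral_of_le ht] using this
  · have := H.param hc (Set.Ioc t 0) (fun x => hI x _ _) (hG _ _)
    simp only [intervalIntegral.integral_of_ge ht]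
    exact ⟨fun x => (this.1 x).neg, this.2.neg⟩

lemma GP.TT_cont {h h' : ℝ → ℝ → ℝ} (H : GP h h') {c M : ℝ} (hc : c ≠ 0)
    (hM : ∀ x s, |h' x s| ≤ M) :
    Continuous (fun z : ℝ × ℝ => TT c h' z.1 z.2) := by
  rw [continuous_iff_continuousAt]
  rintro ⟨x0, t0⟩
  have hi : ∀ x a b, IntervalIntegrable (fun s => h' (x + c * s) s) volume a b := by
    intro x a b
    refine (intervalIntegrable_const (c := M)).mono_fun
      (H.meas_line hc x).aestronglyMeasurable (Eventually.of_forall fun s => ?_)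
    exact (hM _ _).trans (le_abs_self _)
  have h1 : ∀ z : ℝ × ℝ, |TT c h' z.1 z.2 - TT c h' x0 t0| ≤
      |TT c h' z.1 t0 - TT c h' x0 t0| + M * |z.2 - t0| := by
    intro z
    have h2 : TT c h' z.1 z.2 - TT c h' x0 t0 =
      (TT c h' z.1 t0 - TT c h' x0 t0) + ∫ s in t0..z.2, h' (z.1 + c * s) s := by
      unfold TT
      rw [← intervalIntegral.integral_add_adjacent_intervals (hi z.1 0 t0) (hi z.1 t0 z.2)]
      ring
    rw [h2]
    refine (abs_add_le _ _).trans ?_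
    gcongr
    exact intervalIntegral.norm_integral_le_of_norm_le_const (f := fun s => h' (z.1 + c * s) s)
      (C := M) (fun s _ => hM _ _)
  have h3 : Tendsto (fun z : ℝ × ℝ => |TT c h' z.1 t0 - TT c h' x0 t0| + M * |z.2 - t0|)
      (nhds (x0, t0)) (nhds 0) := by
    have h4 : Continuous fun z : ℝ × ℝ => |TT c h' z.1 t0 - TT c h' x0 t0| + M * |z.2 - t0| := by
      have := (H.TT_param hc hM t0).2
      have h5 : Continuous fun z : ℝ × ℝ => TT c h' z.1 t0 := this.comp continuous_fst
      fun_prop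
    have := h4.tendsto (x0, t0)
    simpa using this
  rw [ContinuousAt, tendsto_iff_dist_tendsto_zero]
  exact squeeze_zero (fun _ => dist_nonneg) (fun z => h1 z) h3

lemma TT_cont0 {h : ℝ → ℝ → ℝ} (ch : Continuous (fun z : ℝ × ℝ => h z.1 z.2)) (c : ℝ) :
    Continuous (fun z : ℝ × ℝ => TT c h z.1 z.2) := by
  unfold TT
  apply intervalIntegral.continuous_parametric_intervalIntegral_of_continuous
    (f := fun z : ℝ × ℝ => fun s => h (z.1 + c * s) s)
  · exact ch.comp (f := fun y : (ℝ × ℝ) × ℝ => (y.1.1 + c * y.2, y.2)) (by fun_prop)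
  · exact continuous_snd

lemma GP.DD_dr {h h' : ℝ → ℝ → ℝ} (H : GP h h') {c M : ℝ} (hc : c ≠ 0)
    (hM : ∀ x s, |h' x s| ≤ M) (r t : ℝ) :
    HasDerivAt (fun x => DD c h x t) (DD c h' r t) r :=
  ((H.TT_param hc hM t).1 (r - c * t)).comp_sub_const r (c * t)

lemma small_piece {h : ℝ → ℝ → ℝ} (ch : Continuous (fun z : ℝ × ℝ => h z.1 z.2)) (c r t : ℝ) :
    HasDerivAt (fun τ => ∫ s in t..τ, h (r - c * τ + c * s) s) (h r t) t := by
  rw [hasDerivAt_iff_isLittleO, Asymptotics.isLittleO_iff]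
  intro η hη
  have h1 : ContinuousAt (fun z : ℝ × ℝ => h (r - c * z.1 + c * z.2) z.2) (t, t) :=
    (ch.comp (f := fun z : ℝ × ℝ => (r - c * z.1 + c * z.2, z.2)) (by fun_prop)).continuousAt
  obtain ⟨δ, hδ, hd⟩ := Metric.continuousAt_iff.1 h1 η hη
  filter_upwards [Metric.ball_mem_nhds t hδ] with τ hτ
  rw [Metric.mem_ball] at hτ
  have h2 : (∫ s in t..τ, h (r - c * τ + c * s) s) - (τ - t) * h r t =
      ∫ s in t..τ, (h (r - c * τ + c * s) s - h r t) := by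
    rw [intervalIntegral.integral_sub]
    · simp
    · apply Continuous.intervalIntegrable
      exact ch.comp (f := fun s : ℝ => (r - c * τ + c * s, s)) (by fun_prop)
    · simp
  simp only [intervalIntegral.integral_same, sub_zero, smul_eq_mul]
  rw [h2]
  apply intervalIntegral.norm_integral_le_of_norm_le_const
  intro s hs
  have h3 : dist s t < δ := by
    refine lt_of_le_of_lt ?_ hτ
    have := Set.uIoc_subset_uIcc hs
    rw [dist_comm, Real.dist_eq, Real.dist_eq, abs_sub_comm t s]
    exact Set.abs_sub_left_of_mem_uIcc this
  have := hd (x := (τ, s)) (by rw [Prod.dist_eq]; exact max_lt hτ h3)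
  rw [Real.dist_eq] at this
  simp only [sub_add_cancel] at this
  exact this.le

lemma GP.DD_dt {h h' : ℝ → ℝ → ℝ} (H : GP h h') {c M : ℝ} (hc : c ≠ 0)
    (hM : ∀ x s, |h' x s| ≤ M) (r t : ℝ) :
    HasDerivAt (fun τ => DD c h r τ) (h r t - c * DD c h' r t) t := by
  have h1 : (fun τ => DD c h r τ) =
      fun τ => TT c h (r - c * τ) t + ∫ s in t..τ, h (r - c * τ + c * s) s := by
    funext τ
    unfold DD TT
    rw [intervalIntegral.integral_add_adjacent_intervals] <;>
    exact (H.cont_line c _).intervalIntegrable _ _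
  rw [h1]
  have h2 : HasDerivAt (fun τ => r - c * τ) (-c) t := by
    simpa using ((hasDerivAt_id t).const_mul c).const_sub r
  have h3 := HasDerivAt.comp t ((H.TT_param hc hM t).1 (r - c * t)) h2
  have h4 := h3.add (small_piece H.ch c r t)
  refine h4.congr_deriv ?_
  unfold DD; ring

/-- Characteristic integral up to infinity. -/
def TI (c : ℝ) (h : ℝ → ℝ → ℝ) (x : ℝ) : ℝ := ∫ s in Set.Ioi (0:ℝ), h (x + c * s) s
def EE (c : ℝ) (h : ℝ → ℝ → ℝ) (r t : ℝ) : ℝ := TI c h (r - c * t) - DD c h r t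

lemma cmp_shift {x x0 y : ℝ} {a : ℝ} (ha : 0 ≤ a) (h : |x - x0| < 1) :
    (1 + |x + y|) ^ (-a) ≤ 2 ^ a * (1 + |x0 + y|) ^ (-a) := by
  have h1 : (1 + |x0 + y|) / 2 ≤ 1 + |x + y| := by
    have h2 : |x0 + y| ≤ |x + y| + |x - x0| := by
      have := abs_sub (x + y) (x - x0)
      rwa [show x + y - (x - x0) = x0 + y by ring] at this
    have := abs_nonneg (x + y)
    linarith
  have h4 : (1 + |x + y|) ^ (-a) ≤ ((1 + |x0 + y|) / 2) ^ (-a) :=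
    rpow_le_rpow_of_nonpos (by positivity) h1 (by linarith)
  rw [div_rpow (by positivity) (by norm_num), rpow_neg (by norm_num : (0:ℝ) ≤ 2)] at h4
  calc _ ≤ _ := h4
    _ = _ := by field_simp

lemma integrable_ab {a : ℝ} (ha : 1 < a) : Integrable (fun y : ℝ => (1 + |y|) ^ (-a)) := by
  have := integrable_one_add_norm (E := ℝ) (μ := volume) (r := a) (by simpa using ha)
  simpa using this

lemma integrable_line {k : ℝ → ℝ} (hk : Integrable k) {c : ℝ} (hc : c ≠ 0) (x : ℝ) :
    Integrable (fun s => k (x + c * s)) :=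
  (hk.comp_add_left x).comp_mul_left' hc

lemma GP.TI_param {h h' : ℝ → ℝ → ℝ} (H : GP h h') {c M a : ℝ} (hc : c ≠ 0) (ha : 1 < a)
    (hinteg : ∀ x, IntegrableOn (fun s => h (x + c * s) s) (Set.Ioi 0))
    (hM : ∀ x s, |h' x s| ≤ M * (1 + |x|) ^ (-a)) :
    (∀ x, HasDerivAt (TI c h) (TI c h' x) x) ∧ Continuous (TI c h') := by
  have hM0 : 0 ≤ M := by
    have := (abs_nonneg _).trans (hM 0 0)
    simpa using this
  refine H.param hc (Set.Ioi 0) hinteg fun x0 =>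
    ⟨fun s => M * (2 ^ a * (1 + |x0 + c * s|) ^ (-a)), ?_, fun x s hx => (hM _ _).trans ?_⟩
  · exact (((integrable_line (integrable_ab ha) hc x0).const_mul _).const_mul _).integrableOn
  · exact mul_le_mul_of_nonneg_left (cmp_shift (by linarith) hx) hM0

lemma GP.EE_dr {h h' : ℝ → ℝ → ℝ} (H : GP h h') {c M M' a : ℝ} (hc : c ≠ 0) (ha : 1 < a)
    (hinteg : ∀ x, IntegrableOn (fun s => h (x + c * s) s) (Set.Ioi 0))
    (hM : ∀ x s, |h' x s| ≤ M * (1 + |x|) ^ (-a)) (hM' : ∀ x s, |h' x s| ≤ M') (r t : ℝ) :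
    HasDerivAt (fun x => EE c h x t) (EE c h' r t) r :=
  (((H.TI_param hc ha hinteg hM).1 (r - c * t)).comp_sub_const r (c * t)).sub (H.DD_dr hc hM' r t)

lemma GP.EE_dt {h h' : ℝ → ℝ → ℝ} (H : GP h h') {c M M' a : ℝ} (hc : c ≠ 0) (ha : 1 < a)
    (hinteg : ∀ x, IntegrableOn (fun s => h (x + c * s) s) (Set.Ioi 0))
    (hM : ∀ x s, |h' x s| ≤ M * (1 + |x|) ^ (-a)) (hM' : ∀ x s, |h' x s| ≤ M') (r t : ℝ) :
    HasDerivAt (fun τ => EE c h r τ) (-h r t - c * EE c h' r t) t := by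
  have h2 : HasDerivAt (fun τ => r - c * τ) (-c) t := by
    simpa using ((hasDerivAt_id t).const_mul c).const_sub r
  have h3 := HasDerivAt.comp t ((H.TI_param hc ha hinteg hM).1 (r - c * t)) h2
  refine (h3.sub (H.DD_dt hc hM' r t)).congr_deriv ?_
  unfold EE; ring

lemma EE_eq {c : ℝ} {h : ℝ → ℝ → ℝ} {r t : ℝ}
    (hi : IntegrableOn (fun s => h (r - c * t + c * s) s) (Set.Ioi 0)) (ht : 0 ≤ t) :
    EE c h r t = ∫ s in Set.Ioi t, h (r - c * t + c * s) s := by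
  unfold EE DD TT TI
  have h1 : Set.Ioi (0:ℝ) = Set.Ioc 0 t ∪ Set.Ioi t := (Set.Ioc_union_Ioi_eq_Ioi ht).symm
  have h2 := hi
  rw [h1] at h2
  rw [intervalIntegral.integral_of_le ht, h1,
    setIntegral_union (Set.Ioc_disjoint_Ioi le_rfl) measurableSet_Ioi
      (h2.mono_set Set.subset_union_left) (h2.mono_set Set.subset_union_right)]
  ring

/-- A source term with its radial derivative, and qualitative bounds. -/
structure Src (Φ Φ' : ℝ → ℝ → ℝ) (M : ℝ) : Prop where
  cΦ : ContinuousOn (fun z : ℝ × ℝ => Φ z.1 z.2) QP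
  cΦ' : ContinuousOn (fun z : ℝ × ℝ => Φ' z.1 z.2) QP
  d : ∀ l s, 0 < l → 0 ≤ s → HasDerivAt (fun x => Φ x s) (Φ' l s) l
  b0 : ∀ l s, 0 < l → 0 ≤ s → |Φ l s| ≤ M
  b1 : ∀ l s, 0 < l → 0 ≤ s → l * |Φ l s| ≤ M
  b2 : ∀ l s, 0 < l → 0 ≤ s → l * |Φ' l s| ≤ M

def HH (Φ : ℝ → ℝ → ℝ) (l s : ℝ) : ℝ := l * Φ |l| |s|
def HD (Φ Φ' : ℝ → ℝ → ℝ) (l s : ℝ) : ℝ := if l = 0 then 0 else Φ |l| |s| + |l| * Φ' |l| |s|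
def hh (Φ : ℝ → ℝ → ℝ) (x s : ℝ) : ℝ := ∫ y in (0:ℝ)..x, HH Φ y s

lemma HH_odd (Φ : ℝ → ℝ → ℝ) (l s : ℝ) : HH Φ (-l) s = - HH Φ l s := by
  unfold HH; rw [abs_neg]; ring

lemma hh_even (Φ : ℝ → ℝ → ℝ) (x s : ℝ) : hh Φ (-x) s = hh Φ x s := by
  unfold hh
  have := intervalIntegral.integral_comp_neg (fun y => HH Φ y s) (a := 0) (b := x)
  simp only [HH_odd, neg_zero, intervalIntegral.integral_neg] at this
  rw [intervalIntegral.integral_symm, ← this, neg_neg]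

lemma comp_QP {f : ℝ → ℝ → ℝ} (hf : ContinuousOn (fun z : ℝ × ℝ => f z.1 z.2) QP) :
    ContinuousOn (fun z : ℝ × ℝ => f |z.1| |z.2|) {z | z.1 ≠ 0} :=
  hf.comp (f := fun z : ℝ × ℝ => (|z.1|, |z.2|)) (by fun_prop)
    (fun z hz => ⟨abs_pos.2 hz, abs_nonneg z.2⟩)

lemma Src.cHH {Φ Φ' : ℝ → ℝ → ℝ} {M : ℝ} (S : Src Φ Φ' M) :
    Continuous (fun z : ℝ × ℝ => HH Φ z.1 z.2) := by
  rw [continuous_iff_continuousAt]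
  rintro ⟨x, s⟩
  by_cases hx : x = 0
  · subst hx
    have h0 : HH Φ 0 s = 0 := by simp [HH]
    rw [ContinuousAt, tendsto_iff_dist_tendsto_zero]
    have h1 : ∀ z : ℝ × ℝ, dist (HH Φ z.1 z.2) (HH Φ 0 s) ≤ M * |z.1| := by
      intro z
      rw [h0, Real.dist_eq, sub_zero]
      by_cases hz : z.1 = 0
      · simp [HH, hz]
      · unfold HH
        rw [abs_mul, mul_comm]
        have := S.b0 |z.1| |z.2| (abs_pos.2 hz) (abs_nonneg _)
        gcongr
    refine squeeze_zero (fun _ => dist_nonneg) h1 ?_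
    have h2 : Continuous fun z : ℝ × ℝ => M * |z.1| := by fun_prop
    simpa using h2.tendsto (0, s)
  · have h1 : ContinuousOn (fun z : ℝ × ℝ => HH Φ z.1 z.2) {z | z.1 ≠ 0} :=
      continuousOn_fst.mul (comp_QP S.cΦ)
    exact h1.continuousAt ((isOpen_ne_fun continuous_fst continuous_const).mem_nhds hx)

lemma Src.gp {Φ Φ' : ℝ → ℝ → ℝ} {M : ℝ} (S : Src Φ Φ' M) : GP (HH Φ) (HD Φ Φ') where
  ch := S.cHH
  dh := by
    intro x s hx
    have hs := abs_nonneg s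
    rcases lt_or_gt_of_ne hx with h | h
    · have h1 : HasDerivAt (fun y => Φ (-y) |s|) (-Φ' (-x) |s|) x := by
        have h0 := S.d (-x) |s| (by linarith) hs
        have := HasDerivAt.comp x h0 (hasDerivAt_neg x)
        exact this.congr_deriv (by ring)
      have h2 := (hasDerivAt_id x).mul h1
      have h3 : (fun y => HH Φ y s) =ᶠ[nhds x] (id * fun y => Φ (-y) |s|) := by
        filter_upwards [Iio_mem_nhds h] with y hy
        simp [HH, abs_of_neg (show y < 0 from hy)]
      refine (h2.congr_of_eventuallyEq h3).congr_deriv ?_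
      simp [HD, hx, abs_of_neg h]
    · have h1 := S.d x |s| h hs
      have h2 := (hasDerivAt_id x).mul h1
      have h3 : (fun y => HH Φ y s) =ᶠ[nhds x] (id * fun y => Φ y |s|) := by
        filter_upwards [Ioi_mem_nhds h] with y hy
        simp [HH, abs_of_pos (show 0 < y from hy)]
      refine (h2.congr_of_eventuallyEq h3).congr_deriv ?_
      simp [HD, hx, abs_of_pos h]
  ch' := by
    have h1 : ContinuousOn (fun z : ℝ × ℝ => Φ |z.1| |z.2| + |z.1| * Φ' |z.1| |z.2|)
        {z | z.1 ≠ 0} :=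
      (comp_QP S.cΦ).add (continuousOn_fst.abs.mul (comp_QP S.cΦ'))
    refine h1.congr (fun z hz => ?_)
    have : z.1 ≠ 0 := hz
    simp [HD, this]

lemma Src.gp0 {Φ Φ' : ℝ → ℝ → ℝ} {M : ℝ} (S : Src Φ Φ' M) : GP (hh Φ) (HH Φ) where
  ch := by
    unfold hh
    apply intervalIntegral.continuous_parametric_intervalIntegral_of_continuous
      (f := fun z : ℝ × ℝ => fun y => HH Φ y z.2)
    · exact S.cHH.comp (f := fun y : (ℝ × ℝ) × ℝ => (y.2, y.1.2)) (by fun_prop)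
    · exact continuous_fst
  dh := by
    intro x s _
    have h1 : Continuous fun y => HH Φ y s := S.cHH.comp (f := fun y : ℝ => (y, s)) (by fun_prop)
    exact intervalIntegral.integral_hasDerivAt_right (h1.intervalIntegrable _ _)
      (h1.stronglyMeasurableAtFilter _ _) h1.continuousAt
  ch' := S.cHH.continuousOn

lemma Src.bHH {Φ Φ' : ℝ → ℝ → ℝ} {M : ℝ} (S : Src Φ Φ' M) (x s : ℝ) : |HH Φ x s| ≤ 2 * M := by
  have hM : 0 ≤ M := (abs_nonneg _).trans (S.b0 1 0 one_pos le_rfl)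
  by_cases hx : x = 0
  · simp [HH, hx, hM]
  · have := S.b1 |x| |s| (abs_pos.2 hx) (abs_nonneg _)
    unfold HH; rw [abs_mul]; linarith

lemma Src.bHD {Φ Φ' : ℝ → ℝ → ℝ} {M : ℝ} (S : Src Φ Φ' M) (x s : ℝ) :
    |HD Φ Φ' x s| ≤ 2 * M := by
  have hM : 0 ≤ M := (abs_nonneg _).trans (S.b0 1 0 one_pos le_rfl)
  by_cases hx : x = 0
  · simp [HD, hx, hM]
  · have h1 := S.b0 |x| |s| (abs_pos.2 hx) (abs_nonneg _)
    have h2 := S.b2 |x| |s| (abs_pos.2 hx) (abs_nonneg _)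
    simp only [HD, hx, if_false]
    refine (abs_add_le _ _).trans ?_
    rw [abs_mul, abs_abs]; linarith

lemma hh_sub {Φ Φ' : ℝ → ℝ → ℝ} {M : ℝ} (S : Src Φ Φ' M) (a b s : ℝ) :
    hh Φ b s - hh Φ a s = ∫ y in a..b, HH Φ y s := by
  have h1 : Continuous fun y => HH Φ y s := S.cHH.comp (f := fun y : ℝ => (y, s)) (by fun_prop)
  unfold hh
  exact intervalIntegral.integral_interval_sub_left (h1.intervalIntegrable _ _)
    (h1.intervalIntegrable _ _)

def LW (Φ Φ' : ℝ → ℝ → ℝ) : Wave where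
  h := hh Φ
  H := HH Φ
  m0 := DD (-1) (hh Φ)
  m1 := DD (-1) (HH Φ)
  m2 := DD (-1) (HD Φ Φ')
  p0 := DD 1 (hh Φ)
  p1 := DD 1 (HH Φ)
  p2 := DD 1 (HD Φ Φ')

lemma DD_cont {h : ℝ → ℝ → ℝ} {c : ℝ} (hT : Continuous (fun z : ℝ × ℝ => TT c h z.1 z.2)) :
    Continuous (fun z : ℝ × ℝ => DD c h z.1 z.2) :=
  hT.comp (f := fun z : ℝ × ℝ => (z.1 - c * z.2, z.2)) (by fun_prop)

lemma DD_even {h : ℝ → ℝ → ℝ} (he : ∀ x s, h (-x) s = h x s) (r t : ℝ) :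
    DD (-1) h (-r) t = DD 1 h r t := by
  unfold DD TT
  congr 1; funext s
  rw [← he]; congr 1; ring

lemma DD_odd {h : ℝ → ℝ → ℝ} (he : ∀ x s, h (-x) s = - h x s) (r t : ℝ) :
    DD (-1) h (-r) t = - DD 1 h r t := by
  unfold DD TT
  rw [← intervalIntegral.integral_neg]
  congr 1; funext s
  rw [← he]; congr 1; ring

lemma TI_even {h : ℝ → ℝ → ℝ} (he : ∀ x s, h (-x) s = h x s) (x : ℝ) :
    TI (-1) h (-x) = TI 1 h x := by
  unfold TI
  congr 1; funext s
  rw [← he]; congr 1; ring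

lemma TI_odd {h : ℝ → ℝ → ℝ} (he : ∀ x s, h (-x) s = - h x s) (x : ℝ) :
    TI (-1) h (-x) = - TI 1 h x := by
  unfold TI
  rw [← integral_neg]
  congr 1; funext s
  rw [← he]; congr 1; ring

lemma Src.LW_isWave {Φ Φ' : ℝ → ℝ → ℝ} {M : ℝ} (S : Src Φ Φ' M) : IsWave (LW Φ Φ') where
  dm0r := S.gp0.DD_dr (by norm_num) S.bHH
  dp0r := S.gp0.DD_dr (by norm_num) S.bHH
  dm1r := S.gp.DD_dr (by norm_num) S.bHD
  dp1r := S.gp.DD_dr (by norm_num) S.bHD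
  dm0t := fun r t => (S.gp0.DD_dt (by norm_num) S.bHH r t).congr_deriv (by simp [LW])
  dp0t := fun r t => (S.gp0.DD_dt (by norm_num) S.bHH r t).congr_deriv (by simp [LW])
  dm1t := fun r t => (S.gp.DD_dt (by norm_num) S.bHD r t).congr_deriv (by simp [LW])
  dp1t := fun r t => (S.gp.DD_dt (by norm_num) S.bHD r t).congr_deriv (by simp [LW])
  cm0 := DD_cont (TT_cont0 S.gp0.ch _)
  cm1 := DD_cont (TT_cont0 S.gp.ch _)
  cm2 := DD_cont (S.gp.TT_cont (by norm_num) S.bHD)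
  cp0 := DD_cont (TT_cont0 S.gp0.ch _)
  cp1 := DD_cont (TT_cont0 S.gp.ch _)
  cp2 := DD_cont (S.gp.TT_cont (by norm_num) S.bHD)
  cH := S.cHH
  sym0 := DD_even (hh_even Φ)
  sym1 := DD_odd (HH_odd Φ)

lemma Src.LW_int {Φ Φ' : ℝ → ℝ → ℝ} {M : ℝ} (S : Src Φ Φ' M) (r t : ℝ) :
    (LW Φ Φ').m0 r t - (LW Φ Φ').p0 r t =
      ∫ s in (0:ℝ)..t, ∫ y in (r - (t - s))..(r + (t - s)), HH Φ y s := by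
  show DD (-1) (hh Φ) r t - DD 1 (hh Φ) r t = _
  unfold DD TT
  rw [← intervalIntegral.integral_sub ((S.gp0.cont_line _ _).intervalIntegrable _ _)
    ((S.gp0.cont_line _ _).intervalIntegrable _ _)]
  congr 1; funext s
  rw [← hh_sub S]
  congr 2 <;> ring

lemma Src.LW_eq {Φ Φ' : ℝ → ℝ → ℝ} {M : ℝ} (S : Src Φ Φ' M) {F : ℝ → ℝ → ℝ}
    (hF : ∀ l s, 0 < s → l * F l s = HH Φ l s) (r t : ℝ) (ht : 0 ≤ t) :
    Lop F r t = 1 / (2 * r) * ((LW Φ Φ').m0 r t - (LW Φ Φ').p0 r t) := by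
  rw [S.LW_int]
  unfold Lop
  congr 1
  rw [intervalIntegral.integral_of_le ht, intervalIntegral.integral_of_le ht]
  refine setIntegral_congr_fun measurableSet_Ioc fun s hs => ?_
  simp only [hF _ _ hs.1]

def RW (Φ Φ' : ℝ → ℝ → ℝ) : Wave where
  h := hh Φ
  H := HH Φ
  m0 := fun r t => - EE (-1) (hh Φ) r t
  m1 := fun r t => - EE (-1) (HH Φ) r t
  m2 := fun r t => - EE (-1) (HD Φ Φ') r t
  p0 := fun r t => - EE 1 (hh Φ) r t
  p1 := fun r t => - EE 1 (HH Φ) r t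
  p2 := fun r t => - EE 1 (HD Φ Φ') r t

/-- Extra decay needed for the final value operator. -/
structure RDec (Φ Φ' : ℝ → ℝ → ℝ) (A a : ℝ) : Prop where
  ha : 1 < a
  e0 : ∀ x s, |hh Φ x s| ≤ A * (1 + |s|) ^ (-a)
  e1 : ∀ x s, |HH Φ x s| ≤ A * (1 + |x|) ^ (-a)
  e2 : ∀ x s, |HD Φ Φ' x s| ≤ A * (1 + |x|) ^ (-a)

lemma RDec.i0 {Φ Φ' : ℝ → ℝ → ℝ} {M A a : ℝ} (S : Src Φ Φ' M) (R : RDec Φ Φ' A a) (c x : ℝ) :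
    Integrable (fun s => hh Φ (x + c * s) s) :=
  ((integrable_ab R.ha).const_mul A).mono' (S.gp0.cont_line c x).aestronglyMeasurable
    (Eventually.of_forall fun _ => R.e0 _ _)

lemma RDec.i1 {Φ Φ' : ℝ → ℝ → ℝ} {M A a : ℝ} (S : Src Φ Φ' M) (R : RDec Φ Φ' A a) {c : ℝ}
    (hc : c ≠ 0) (x : ℝ) :
    Integrable (fun s => HH Φ (x + c * s) s) :=
  ((integrable_line (integrable_ab R.ha) hc x).const_mul A).mono'
    (S.gp.cont_line c x).aestronglyMeasurable
    (Eventually.of_forall fun _ => R.e1 _ _)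

lemma RDec.i2 {Φ Φ' : ℝ → ℝ → ℝ} {M A a : ℝ} (S : Src Φ Φ' M) (R : RDec Φ Φ' A a) {c : ℝ}
    (hc : c ≠ 0) (x : ℝ) :
    Integrable (fun s => HD Φ Φ' (x + c * s) s) :=
  ((integrable_line (integrable_ab R.ha) hc x).const_mul A).mono'
    (S.gp.meas_line hc x).aestronglyMeasurable
    (Eventually.of_forall fun _ => R.e2 _ _)

lemma EE_cont {h : ℝ → ℝ → ℝ} {c : ℝ} (hT : Continuous (fun z : ℝ × ℝ => TT c h z.1 z.2))
    (hI : Continuous (TI c h)) :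
    Continuous (fun z : ℝ × ℝ => - EE c h z.1 z.2) := by
  have h1 := DD_cont hT
  have h2 : Continuous fun z : ℝ × ℝ => TI c h (z.1 - c * z.2) := hI.comp (by fun_prop)
  unfold EE; fun_prop

lemma Src.RW_isWave {Φ Φ' : ℝ → ℝ → ℝ} {M A a : ℝ} (S : Src Φ Φ' M) (R : RDec Φ Φ' A a) :
    IsWave (RW Φ Φ') := by
  have j0 : ∀ c x : ℝ, IntegrableOn (fun s => hh Φ (x + c * s) s) (Set.Ioi 0) :=
    fun c x => (R.i0 S c x).integrableOn
  have n1 : (1:ℝ) ≠ 0 := by norm_num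
  have n2 : (-1:ℝ) ≠ 0 := by norm_num
  have j1 : ∀ c : ℝ, c ≠ 0 → ∀ x : ℝ, IntegrableOn (fun s => HH Φ (x + c * s) s) (Set.Ioi 0) :=
    fun c hc x => (R.i1 S hc x).integrableOn
  have ci0 : ∀ c : ℝ, c ≠ 0 → Continuous (TI c (hh Φ)) := fun c hc =>
    continuous_iff_continuousAt.2 fun x =>
      ((S.gp0.TI_param hc R.ha (j0 c) R.e1).1 x).continuousAt
  exact {
    dm0r := fun r t => (S.gp0.EE_dr n2 R.ha (j0 _) R.e1 S.bHH r t).neg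
    dp0r := fun r t => (S.gp0.EE_dr n1 R.ha (j0 _) R.e1 S.bHH r t).neg
    dm1r := fun r t => (S.gp.EE_dr n2 R.ha (j1 _ n2) R.e2 S.bHD r t).neg
    dp1r := fun r t => (S.gp.EE_dr n1 R.ha (j1 _ n1) R.e2 S.bHD r t).neg
    dm0t := fun r t => (S.gp0.EE_dt n2 R.ha (j0 _) R.e1 S.bHH r t).neg.congr_deriv
      (by simp only [RW]; ring)
    dp0t := fun r t => (S.gp0.EE_dt n1 R.ha (j0 _) R.e1 S.bHH r t).neg.congr_deriv
      (by simp only [RW]; ring)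
    dm1t := fun r t => (S.gp.EE_dt n2 R.ha (j1 _ n2) R.e2 S.bHD r t).neg.congr_deriv
      (by simp only [RW]; ring)
    dp1t := fun r t => (S.gp.EE_dt n1 R.ha (j1 _ n1) R.e2 S.bHD r t).neg.congr_deriv
      (by simp only [RW]; ring)
    cm0 := EE_cont (TT_cont0 S.gp0.ch _) (ci0 _ n2)
    cm1 := EE_cont (TT_cont0 S.gp.ch _) (S.gp0.TI_param n2 R.ha (j0 _) R.e1).2
    cm2 := EE_cont (S.gp.TT_cont n2 S.bHD) (S.gp.TI_param n2 R.ha (j1 _ n2) R.e2).2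
    cp0 := EE_cont (TT_cont0 S.gp0.ch _) (ci0 _ n1)
    cp1 := EE_cont (TT_cont0 S.gp.ch _) (S.gp0.TI_param n1 R.ha (j0 _) R.e1).2
    cp2 := EE_cont (S.gp.TT_cont n1 S.bHD) (S.gp.TI_param n1 R.ha (j1 _ n1) R.e2).2
    cH := S.cHH
    sym0 := by
      intro r t
      show -(TI (-1) (hh Φ) (-r - -1 * t) - DD (-1) (hh Φ) (-r) t) =
        -(TI 1 (hh Φ) (r - 1 * t) - DD 1 (hh Φ) r t)
      rw [DD_even (hh_even Φ), show -r - -1 * t = -(r - 1 * t) by ring, TI_even (hh_even Φ)]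
    sym1 := by
      intro r t
      show -(TI (-1) (HH Φ) (-r - -1 * t) - DD (-1) (HH Φ) (-r) t) =
        -(-(TI 1 (HH Φ) (r - 1 * t) - DD 1 (HH Φ) r t))
      rw [DD_odd (HH_odd Φ), show -r - -1 * t = -(r - 1 * t) by ring, TI_odd (HH_odd Φ)]
      ring }

lemma Src.RW_int {Φ Φ' : ℝ → ℝ → ℝ} {M A a : ℝ} (S : Src Φ Φ' M) (R : RDec Φ Φ' A a) (r t : ℝ)
    (ht : 0 ≤ t) :
    (RW Φ Φ').m0 r t - (RW Φ Φ').p0 r t =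
      ∫ s in Set.Ioi t, ∫ y in ((s - t) - r)..((s - t) + r), HH Φ y s := by
  show - EE (-1) (hh Φ) r t - - EE 1 (hh Φ) r t = _
  rw [EE_eq (R.i0 S _ _).integrableOn ht, EE_eq (R.i0 S _ _).integrableOn ht, sub_neg_eq_add,
    add_comm, ← sub_eq_add_neg, ← integral_sub (R.i0 S _ _).integrableOn
      (R.i0 S _ _).integrableOn]
  congr 1; funext s
  rw [← hh_sub S, ← hh_even Φ (s - t - r)]
  congr 2 <;> ring

lemma Src.RW_eq {Φ Φ' : ℝ → ℝ → ℝ} {M A a : ℝ} (S : Src Φ Φ' M) (R : RDec Φ Φ' A a)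
    {F : ℝ → ℝ → ℝ}
    (hF : ∀ l s, 0 < s → l * F l s = HH Φ l s) (r t : ℝ) (ht : 0 ≤ t) :
    Rop F r t = 1 / (2 * r) * ((RW Φ Φ').m0 r t - (RW Φ Φ').p0 r t) := by
  rw [S.RW_int R r t ht]
  unfold Rop
  congr 1
  refine setIntegral_congr_fun measurableSet_Ioi fun s hs => ?_
  have : 0 < s := lt_of_le_of_lt ht hs
  simp only [hF _ _ this]

/-- `∫ (1+|y|)^{-a}` -/
def Ia (a : ℝ) : ℝ := ∫ y : ℝ, (1 + |y|) ^ (-a)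

lemma Ia_nonneg (a : ℝ) : 0 ≤ Ia a := integral_nonneg fun _ => by positivity

lemma charInt {k : ℝ → ℝ} (hk : Integrable k) (h0 : ∀ y, 0 ≤ k y) {c d : ℝ} (hd : 1 ≤ |d|)
    (S : Set ℝ) : ∫ s in S, k (c + d * s) ≤ ∫ y, k y := by
  have hd0 : d ≠ 0 := by intro h; simp [h] at hd; linarith
  have hi : Integrable (fun s => k (c + d * s)) := integrable_line hk hd0 c
  calc ∫ s in S, k (c + d * s) ≤ ∫ s, k (c + d * s) :=
        setIntegral_le_integral hi (Eventually.of_forall fun s => h0 _)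
    _ = |d⁻¹| * ∫ y, k (c + y) := by
      rw [Measure.integral_comp_mul_left (fun y => k (c + y)) d, smul_eq_mul]
    _ = |d⁻¹| * ∫ y, k y := by rw [integral_add_left_eq_self k c]
    _ ≤ 1 * ∫ y, k y := by
      gcongr
      · exact integral_nonneg h0
      · rw [abs_inv]; exact inv_le_one_of_one_le₀ hd
    _ = _ := one_mul _

/-- the weight of sources -/
def om (μ δ : ℝ) (k : ℝ → ℝ) (l s : ℝ) : ℝ :=
  (1 + |l| + s) ^ (-μ) * ((1 + |(|l| - s)|) ^ (-δ) + k l)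

lemma abs_sub_pow_le {δ : ℝ} (l s : ℝ) :
    (1 + |(|l| - s)|) ^ (-δ) ≤ (1 + |-s + l|) ^ (-δ) + (1 + |s + l|) ^ (-δ) := by
  rcases abs_cases l with ⟨h, _⟩ | ⟨h, _⟩
  · rw [h, show -s + l = l - s by ring]
    have : 0 ≤ (1 + |s + l|) ^ (-δ) := by positivity
    linarith
  · rw [h, show -l - s = -(s + l) by ring, abs_neg]
    have : 0 ≤ (1 + |-s + l|) ^ (-δ) := by positivity
    linarith

/-- Integrals over the spatial variable. -/
lemma inner_bound {G : ℝ → ℝ} {k : ℝ → ℝ} (hk : Integrable k) (h0 : ∀ y, 0 ≤ k y)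
    {A μ δ s N a b : ℝ} (hA : 0 ≤ A) (hμ : 0 ≤ μ) (hδ : 1 < δ) (hN : 0 < N)
    (hG : ∀ y, y ∈ Set.uIoc a b → |G y| ≤ A * om μ δ k y s)
    (hy : ∀ y, y ∈ Set.uIoc a b → N ≤ 1 + |y| + s) :
    |∫ y in a..b, G y| ≤ A * (2 * Ia δ + ∫ y, k y) * N ^ (-μ) := by
  set g : ℝ → ℝ := fun y => A * N ^ (-μ) * (((1 + |-s + y|) ^ (-δ) + (1 + |s + y|) ^ (-δ)) + k y)
  have i1 : Integrable fun y : ℝ => (1 + |-s + y|) ^ (-δ) :=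
    (integrable_ab hδ).comp_add_left (-s)
  have i2 : Integrable fun y : ℝ => (1 + |s + y|) ^ (-δ) := (integrable_ab hδ).comp_add_left s
  have i12 : Integrable fun y : ℝ => (1 + |-s + y|) ^ (-δ) + (1 + |s + y|) ^ (-δ) := i1.add i2
  have hg : Integrable g := ((i1.add i2).add hk).const_mul _
  have hg0 : ∀ y, 0 ≤ g y := fun y => by
    have := h0 y
    simp only [g]; positivity
  have h1 : |∫ y in a..b, G y| ≤ ∫ y in Set.uIoc a b, g y := by
    have : |∫ y in a..b, G y| = |∫ y in Set.uIoc a b, G y| :=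
      intervalIntegral.abs_integral_eq_abs_integral_uIoc G
    rw [this]
    refine norm_integral_le_of_norm_le (f := G) (g := g) hg.integrableOn ?_
    filter_upwards [ae_restrict_mem measurableSet_uIoc] with y hyy
    refine (hG y hyy).trans ?_
    simp only [g, om, mul_assoc]
    have h3 := hy y hyy
    have h4 : (1 + |y| + s) ^ (-μ) ≤ N ^ (-μ) := rpow_le_rpow_of_nonpos hN h3 (by linarith)
    have h5 := abs_sub_pow_le (δ := δ) y s
    have h6 := h0 y
    have : 0 < 1 + |y| + s := by linarith
    gcongr
  have h2 : ∫ y in Set.uIoc a b, g y ≤ ∫ y, g y :=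
    setIntegral_le_integral hg (Eventually.of_forall hg0)
  refine h1.trans (h2.trans (le_of_eq ?_))
  simp only [g]
  rw [integral_const_mul, integral_add i12 hk, integral_add i1 i2,
    integral_add_left_eq_self (fun y : ℝ => (1 + |y|) ^ (-δ)) (-s),
    integral_add_left_eq_self (fun y : ℝ => (1 + |y|) ^ (-δ)) s]
  unfold Ia; ring

lemma int_Icc_pow {μ N : ℝ} (hμ : μ < 1) (hN : 0 ≤ N) :
    ∫ y in (0:ℝ)..N, (1 + y) ^ (-μ) = ((1 + N) ^ (1 - μ) - 1) / (1 - μ) := by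
  have h1 : ∫ y in (0:ℝ)..N, (1 + y) ^ (-μ) = ∫ y in (1 + 0 : ℝ)..(1 + N), y ^ (-μ) :=
    intervalIntegral.integral_comp_add_left (fun y => y ^ (-μ)) 1
  rw [h1, integral_rpow (Or.inl (by linarith))]
  simp [add_comm, sub_eq_add_neg]

lemma cont_pow_ii {μ N : ℝ} (hN : 0 ≤ N) :
    IntervalIntegrable (fun y : ℝ => (1 + y) ^ (-μ)) volume 0 N := by
  apply ContinuousOn.intervalIntegrable
  rw [Set.uIcc_of_le hN]
  intro y hy
  exact (ContinuousAt.rpow_const (by fun_prop) (Or.inl (by linarith [hy.1]))).continuousWithinAt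

/-- truncated power -/
def ktr (μ N : ℝ) (y : ℝ) : ℝ := Set.indicator (Set.Iic N) (fun y => (1 + y) ^ (-μ)) |y|

lemma ktr_nonneg (μ N y : ℝ) : 0 ≤ ktr μ N y := by
  unfold ktr
  apply Set.indicator_apply_nonneg
  intro _; positivity

lemma ktr_int {μ N : ℝ} (hμ : μ < 1) (hN : 0 ≤ N) :
    Integrable (ktr μ N) ∧ ∫ y, ktr μ N y ≤ 2 / (1 - μ) * (1 + N) ^ (1 - μ) := by
  have h1 : ∫ y, ktr μ N y = 2 * ∫ y in Set.Ioi (0:ℝ),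
      Set.indicator (Set.Iic N) (fun y : ℝ => (1 + y) ^ (-μ)) y := integral_comp_abs
  have h2 : ∫ y in Set.Ioi (0:ℝ), Set.indicator (Set.Iic N) (fun y : ℝ => (1 + y) ^ (-μ)) y
      = ((1 + N) ^ (1 - μ) - 1) / (1 - μ) := by
    rw [setIntegral_indicator measurableSet_Iic, Set.Ioi_inter_Iic,
      ← intervalIntegral.integral_of_le hN, int_Icc_pow hμ hN]
  constructor
  · have h4 : ktr μ N = Set.indicator (Set.Icc (-N) N) (fun y => (1 + |y|) ^ (-μ)) := by
      funext y
      simp only [ktr, Set.indicator, Set.mem_Iic, Set.mem_Icc, abs_le]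
    rw [h4, integrable_indicator_iff measurableSet_Icc]
    apply Continuous.integrableOn_Icc
    exact Continuous.rpow_const (by fun_prop) (fun y => Or.inl (by positivity))
  · rw [h1, h2]
    have h3 : 0 < 1 - μ := by linarith
    rw [div_mul_eq_mul_div, ← mul_div_assoc]
    gcongr
    linarith

/-- Bounds along the characteristics for the operator `L`. -/
def CL (μ δ : ℝ) (k : ℝ → ℝ) : ℝ := 2 / (1 - μ) + 2 * Ia δ + ∫ y, k y

lemma CL_nonneg {μ δ : ℝ} (hμ : μ < 1) {k : ℝ → ℝ} (h0 : ∀ y, 0 ≤ k y) : 0 ≤ CL μ δ k := by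
  unfold CL
  have := Ia_nonneg δ
  have h2 : 0 ≤ ∫ y, k y := integral_nonneg h0
  have h3 : 0 < 1 - μ := by linarith
  positivity

lemma pow_le_wZ {μ r t : ℝ} (hr : 0 ≤ r) (ht : 0 ≤ t) : (1 + r + t) ^ (-μ) ≤ wZ μ r t := by
  unfold wZ
  have h := abs_rt_le hr ht
  rw [le_div_iff₀ (by positivity), show (1 - μ) = -μ + 1 by ring,
    rpow_add_one (by positivity)]
  exact mul_le_mul_of_nonneg_left (by linarith) (by positivity)

lemma DD_in {G : ℝ → ℝ → ℝ} {k : ℝ → ℝ} (hk : Integrable k) (h0 : ∀ y, 0 ≤ k y)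
    {A μ δ : ℝ} (hA : 0 ≤ A) (hμ1 : μ < 1) (hδ : 1 < δ)
    (hG : ∀ y s, 0 ≤ s → |G y s| ≤ A * om μ δ k y s) {r t : ℝ} (hr : 0 < r) (ht : 0 ≤ t) :
    |DD (-1) G r t| ≤ CL μ δ k * A * wZ μ r t := by
  have hI := Ia_nonneg δ
  have hkI : 0 ≤ ∫ y, k y := integral_nonneg h0
  have hW := pow_le_wZ (μ := μ) hr.le ht
  have hW0 := wZ_nonneg μ r t hr.le ht
  unfold DD TT
  rw [intervalIntegral.integral_of_le ht]
  have i1 : Integrable fun s : ℝ => (1 + |(r + t) + (-2) * s|) ^ (-δ) :=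
    integrable_line (integrable_ab hδ) (by norm_num) _
  have i2 : Integrable fun s : ℝ => k ((r + t) + (-1) * s) :=
    integrable_line hk (by norm_num) _
  have hb : |∫ s in Set.Ioc 0 t, G (r - -1 * t + -1 * s) s| ≤
      ∫ s in Set.Ioc 0 t, A * (1 + r + t) ^ (-μ) *
        ((1 + |(r + t) + (-2) * s|) ^ (-δ) + k ((r + t) + (-1) * s)) := by
    refine norm_integral_le_of_norm_le (f := fun s => G (r - -1 * t + -1 * s) s) ((i1.add i2).const_mul _).integrableOn ?_
    filter_upwards [ae_restrict_mem measurableSet_Ioc] with s hs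
    refine (hG _ s hs.1.le).trans (le_of_eq ?_)
    have h1 : r - -1 * t + -1 * s = (r + t) + (-1) * s := by ring
    have h2 : |(r + t) + (-1) * s| = r + t - s := by
      rw [abs_of_nonneg] <;> linarith [hs.2]
    unfold om
    rw [h1, h2, show 1 + (r + t - s) + s = 1 + r + t by ring,
      show r + t - s - s = (r + t) + (-2) * s by ring]
    ring
  refine hb.trans ?_
  rw [integral_const_mul, integral_add i1.integrableOn i2.integrableOn]
  have e1 : ∫ s in Set.Ioc 0 t, (1 + |(r + t) + (-2) * s|) ^ (-δ) ≤ Ia δ :=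
    charInt (integrable_ab hδ) (fun y => by positivity) (by norm_num) _
  have e2 : ∫ s in Set.Ioc 0 t, k ((r + t) + (-1) * s) ≤ ∫ y, k y :=
    charInt hk h0 (by norm_num) _
  calc _ ≤ A * (1 + r + t) ^ (-μ) * (Ia δ + ∫ y, k y) := by gcongr
    _ ≤ A * wZ μ r t * CL μ δ k := by
      gcongr
      unfold CL
      have : 0 < 2 / (1 - μ) := div_pos two_pos (by linarith)
      linarith
    _ = _ := by ring

lemma om_out {μ δ : ℝ} {k : ℝ → ℝ} (h0 : ∀ y, 0 ≤ k y) (hμ : 0 ≤ μ) {σ s : ℝ}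
    (hs : 0 ≤ s) : om μ δ k (σ + s) s ≤
      (1 + |σ|) ^ (-δ) * (1 + |σ + 2 * s|) ^ (-μ) +
      (1 + |σ|) ^ (-μ) * ((1 + |σ + 2 * s|) ^ (-δ) + k (σ + 1 * s)) := by
  unfold om
  rw [one_mul]
  have hk := h0 (σ + s)
  have h1 : |σ| ≤ |σ + s| + s := by
    have := abs_sub (σ + s) s
    rwa [add_sub_cancel_right, abs_of_nonneg hs] at this
  have h2 : (1 + |σ + s| + s) ^ (-μ) ≤ (1 + |σ|) ^ (-μ) :=
    rpow_le_rpow_of_nonpos (by positivity) (by linarith) (by linarith)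
  rw [mul_add, mul_add, ← add_assoc]
  refine add_le_add ?_ (by gcongr)
  rcases abs_cases (σ + s) with ⟨h, h'⟩ | ⟨h, h'⟩
  · have h3 : |σ + 2 * s| = σ + 2 * s := abs_of_nonneg (by linarith)
    rw [h, h3, show σ + s - s = σ by ring, show 1 + (σ + s) + s = 1 + (σ + 2 * s) by ring]
    have : 0 ≤ (1 + |σ|) ^ (-μ) * (1 + (σ + 2 * s)) ^ (-δ) := by
      have : 0 ≤ 1 + (σ + 2 * s) := by linarith
      positivity
    rw [mul_comm]; linarith
  · have h3 : |σ| = -σ := abs_of_neg (by linarith)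
    rw [h, show -(σ + s) - s = -(σ + 2 * s) by ring, abs_neg,
      show 1 + -(σ + s) + s = 1 + |σ| by rw [h3]; ring]
    have : 0 ≤ (1 + |σ|) ^ (-δ) * (1 + |σ + 2 * s|) ^ (-μ) := by positivity
    linarith

lemma DD_out {G : ℝ → ℝ → ℝ} {k : ℝ → ℝ} (hk : Integrable k) (h0 : ∀ y, 0 ≤ k y)
    {A μ δ : ℝ} (hA : 0 ≤ A) (hμ0 : 0 ≤ μ) (hμ1 : μ < 1) (hδ : 1 < δ)
    (hG : ∀ y s, 0 ≤ s → |G y s| ≤ A * om μ δ k y s) {r t : ℝ} (hr : 0 < r) (ht : 0 ≤ t) :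
    |DD 1 G r t| ≤ CL μ δ k * A * wZ μ r t := by
  have hI := Ia_nonneg δ
  have hkI : 0 ≤ ∫ y, k y := integral_nonneg h0
  have hrt : 0 ≤ r + t := by linarith
  obtain ⟨hti, htb⟩ := ktr_int hμ1 hrt
  have hW0 := wZ_nonneg μ r t hr.le ht
  unfold DD TT
  rw [intervalIntegral.integral_of_le ht]
  set σ := r - t with hσ
  have i0 : Integrable fun s : ℝ => ktr μ (r + t) (σ + 2 * s) :=
    integrable_line hti (by norm_num) _
  have i1 : Integrable fun s : ℝ => (1 + |σ + 2 * s|) ^ (-δ) :=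
    integrable_line (integrable_ab hδ) (by norm_num) _
  have i2 : Integrable fun s : ℝ => k (σ + 1 * s) :=
    integrable_line hk (by norm_num) _
  have i12 : Integrable fun s : ℝ => (1 + |σ|) ^ (-μ) *
      ((1 + |σ + 2 * s|) ^ (-δ) + k (σ + 1 * s)) := (i1.add i2).const_mul _
  have hb : |∫ s in Set.Ioc 0 t, G (r - 1 * t + 1 * s) s| ≤
      ∫ s in Set.Ioc 0 t, A * ((1 + |σ|) ^ (-δ) * ktr μ (r + t) (σ + 2 * s) +
        (1 + |σ|) ^ (-μ) * ((1 + |σ + 2 * s|) ^ (-δ) + k (σ + 1 * s))) := by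
    refine norm_integral_le_of_norm_le (f := fun s => G (r - 1 * t + 1 * s) s)
      (((i0.const_mul _).add ((i1.add i2).const_mul _)).const_mul _).integrableOn ?_
    filter_upwards [ae_restrict_mem measurableSet_Ioc] with s hs
    refine (hG _ s hs.1.le).trans ?_
    have h1 : r - 1 * t + 1 * s = σ + s := by rw [hσ]; ring
    rw [h1]
    have h2 := om_out (μ := μ) (δ := δ) h0 hμ0 (σ := σ) hs.1.le
    have h3 : ktr μ (r + t) (σ + 2 * s) = (1 + |σ + 2 * s|) ^ (-μ) := by
      unfold ktr
      rw [Set.indicator_of_mem]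
      rw [Set.mem_Iic, abs_le, hσ]
      constructor <;> linarith [hs.1, hs.2]
    rw [h3]
    gcongr
  refine hb.trans ?_
  rw [integral_const_mul, integral_add (i0.const_mul _).integrableOn
    i12.integrableOn, integral_const_mul, integral_const_mul,
    integral_add i1.integrableOn i2.integrableOn]
  have e0 : ∫ s in Set.Ioc 0 t, ktr μ (r + t) (σ + 2 * s) ≤ 2 / (1 - μ) * (1 + (r + t)) ^ (1 - μ) :=
    (charInt hti (ktr_nonneg _ _) (by norm_num) _).trans htb
  have e1 : ∫ s in Set.Ioc 0 t, (1 + |σ + 2 * s|) ^ (-δ) ≤ Ia δ :=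
    charInt (integrable_ab hδ) (fun y => by positivity) (by norm_num) _
  have e2 : ∫ s in Set.Ioc 0 t, k (σ + 1 * s) ≤ ∫ y, k y :=
    charInt hk h0 (by norm_num) _
  have f1 : (1 + |σ|) ^ (-δ) ≤ (1 + |σ|)⁻¹ := by
    rw [← rpow_neg_one]
    apply rpow_le_rpow_of_exponent_le
    · linarith [abs_nonneg σ]
    · linarith
  have f2 : (1 + |σ|) ^ (-μ) ≤ wZ μ r t := wX_le_wZ hμ1.le hr.le ht
  have h1μ : 0 < 1 - μ := by linarith
  calc _ ≤ A * ((1 + |σ|)⁻¹ * (2 / (1 - μ) * (1 + (r + t)) ^ (1 - μ)) +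
        wZ μ r t * (Ia δ + ∫ y, k y)) := by
        have : 0 ≤ ∫ s in Set.Ioc 0 t, ktr μ (r + t) (σ + 2 * s) :=
          integral_nonneg fun _ => ktr_nonneg _ _ _
        have : 0 ≤ ∫ s in Set.Ioc 0 t, (1 + |σ + 2 * s|) ^ (-δ) :=
          integral_nonneg fun _ => by positivity
        have : 0 ≤ ∫ s in Set.Ioc 0 t, k (σ + 1 * s) := integral_nonneg fun _ => h0 _
        gcongr
    _ = A * (2 / (1 - μ) * wZ μ r t + wZ μ r t * (Ia δ + ∫ y, k y)) := by
      unfold wZ; rw [← add_assoc, hσ]; ring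
    _ ≤ _ := by
      unfold CL
      have : 0 ≤ A * wZ μ r t * Ia δ := by positivity
      nlinarith

/-- The estimate for the operator `L`. -/
lemma L_est {μ δ : ℝ} {k : ℝ → ℝ} (hk : Integrable k) (h0 : ∀ y, 0 ≤ k y)
    (hμ0 : 0 ≤ μ) (hμ1 : μ < 1) (hδ : 1 < δ) :
    ∃ C > 0, ∀ (Φ Φ' F : ℝ → ℝ → ℝ) (M A1 A2 : ℝ), Src Φ Φ' M →
      (∀ l s, 0 < s → l * F l s = HH Φ l s) → 0 ≤ A1 → 0 ≤ A2 →
      (∀ l s, 0 ≤ s → |HH Φ l s| ≤ A1 * om μ δ (fun _ => 0) l s) →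
      (∀ l s, 0 ≤ s → |HD Φ Φ' l s| ≤ A2 * om μ δ k l s) →
      ∃ J : Jet, IsJet J ∧ J.u = Lop F ∧ ∀ r t, 0 < r → 0 ≤ t →
        J.b1 r t ≤ C * A1 * wZ μ r t ∧ J.b2 r t ≤ C * (A1 + A2) * wZ μ r t := by
  set K : ℝ := 2 ^ |1 - μ| * 2 with hK
  have hsh := shift_wZ μ
  have hK1 : 1 ≤ K := hsh.1
  set c := CL μ δ k with hc
  have hc0 : 0 ≤ c := CL_nonneg hμ1 h0
  set B := 2 / (1 - μ) * (1 + c) + 1 + c with hB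
  have h1μ : 0 < 1 - μ := by linarith
  have hB0 : 0 ≤ 2 / (1 - μ) * (1 + c) := by positivity
  refine ⟨(40 * K + 40) * B, by positivity, ?_⟩
  intro Φ Φ' F M A1 A2 S hF hA1 hA2 hH hD
  have hH' : ∀ l s, 0 ≤ s → |HH Φ l s| ≤ A1 * om μ δ k l s := by
    intro l s hs
    refine (hH l s hs).trans ?_
    unfold om
    have := h0 l
    gcongr
  have hu := S.LW_eq hF
  have hcB : c ≤ B := by rw [hB]; linarith
  have hW0 : ∀ r t, 0 < r → 0 ≤ t → 0 ≤ wZ μ r t := fun r t hr ht => wZ_nonneg μ r t hr.le ht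
  have up : ∀ x A r t, 0 ≤ A → 0 < r → 0 ≤ t → x ≤ c * A * wZ μ r t → x ≤ B * A * wZ μ r t := by
    intro x A r t hA hr ht hx
    have := hW0 r t hr ht
    exact hx.trans (by gcongr)
  have hb := S.LW_isWave.bounds hu (W := wZ μ) (A1 := B * A1) (A2 := B * (A1 + A2)) hsh
    (by positivity) (by positivity)
    (fun r t hr ht => up _ _ r t hA1 hr ht (DD_in hk h0 hA1 hμ1 hδ hH' hr ht))
    (fun r t hr ht => up _ _ r t hA1 hr ht (DD_out hk h0 hA1 hμ0 hμ1 hδ hH' hr ht))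
    (fun r t hr ht => ?_) (fun r t hr ht => ?_) (fun r t hr ht => ?_) (fun r t hr ht htr => ?_)
  · refine ⟨_, S.LW_isWave.isJet hu, rfl, fun r t hr ht => ?_⟩
    obtain ⟨h1, h2⟩ := hb r t hr ht
    have := hW0 r t hr ht
    constructor
    · refine h1.trans ?_
      have : 0 ≤ B * A1 * wZ μ r t := by positivity
      nlinarith [mul_nonneg (by linarith : 0 ≤ K) this]
    · refine h2.trans ?_
      have h5 : 0 ≤ B * A2 * wZ μ r t := by positivity
      have h6 : 0 ≤ B * A1 * wZ μ r t := by positivity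
      nlinarith [mul_nonneg (by linarith : 0 ≤ K) h5, mul_nonneg (by linarith : 0 ≤ K) h6]
  · have := up _ _ r t hA2 hr ht (DD_in hk h0 hA2 hμ1 hδ hD hr ht)
    have := hW0 r t hr ht
    calc _ ≤ B * A2 * wZ μ r t := by assumption
      _ ≤ _ := by gcongr; linarith
  · have := up _ _ r t hA2 hr ht (DD_out hk h0 hA2 hμ0 hμ1 hδ hD hr ht)
    have := hW0 r t hr ht
    calc _ ≤ B * A2 * wZ μ r t := by assumption
      _ ≤ _ := by gcongr; linarith
  · show |HH Φ r t| ≤ _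
    have h1 := hH r t ht
    have h2 := pow_le_wZ (μ := μ) hr.le ht
    have h3 : om μ δ (fun _ => 0) r t ≤ wZ μ r t := by
      unfold om
      rw [abs_of_pos hr, add_zero]
      refine le_trans ?_ h2
      have : (1 + |r - t|) ^ (-δ) ≤ 1 :=
        rpow_le_one_of_one_le_of_nonpos (by linarith [abs_nonneg (r - t)]) (by linarith)
      have h4 : 0 ≤ (1 + r + t) ^ (-μ) := by positivity
      nlinarith
    have := hW0 r t hr ht
    have hB1 : 1 ≤ B := by rw [hB]; linarith
    calc _ ≤ A1 * wZ μ r t := h1.trans (by gcongr)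
      _ ≤ 1 * (A1 + A2) * wZ μ r t := by gcongr; linarith
      _ ≤ _ := by gcongr
  · have hr0 : 0 < r := by linarith
    have hW := hW0 r t hr0 ht
    unfold Wave.P
    rw [S.LW_int]
    have h1 : |∫ s in (0:ℝ)..t, ∫ y in (r - (t - s))..(r + (t - s)), HH Φ y s| ≤
        ∫ s in (0:ℝ)..t, A1 * c * (1 + s) ^ (-μ) := by
      refine intervalIntegral.norm_integral_le_of_norm_le ht
        (f := fun s => ∫ y in (r - (t - s))..(r + (t - s)), HH Φ y s) (g := fun s => A1 * c * (1 + s) ^ (-μ))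
        (Eventually.of_forall fun s hs => ?_) ((cont_pow_ii ht).const_mul _)
      have h2 := inner_bound hk h0 (s := s) (N := 1 + s) (a := r - (t - s)) (b := r + (t - s))
        (G := fun y => HH Φ y s) hA1 hμ0 hδ (by linarith [hs.1]) (fun y _ => hH' y s hs.1.le)
        (fun y _ => by linarith [abs_nonneg y])
      refine h2.trans ?_
      have h3 : 2 * Ia δ + ∫ y, k y ≤ c := by
        rw [hc, CL]
        have : 0 < 2 / (1 - μ) := by positivity
        linarith
      have : 0 ≤ 1 + s := by linarith [hs.1]
      gcongr
    rw [intervalIntegral.integral_const_mul, int_Icc_pow hμ1 ht] at h1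
    have h4 : ((1 + t) ^ (1 - μ) - 1) / (1 - μ) ≤ 2 / (1 - μ) * (r * wZ μ r t) := by
      have h5 : (1 + t) ^ (1 - μ) ≤ 2 * (r * wZ μ r t) := by
        unfold wZ
        have h6 : 1 + |r - t| ≤ 2 * r := by
          rcases abs_cases (r - t) with h | h <;> linarith
        rw [← mul_div_assoc, ← mul_div_assoc, le_div_iff₀ (by positivity)]
        have h7 : (1 + t) ^ (1 - μ) ≤ (1 + r + t) ^ (1 - μ) :=
          rpow_le_rpow (by positivity) (by linarith) h1μ.le
        calc _ ≤ (1 + r + t) ^ (1 - μ) * (2 * r) := by gcongr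
          _ = _ := by ring
      rw [div_mul_eq_mul_div]
      gcongr
      linarith
    rw [abs_div, abs_two]
    have h8 : 0 ≤ r * wZ μ r t := by positivity
    have h9 : A1 * c * (((1 + t) ^ (1 - μ) - 1) / (1 - μ)) ≤
        A1 * c * (2 / (1 - μ) * (r * wZ μ r t)) := by gcongr
    have h10 : A1 * c * (2 / (1 - μ) * (r * wZ μ r t)) ≤ B * A1 * (r * wZ μ r t) := by
      have : c * (2 / (1 - μ)) ≤ B := by
        rw [hB]
        have : 0 < 2 / (1 - μ) := by positivity
        nlinarith
      calc _ = (c * (2 / (1 - μ))) * A1 * (r * wZ μ r t) := by ring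
        _ ≤ _ := by gcongr
    have h11 : 0 ≤ B * A1 * (r * wZ μ r t) := by positivity
    linarith

lemma pow_scale {c x N a : ℝ} (hc : 0 < c) (hN : 0 < N) (ha : 0 ≤ a) (h : N ≤ c * x) :
    x ^ (-a) ≤ c ^ a * N ^ (-a) := by
  have h1 : N / c ≤ x := by rw [div_le_iff₀ hc]; linarith
  have h4 : x ^ (-a) ≤ (N / c) ^ (-a) :=
    rpow_le_rpow_of_nonpos (by positivity) h1 (by linarith)
  rw [div_rpow hN.le hc.le, rpow_neg hc.le] at h4
  calc _ ≤ _ := h4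
    _ = _ := by field_simp

/-- source weight for the operator `R` -/
def rho (a l s : ℝ) : ℝ := (1 + |l|) ^ (-a) * (1 + |(|l| - s)|) ^ (-(1 + a))

def kab (a : ℝ) (y : ℝ) : ℝ := (1 + |y|) ^ (-a)

lemma kab_nonneg (a y : ℝ) : 0 ≤ kab a y := by unfold kab; positivity

lemma rho_le_om {a l s : ℝ} (ha : 1 < a) (hs : 0 ≤ s) :
    rho a l s ≤ 3 ^ a * om a (1 + a) (kab a) l s := by
  unfold rho om kab
  set x := |l| with hx
  set σ := |x - s| with hσ
  have hx0 : 0 ≤ x := abs_nonneg _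
  have hσ0 : 0 ≤ σ := abs_nonneg _
  have h1 : s - x ≤ σ := by rw [hσ, abs_sub_comm]; exact le_abs_self _
  have hN : 0 < 1 + x + s := by positivity
  rcases le_total σ x with h | h
  · have h2 : (1 + x) ^ (-a) ≤ 3 ^ a * (1 + x + s) ^ (-a) :=
      pow_scale (by norm_num) hN (by linarith) (by linarith)
    have : 0 ≤ (1 + x) ^ (-a) := by positivity
    calc _ ≤ 3 ^ a * (1 + x + s) ^ (-a) * (1 + σ) ^ (-(1 + a)) := by gcongr
      _ ≤ 3 ^ a * (1 + x + s) ^ (-a) * ((1 + σ) ^ (-(1 + a)) + (1 + x) ^ (-a)) := by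
        gcongr; linarith
      _ = _ := by ring
  · have h2 : (1 + σ) ^ (-a) ≤ 3 ^ a * (1 + x + s) ^ (-a) :=
      pow_scale (by norm_num) hN (by linarith) (by linarith)
    have h3 : (1 + σ) ^ (-(1 + a)) ≤ (1 + σ) ^ (-a) :=
      rpow_le_rpow_of_exponent_le (by linarith) (by linarith)
    have : 0 ≤ (1 + σ) ^ (-(1 + a)) := by positivity
    calc _ ≤ (1 + x) ^ (-a) * (3 ^ a * (1 + x + s) ^ (-a)) := by gcongr; exact h3.trans h2
      _ = 3 ^ a * (1 + x + s) ^ (-a) * (1 + x) ^ (-a) := by ring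
      _ ≤ 3 ^ a * (1 + x + s) ^ (-a) * ((1 + σ) ^ (-(1 + a)) + (1 + x) ^ (-a)) := by
        gcongr; linarith
      _ = _ := by ring

lemma tail_int {a c t : ℝ} (ha : 1 < a) (hc : 0 < c + t) :
    IntegrableOn (fun s => (c + s) ^ (-a)) (Set.Ioi t) ∧
      ∫ s in Set.Ioi t, (c + s) ^ (-a) = (c + t) ^ (1 - a) / (a - 1) := by
  have h0 := measurePreserving_add_left (volume : Measure ℝ) c
  have he : MeasurableEmbedding fun s : ℝ => c + s := measurableEmbedding_addLeft c
  have hp : (fun s : ℝ => c + s) ⁻¹' Set.Ioi (c + t) = Set.Ioi t := by ext s; simp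
  constructor
  · have := (h0.integrableOn_comp_preimage he (f := fun y : ℝ => y ^ (-a))
      (s := Set.Ioi (c + t))).2 (integrableOn_Ioi_rpow_of_lt (by linarith) hc)
    rw [hp] at this
    exact this
  · have := h0.setIntegral_preimage_emb he (fun y : ℝ => y ^ (-a)) (Set.Ioi (c + t))
    rw [hp] at this
    rw [this, integral_Ioi_rpow_of_lt (by linarith) hc, show -a + 1 = -(a - 1) by ring,
      show 1 - a = -(a - 1) by ring, div_neg, neg_div, neg_neg]

lemma out_w {a r t : ℝ} (ha : 1 < a) (hr : 0 < r) (ht : 0 ≤ t) :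
    (1 + |r - t|) ^ (-(1 + a)) * (1 + r) ^ (1 - a) ≤ 2 ^ (a - 1) * wZ a r t := by
  unfold wZ
  set σ := |r - t| with hσ
  have hσ0 : 0 ≤ σ := abs_nonneg _
  have h1 : t - r ≤ σ := by rw [hσ, abs_sub_comm]; exact le_abs_self _
  rw [← mul_div_assoc, le_div_iff₀ (by positivity)]
  have h2 : ((1 + r) * (1 + σ)) ^ (-(a - 1)) ≤ 2 ^ (a - 1) * (1 + r + t) ^ (-(a - 1)) :=
    pow_scale (by norm_num) (by positivity) (by linarith) (by nlinarith)
  rw [mul_rpow (by positivity) (by positivity)] at h2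
  rw [show 1 - a = -(a - 1) by ring]
  refine le_trans ?_ h2
  have h3 : (1 + σ) ^ (-(1 + a)) * (1 + σ) ≤ (1 + σ) ^ (-(a - 1)) := by
    rw [← rpow_add_one (by positivity)]
    exact rpow_le_rpow_of_exponent_le (by linarith) (by linarith)
  calc _ = (1 + r) ^ (-(a - 1)) * ((1 + σ) ^ (-(1 + a)) * (1 + σ)) := by ring
    _ ≤ _ := by gcongr

lemma EE_out {G : ℝ → ℝ → ℝ} {A a : ℝ} (hA : 0 ≤ A) (ha : 1 < a)
    (hG : ∀ y s, 0 ≤ s → |G y s| ≤ A * rho a y s) {r t : ℝ} (hr : 0 < r) (ht : 0 ≤ t)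
    (hi : IntegrableOn (fun s => G (r - 1 * t + 1 * s) s) (Set.Ioi 0)) :
    |EE 1 G r t| ≤ 2 ^ (a - 1) / (a - 1) * A * wZ a r t := by
  rw [EE_eq hi ht]
  obtain ⟨j1, j2⟩ := tail_int (a := a) (c := 1 + r - t) (t := t) ha (by linarith)
  have hb : |∫ s in Set.Ioi t, G (r - 1 * t + 1 * s) s| ≤
      ∫ s in Set.Ioi t, A * (1 + |r - t|) ^ (-(1 + a)) * (1 + r - t + s) ^ (-a) := by
    refine norm_integral_le_of_norm_le (f := fun s => G (r - 1 * t + 1 * s) s)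
      (j1.const_mul _) ?_
    filter_upwards [ae_restrict_mem measurableSet_Ioi] with s hs
    have hs' : t < s := hs
    refine (hG _ s (by linarith)).trans (le_of_eq ?_)
    unfold rho
    rw [abs_of_nonneg (show 0 ≤ r - 1 * t + 1 * s by linarith),
      show r - 1 * t + 1 * s - s = r - t by ring,
      show 1 + (r - 1 * t + 1 * s) = 1 + r - t + s by ring]
    ring
  refine hb.trans ?_
  rw [integral_const_mul, j2, show 1 + r - t + t = 1 + r by ring]
  have ha1 : 0 < a - 1 := by linarith
  calc _ = A / (a - 1) * ((1 + |r - t|) ^ (-(1 + a)) * (1 + r) ^ (1 - a)) := by ring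
    _ ≤ A / (a - 1) * (2 ^ (a - 1) * wZ a r t) := by
      exact mul_le_mul_of_nonneg_left (out_w ha hr ht) (by positivity)
    _ = _ := by ring

lemma EE_in {G : ℝ → ℝ → ℝ} {A a : ℝ} (hA : 0 ≤ A) (ha : 1 < a)
    (hG : ∀ y s, 0 ≤ s → |G y s| ≤ A * rho a y s) {r t : ℝ} (hr : 0 < r) (ht : 0 ≤ t)
    (hi : IntegrableOn (fun s => G (r - (-1) * t + (-1) * s) s) (Set.Ioi 0)) :
    |EE (-1) G r t| ≤ 3 ^ a * (Ia (1 + a) + Ia a) * A * wZ a r t := by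
  have hI := Ia_nonneg (1 + a)
  have hI' := Ia_nonneg a
  rw [EE_eq hi ht]
  have i1 : Integrable fun s : ℝ => (1 + |(r + t) + (-2) * s|) ^ (-(1 + a)) :=
    integrable_line (integrable_ab (by linarith)) (by norm_num) _
  have i2 : Integrable fun s : ℝ => (1 + |(r + t) + (-1) * s|) ^ (-a) :=
    integrable_line (integrable_ab ha) (by norm_num) _
  have hb : |∫ s in Set.Ioi t, G (r - (-1) * t + (-1) * s) s| ≤
      ∫ s in Set.Ioi t, A * (3 ^ a * (1 + r + t) ^ (-a)) *
        ((1 + |(r + t) + (-2) * s|) ^ (-(1 + a)) + (1 + |(r + t) + (-1) * s|) ^ (-a)) := by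
    refine norm_integral_le_of_norm_le (f := fun s => G (r - (-1) * t + (-1) * s) s)
      ((i1.add i2).const_mul _).integrableOn ?_
    filter_upwards [ae_restrict_mem measurableSet_Ioi] with s hs
    have hs' : t < s := hs
    refine (hG _ s (by linarith)).trans ?_
    rw [mul_assoc]
    refine mul_le_mul_of_nonneg_left ?_ hA
    have h1 : r - -1 * t + -1 * s = (r + t) + (-1) * s := by ring
    rw [h1]
    rcases abs_cases ((r + t) + (-1) * s) with ⟨h, _⟩ | ⟨h, h'⟩
    · refine (rho_le_om ha (by linarith)).trans (le_of_eq ?_)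
      unfold om kab
      rw [h, show 1 + (r + t + -1 * s) + s = 1 + r + t by ring,
        show r + t + -1 * s - s = (r + t) + (-2) * s by ring]
      ring
    · unfold rho
      rw [h, show (-(r + t + -1 * s) - s) = -(r + t) by ring, abs_neg,
        abs_of_nonneg (show 0 ≤ r + t by linarith)]
      have hl : 0 ≤ -(r + t + -1 * s) := by linarith
      set x := -(r + t + -1 * s)
      have h3 : (1 + (r + t)) ^ (-(1 + a)) ≤ 3 ^ a * (1 + r + t) ^ (-a) := by
        have h4 : (1 + (r + t)) ^ (-(1 + a)) ≤ (1 + (r + t)) ^ (-a) :=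
          rpow_le_rpow_of_exponent_le (by linarith) (by linarith)
        have h5 : (1:ℝ) ≤ 3 ^ a := one_le_rpow (by norm_num) (by linarith)
        rw [← add_assoc] at h4 ⊢
        have : 0 ≤ (1 + r + t) ^ (-a) := by positivity
        nlinarith
      have h6 : 0 ≤ (1 + |(r + t) + (-2) * s|) ^ (-(1 + a)) := by positivity
      calc _ ≤ (1 + x) ^ (-a) * (3 ^ a * (1 + r + t) ^ (-a)) := by gcongr
        _ = (3 ^ a * (1 + r + t) ^ (-a)) * (1 + x) ^ (-a) := by ring
        _ ≤ _ := by gcongr; linarith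
  refine hb.trans ?_
  rw [integral_const_mul, integral_add i1.integrableOn i2.integrableOn]
  have e1 : ∫ s in Set.Ioi t, (1 + |(r + t) + (-2) * s|) ^ (-(1 + a)) ≤ Ia (1 + a) :=
    charInt (integrable_ab (by linarith)) (fun y => by positivity) (by norm_num) _
  have e2 : ∫ s in Set.Ioi t, (1 + |(r + t) + (-1) * s|) ^ (-a) ≤ Ia a :=
    charInt (integrable_ab ha) (fun y => by positivity) (by norm_num) _
  have hW := pow_le_wZ (μ := a) hr.le ht
  have hW0 := wZ_nonneg a r t hr.le ht
  calc _ ≤ A * (3 ^ a * wZ a r t) * (Ia (1 + a) + Ia a) := by gcongr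
    _ = _ := by ring

/-- The estimate for the operator `R`. -/
lemma R_est {a : ℝ} (ha : 1 < a) :
    ∃ C > 0, ∀ (Φ Φ' F : ℝ → ℝ → ℝ) (M A1 A2 : ℝ), Src Φ Φ' M →
      (∀ l s, 0 < s → l * F l s = HH Φ l s) → 0 ≤ A1 → 0 ≤ A2 →
      (∀ l s, 0 ≤ s → |HH Φ l s| ≤ A1 * rho a l s) →
      (∀ l s, 0 ≤ s → |HD Φ Φ' l s| ≤ A2 * rho a l s) →
      ∃ J : Jet, IsJet J ∧ J.u = Rop F ∧ ∀ r t, 0 < r → 0 ≤ t →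
        J.b1 r t ≤ C * A1 * wZ a r t ∧ J.b2 r t ≤ C * (A1 + A2) * wZ a r t := by
  have ha1 : 0 < a - 1 := by linarith
  set K : ℝ := 2 ^ |1 - a| * 2 with hK
  have hsh := shift_wZ a
  have hK1 : 1 ≤ K := hsh.1
  have hI := Ia_nonneg (1 + a)
  have hI' := Ia_nonneg a
  set c1 := (3:ℝ) ^ a * (2 * Ia (1 + a) + Ia a) with hc1
  have hc10 : 0 ≤ c1 := by positivity
  set c2 := (2:ℝ) ^ (a - 1) / (a - 1) with hc2
  have hc20 : 0 ≤ c2 := by positivity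
  set c3 := (2:ℝ) ^ (a - 1) with hc3
  have hc30 : 0 < c3 := by positivity
  set c4 := c1 * 2 ^ a / (a - 1) with hc4
  have hc40 : 0 ≤ c4 := by positivity
  set B := c1 + c2 + c3 + c4 with hB
  have hB0 : 0 < B := by positivity
  refine ⟨(40 * K + 40) * B, by positivity, ?_⟩
  intro Φ Φ' F M A1 A2 S hF hA1 hA2 hH hD
  have hk : Integrable (kab a) := integrable_ab ha
  have hHo : ∀ l s, 0 ≤ s → |HH Φ l s| ≤ (A1 * 3 ^ a) * om a (1 + a) (kab a) l s := by
    intro l s hs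
    refine (hH l s hs).trans ?_
    rw [mul_assoc]
    exact mul_le_mul_of_nonneg_left (rho_le_om ha hs) hA1
  have hrho : ∀ l s, rho a l s ≤ (1 + |l|) ^ (-a) := by
    intro l s
    unfold rho
    refine mul_le_of_le_one_right (by positivity) ?_
    exact rpow_le_one_of_one_le_of_nonpos (by linarith [abs_nonneg (|l| - s)]) (by linarith)
  have eH : ∀ l s, HH Φ l s = HH Φ l |s| := fun l s => by simp [HH]
  have eD : ∀ l s, HD Φ Φ' l s = HD Φ Φ' l |s| := fun l s => by simp [HD]
  have R : RDec Φ Φ' (A1 * c1 + A1 + A2) a := by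
    refine ⟨ha, fun x s => ?_, fun x s => ?_, fun x s => ?_⟩
    · have h2 := inner_bound hk (kab_nonneg a) (s := |s|) (N := 1 + |s|) (a := 0) (b := x)
        (G := fun y => HH Φ y s) (A := A1 * 3 ^ a) (μ := a) (δ := 1 + a) (by positivity)
        (by linarith) (by linarith) (by positivity)
        (fun y _ => by show |HH Φ y s| ≤ _; rw [eH]; exact hHo y |s| (abs_nonneg s))
        (fun y _ => by linarith [abs_nonneg y])
      refine h2.trans ?_
      have : A1 * 3 ^ a * (2 * Ia (1 + a) + ∫ y, kab a y) = A1 * c1 := by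
        rw [hc1]; unfold kab Ia; ring
      rw [this]
      gcongr
      linarith
    · rw [eH]
      refine (hH x |s| (abs_nonneg s)).trans ?_
      calc _ ≤ A1 * (1 + |x|) ^ (-a) := by gcongr; exact hrho _ _
        _ ≤ _ := by gcongr; nlinarith [mul_nonneg hA1 hc10]
    · rw [eD]
      refine (hD x |s| (abs_nonneg s)).trans ?_
      calc _ ≤ A2 * (1 + |x|) ^ (-a) := by gcongr; exact hrho _ _
        _ ≤ _ := by gcongr; nlinarith [mul_nonneg hA1 hc10]
  have hu := S.RW_eq R hF
  have hW0 : ∀ r t, 0 < r → 0 ≤ t → 0 ≤ wZ a r t := fun r t hr ht => wZ_nonneg a r t hr.le ht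
  have up : ∀ c x A r t, c ≤ B → 0 ≤ A → 0 < r → 0 ≤ t → x ≤ c * A * wZ a r t →
      x ≤ B * A * wZ a r t := by
    intro c x A r t hc hA hr ht hx
    have := hW0 r t hr ht
    exact hx.trans (by gcongr)
  have up2 : ∀ c x r t, c ≤ B → 0 < r → 0 ≤ t → x ≤ c * A2 * wZ a r t →
      x ≤ B * (A1 + A2) * wZ a r t := by
    intro c x r t hc hr ht hx
    have := hW0 r t hr ht
    refine (up c x A2 r t hc hA2 hr ht hx).trans ?_
    gcongr; linarith
  have hcin : 3 ^ a * (Ia (1 + a) + Ia a) ≤ B := by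
    have : 3 ^ a * (Ia (1 + a) + Ia a) ≤ c1 := by rw [hc1]; gcongr; linarith
    linarith
  have hcout : c2 ≤ B := by linarith
  have hn1 : (1:ℝ) ≠ 0 := by norm_num
  have hn2 : (-1:ℝ) ≠ 0 := by norm_num
  have hb := (S.RW_isWave R).bounds hu (W := wZ a) (A1 := B * A1) (A2 := B * (A1 + A2)) hsh
    (by positivity) (by positivity)
    (fun r t hr ht => up _ _ _ r t hcin hA1 hr ht ((abs_neg _).le.trans
      (EE_in hA1 ha hH hr ht (R.i1 S hn2 _).integrableOn)))
    (fun r t hr ht => up _ _ _ r t hcout hA1 hr ht ((abs_neg _).le.trans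
      (EE_out hA1 ha hH hr ht (R.i1 S hn1 _).integrableOn)))
    (fun r t hr ht => up2 _ _ r t hcin hr ht ((abs_neg _).le.trans
      (EE_in hA2 ha hD hr ht (R.i2 S hn2 _).integrableOn)))
    (fun r t hr ht => up2 _ _ r t hcout hr ht ((abs_neg _).le.trans
      (EE_out hA2 ha hD hr ht (R.i2 S hn1 _).integrableOn)))
    (fun r t hr ht => ?_) (fun r t hr ht htr => ?_)
  · refine ⟨_, (S.RW_isWave R).isJet hu, rfl, fun r t hr ht => ?_⟩
    obtain ⟨h1, h2⟩ := hb r t hr ht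
    have := hW0 r t hr ht
    constructor
    · refine h1.trans ?_
      have : 0 ≤ B * A1 * wZ a r t := by positivity
      nlinarith [mul_nonneg (by linarith : 0 ≤ K) this]
    · refine h2.trans ?_
      have h5 : 0 ≤ B * A2 * wZ a r t := by positivity
      have h6 : 0 ≤ B * A1 * wZ a r t := by positivity
      nlinarith [mul_nonneg (by linarith : 0 ≤ K) h5, mul_nonneg (by linarith : 0 ≤ K) h6]
  · show |HH Φ r t| ≤ _
    have h1 := hH r t ht
    have h3 : rho a r t ≤ c3 * wZ a r t := by
      refine le_trans ?_ (out_w ha hr ht)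
      unfold rho
      rw [abs_of_pos hr, mul_comm]
      gcongr
      · linarith
      · linarith
    have := hW0 r t hr ht
    calc _ ≤ A1 * (c3 * wZ a r t) := h1.trans (by gcongr)
      _ = c3 * A1 * wZ a r t := by ring
      _ ≤ B * (A1 + A2) * wZ a r t := by gcongr <;> linarith
  · have hr0 : 0 < r := by linarith
    have hW := hW0 r t hr0 ht
    unfold Wave.P
    rw [S.RW_int R r t ht]
    obtain ⟨j1, j2⟩ := tail_int (a := a) (c := 1 + r + t) (t := t) ha (by linarith)
    have h1 : |∫ s in Set.Ioi t, ∫ y in ((s - t) - r)..((s - t) + r), HH Φ y s| ≤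
        ∫ s in Set.Ioi t, A1 * c1 * 2 ^ a * (1 + r + t + s) ^ (-a) := by
      refine norm_integral_le_of_norm_le
        (f := fun s => ∫ y in ((s - t) - r)..((s - t) + r), HH Φ y s) (j1.const_mul _) ?_
      filter_upwards [ae_restrict_mem measurableSet_Ioi] with s hs
      have hs' : t < s := hs
      have hab : |s - t - r| ≤ s - t + r := by rw [abs_le]; constructor <;> linarith
      have h3 : ∫ y in ((s - t) - r)..((s - t) + r), HH Φ y s =
          ∫ y in |s - t - r|..((s - t) + r), HH Φ y s := by
        rw [← hh_sub S, ← hh_sub S]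
        congr 1
        rcases abs_choice (s - t - r) with h | h <;> rw [h]
        rw [hh_even]
      rw [h3]
      have h2 := inner_bound hk (kab_nonneg a) (s := s) (N := (1 + r + t + s) / 2)
        (a := |s - t - r|) (b := s - t + r)
        (G := fun y => HH Φ y s) (A := A1 * 3 ^ a) (μ := a) (δ := 1 + a) (by positivity)
        (by linarith) (by linarith) (by linarith) (fun y _ => hHo y s (by linarith))
        (fun y hy => by
          rw [Set.uIoc_of_le hab] at hy
          have := hy.1
          have h4 := neg_abs_le (s - t - r)
          have h5 := le_abs_self y
          have h6 := abs_nonneg y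
          linarith)
      refine h2.trans ?_
      have e1 : A1 * 3 ^ a * (2 * Ia (1 + a) + ∫ y, kab a y) = A1 * c1 := by
        rw [hc1]; unfold kab Ia; ring
      rw [e1, mul_assoc (A1 * c1)]
      refine mul_le_mul_of_nonneg_left ?_ (by positivity)
      exact pow_scale (by norm_num) (by linarith) (by linarith) (by linarith)
    rw [integral_const_mul, j2] at h1
    have h5 : (1 + r + t + t) ^ (1 - a) ≤ 2 * (r * wZ a r t) := by
      unfold wZ
      have h6 : 1 + |r - t| ≤ 2 * r := by
        rcases abs_cases (r - t) with h | h <;> linarith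
      rw [← mul_div_assoc, ← mul_div_assoc, le_div_iff₀ (by positivity)]
      have h7 : (1 + r + t + t) ^ (1 - a) ≤ (1 + r + t) ^ (1 - a) :=
        rpow_le_rpow_of_nonpos (by positivity) (by linarith) (by linarith)
      calc _ ≤ (1 + r + t) ^ (1 - a) * (2 * r) := by gcongr
        _ = _ := by ring
    rw [abs_div, abs_two]
    have h8 : 0 ≤ r * wZ a r t := by positivity
    have h9 : A1 * c1 * 2 ^ a * ((1 + r + t + t) ^ (1 - a) / (a - 1)) ≤
        2 * (c4 * A1 * (r * wZ a r t)) := by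
      calc _ ≤ A1 * c1 * 2 ^ a * ((2 * (r * wZ a r t)) / (a - 1)) := by gcongr
        _ = _ := by rw [hc4]; ring
    have h10 : c4 * A1 * (r * wZ a r t) ≤ B * A1 * (r * wZ a r t) := by
      gcongr; linarith
    linarith

/-- signed power, up to a factor the derivative of `|x|^r` -/
def sp (r x : ℝ) : ℝ := |x| ^ (r - 2) * x

lemma abs_sp {r : ℝ} (hr : 1 < r) (x : ℝ) : |sp r x| = |x| ^ (r - 1) := by
  unfold sp
  by_cases hx : x = 0
  · subst hx; simp; rw [zero_rpow]; linarith
  · rw [abs_mul, abs_of_nonneg (by positivity), ← rpow_add_one (abs_ne_zero.2 hx)]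
    congr 1; ring

lemma sp_of_nonneg {r : ℝ} (hr : 1 < r) {x : ℝ} (hx : 0 ≤ x) : sp r x = |x| ^ (r - 1) := by
  rw [← abs_sp hr, abs_of_nonneg]; unfold sp; positivity

lemma sp_of_nonpos {r : ℝ} (hr : 1 < r) {x : ℝ} (hx : x ≤ 0) : sp r x = -|x| ^ (r - 1) := by
  rw [← abs_sp hr, abs_of_nonpos, neg_neg]
  unfold sp
  exact mul_nonpos_of_nonneg_of_nonpos (by positivity) hx

lemma sp_cases {r : ℝ} (hr : 1 < r) (x y : ℝ) :
    (|sp r x - sp r y| = |(|x| ^ (r - 1) - |y| ^ (r - 1))| ∧ |(|x| - |y|)| ≤ |x - y|) ∨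
    (|sp r x - sp r y| = |x| ^ (r - 1) + |y| ^ (r - 1) ∧ |x - y| = |x| + |y|) := by
  rcases le_total 0 x with hx | hx <;> rcases le_total 0 y with hy | hy
  · left
    rw [sp_of_nonneg hr hx, sp_of_nonneg hr hy]
    exact ⟨rfl, abs_abs_sub_abs_le_abs_sub x y⟩
  · right
    rw [sp_of_nonneg hr hx, sp_of_nonpos hr hy]
    constructor
    · rw [sub_neg_eq_add, abs_of_nonneg]; positivity
    · rw [abs_of_nonneg hx, abs_of_nonpos hy, abs_of_nonneg] <;> linarith
  · right
    rw [sp_of_nonpos hr hx, sp_of_nonneg hr hy]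
    constructor
    · rw [← abs_neg, abs_of_nonneg]; · ring
      rw [neg_sub, sub_neg_eq_add]; positivity
    · rw [abs_of_nonpos hx, abs_of_nonneg hy, abs_of_nonpos] <;> linarith
  · left
    rw [sp_of_nonpos hr hx, sp_of_nonpos hr hy]
    exact ⟨by rw [← abs_neg]; congr 1; ring, abs_abs_sub_abs_le_abs_sub x y⟩

lemma pow_diff {r : ℝ} (hr : 1 ≤ r) (a b : ℝ) :
    |(|a| ^ r - |b| ^ r)| ≤ r * (|a| + |b|) ^ (r - 1) * |a - b| := by
  rcases hr.eq_or_lt with h | hr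
  · subst h
    simp only [rpow_one, sub_self, rpow_zero, mul_one, one_mul]
    exact abs_abs_sub_abs_le_abs_sub a b
  have := Convex.norm_image_sub_le_of_norm_hasDerivWithin_le (f := fun x : ℝ => |x| ^ r)
    (f' := fun x => r * |x| ^ (r - 2) * x) (s := Set.Icc (-(|a| + |b|)) (|a| + |b|))
    (C := r * (|a| + |b|) ^ (r - 1))
    (fun x _ => (hasDerivAt_abs_rpow x hr).hasDerivWithinAt)
    (fun x hx => by
      have h1 : r * |x| ^ (r - 2) * x = r * sp r x := by unfold sp; ring
      rw [h1, norm_mul, Real.norm_eq_abs, Real.norm_eq_abs, abs_sp hr, abs_of_pos (by linarith)]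
      have h2 : |x| ≤ |a| + |b| := abs_le.2 hx
      gcongr)
    (convex_Icc _ _) (x := b) (y := a)
    (abs_le.1 (by linarith [abs_nonneg a])) (abs_le.1 (by linarith [abs_nonneg b]))
  exact this

/-- Hölder continuity -/
lemma sp_holder {p : ℝ} (hp1 : 1 < p) (hp2 : p < 2) (x y : ℝ) :
    |sp p x - sp p y| ≤ 2 * |x - y| ^ (p - 1) := by
  have hn : 0 ≤ |x - y| ^ (p - 1) := by positivity
  have key : ∀ a b : ℝ, 0 ≤ a → 0 ≤ b → a ≤ b + |x - y| → a ^ (p - 1) ≤ b ^ (p - 1) + |x - y| ^ (p - 1) := by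
    intro a b ha hb h
    refine (rpow_le_rpow ha h (by linarith)).trans ?_
    exact Real.rpow_add_le_add_rpow hb (abs_nonneg _) (by linarith) (by linarith)
  rcases sp_cases hp1 x y with ⟨h1, h2⟩ | ⟨h1, h2⟩
  · rw [h1]
    have h3 := abs_le.1 h2
    have k1 := key |x| |y| (abs_nonneg _) (abs_nonneg _) (by linarith)
    have k2 := key |y| |x| (abs_nonneg _) (abs_nonneg _) (by linarith)
    rw [abs_le]; constructor <;> linarith
  · rw [h1, h2, two_mul]
    gcongr <;> linarith [abs_nonneg x, abs_nonneg y]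

lemma sp_lip {q : ℝ} (hq : 2 < q) (x y : ℝ) :
    |sp q x - sp q y| ≤ (q - 1) * (|x| + |y|) ^ (q - 2) * |x - y| := by
  have hx := abs_nonneg x
  have hy := abs_nonneg y
  rcases sp_cases (by linarith : 1 < q) x y with ⟨h1, h2⟩ | ⟨h1, h2⟩
  · rw [h1]
    have := pow_diff (r := q - 1) (by linarith) |x| |y|
    rw [abs_abs, abs_abs, show q - 1 - 1 = q - 2 by ring] at this
    refine this.trans ?_
    have : 0 ≤ q - 1 := by linarith
    gcongr
  · rw [h1, h2]
    by_cases h0 : |x| + |y| = 0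
    · have hx0 : |x| = 0 := by linarith
      have hy0 : |y| = 0 := by linarith
      rw [hx0, hy0, zero_rpow (by linarith)]; simp
    · rw [mul_assoc, ← rpow_add_one h0, show q - 2 + 1 = q - 1 by ring]
      have k1 : |x| ^ (q - 1) + |y| ^ (q - 1) ≤ (|x| + |y|) ^ (q - 1) :=
        Real.add_rpow_le_rpow_add hx hy (by linarith)
      have : 0 ≤ (|x| + |y|) ^ (q - 1) := by positivity
      nlinarith

lemma sp_cont {r : ℝ} (hr : 1 < r) : Continuous (sp r) := by
  have h1 : ContDiff ℝ 1 (fun x : ℝ => |x| ^ r) := contDiff_norm_rpow hr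
  have h2 := h1.continuous_deriv le_rfl
  have h3 : deriv (fun x : ℝ => |x| ^ r) = fun x => r * sp r x := by
    funext x
    rw [(hasDerivAt_abs_rpow x hr).deriv]; unfold sp; ring
  rw [h3] at h2
  have h4 : sp r = fun x => r⁻¹ * (r * sp r x) := by
    funext x; field_simp
  rw [h4]; exact continuous_const.mul h2

/-- difference of nonlinearities -/
def PhiF (r : ℝ) (V V' : Jet) (l s : ℝ) : ℝ := |V.ut l s| ^ r - |V'.ut l s| ^ r
def PhiD (r : ℝ) (V V' : Jet) (l s : ℝ) : ℝ :=
  r * (sp r (V.ut l s) * V.urt l s - sp r (V'.ut l s) * V'.urt l s)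

lemma src_mk {r : ℝ} (hr : 1 < r) {V V' : Jet} (hV : IsJet V) (hV' : IsJet V') {M : ℝ}
    (b0 : ∀ l s, 0 < l → 0 ≤ s → |PhiF r V V' l s| ≤ M)
    (b1 : ∀ l s, 0 < l → 0 ≤ s → l * |PhiF r V V' l s| ≤ M)
    (b2 : ∀ l s, 0 < l → 0 ≤ s → l * |PhiD r V V' l s| ≤ M) :
    Src (PhiF r V V') (PhiD r V V') M where
  cΦ := by
    unfold PhiF
    exact (hV.ct.abs.rpow_const (fun _ _ => Or.inr (by linarith))).sub
      (hV'.ct.abs.rpow_const (fun _ _ => Or.inr (by linarith)))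
  cΦ' := by
    unfold PhiD
    exact continuousOn_const.mul ((((sp_cont hr).comp_continuousOn hV.ct).mul hV.crt).sub
      (((sp_cont hr).comp_continuousOn hV'.ct).mul hV'.crt))
  d := by
    intro l s hl hs
    have h1 := (hasDerivAt_abs_rpow (V.ut l s) hr).comp l (hV.drt l s hl hs)
    have h2 := (hasDerivAt_abs_rpow (V'.ut l s) hr).comp l (hV'.drt l s hl hs)
    exact (h1.sub h2).congr_deriv (by unfold PhiD sp; ring)
  b0 := b0
  b1 := b1
  b2 := b2

lemma pdt_even {V : Jet} (hV : IsJet V) {l s : ℝ} (hs : 0 < s) : pdt V.u (-l) s = pdt V.u l s := by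
  unfold pdt
  apply Filter.EventuallyEq.deriv_eq
  filter_upwards [Ioi_mem_nhds hs] with t ht
  exact hV.even l t (le_of_lt ht)

lemma HH_src {r : ℝ} {V V' : Jet} (hV : IsJet V) (hV' : IsJet V') (l s : ℝ) (hs : 0 < s) :
    l * (NLt r V.u - NLt r V'.u) l s = HH (PhiF r V V') l s := by
  have key : ∀ x, 0 < x → (NLt r V.u - NLt r V'.u) x s = PhiF r V V' x s := by
    intro x hx
    show NLt r V.u x s - NLt r V'.u x s = _
    unfold NLt PhiF
    rw [hV.pdt_eq hx hs, hV'.pdt_eq hx hs]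
  unfold HH
  rw [abs_of_pos hs]
  rcases lt_trichotomy l 0 with h | h | h
  · rw [abs_of_neg h, ← key (-l) (by linarith)]
    show l * (NLt r V.u l s - NLt r V'.u l s) = l * (NLt r V.u (-l) s - NLt r V'.u (-l) s)
    unfold NLt
    rw [pdt_even hV hs, pdt_even hV' hs]
  · subst h; simp
  · rw [abs_of_pos h, key l h]

lemma HH_bd {Φ w : ℝ → ℝ → ℝ} {A : ℝ} (hA : 0 ≤ A) (hw0 : ∀ l s, 0 ≤ s → 0 ≤ w l s)
    (hw : ∀ l s, w |l| s = w l s) (h : ∀ l s, 0 < l → 0 ≤ s → l * |Φ l s| ≤ A * w l s)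
    (l s : ℝ) (hs : 0 ≤ s) : |HH Φ l s| ≤ A * w l s := by
  by_cases hl : l = 0
  · subst hl
    simp only [HH, zero_mul, abs_zero]
    exact mul_nonneg hA (hw0 _ _ hs)
  · have := h |l| s (abs_pos.2 hl) hs
    rw [hw] at this
    unfold HH
    rw [abs_mul, abs_of_nonneg hs]; exact this

lemma HD_bd {Φ Φ' w : ℝ → ℝ → ℝ} {A : ℝ} (hA : 0 ≤ A) (hw0 : ∀ l s, 0 ≤ s → 0 ≤ w l s)
    (hw : ∀ l s, w |l| s = w l s)
    (h : ∀ l s, 0 < l → 0 ≤ s → |Φ l s| + l * |Φ' l s| ≤ A * w l s)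
    (l s : ℝ) (hs : 0 ≤ s) : |HD Φ Φ' l s| ≤ A * w l s := by
  by_cases hl : l = 0
  · subst hl
    simp only [HD, if_true, abs_zero]
    exact mul_nonneg hA (hw0 _ _ hs)
  · have := h |l| s (abs_pos.2 hl) hs
    rw [hw] at this
    simp only [HD, hl, if_false]
    rw [abs_of_nonneg hs]
    refine (abs_add_le _ _).trans ?_
    rw [abs_mul, abs_abs]; exact this

lemma PhiF_le {r : ℝ} (hr : 1 < r) (V V' : Jet) (l s : ℝ) {X : ℝ} (h1 : |V.ut l s| ≤ X)
    (h2 : |V'.ut l s| ≤ X) :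
    |PhiF r V V' l s| ≤ r * (2 * X) ^ (r - 1) * |(V.sub V').ut l s| := by
  refine (pow_diff hr.le _ _).trans ?_
  show _ ≤ r * (2 * X) ^ (r - 1) * |V.ut l s - V'.ut l s|
  gcongr; linarith

lemma PhiD_le {r : ℝ} (hr : 1 < r) (V V' : Jet) (l s : ℝ) :
    |PhiD r V V' l s| ≤ r * (|V.ut l s| ^ (r - 1) * |(V.sub V').urt l s| +
      |sp r (V.ut l s) - sp r (V'.ut l s)| * |V'.urt l s|) := by
  unfold PhiD
  rw [abs_mul, abs_of_pos (by linarith)]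
  refine mul_le_mul_of_nonneg_left ?_ (by linarith)
  have : sp r (V.ut l s) * V.urt l s - sp r (V'.ut l s) * V'.urt l s =
    sp r (V.ut l s) * (V.sub V').urt l s + (sp r (V.ut l s) - sp r (V'.ut l s)) * V'.urt l s := by
    show _ = sp r (V.ut l s) * (V.urt l s - V'.urt l s) + _
    ring
  rw [this]
  refine (abs_add_le _ _).trans ?_
  rw [abs_mul, abs_mul, abs_sp hr]

lemma Jet.ut_b1 {J : Jet} {l s X : ℝ} (hl : 0 < l) (h : J.b1 l s ≤ X) : l * |J.ut l s| ≤ X := by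
  unfold Jet.b1 at h
  have h1 := abs_nonneg (J.u l s)
  have h2 := mul_nonneg hl.le (abs_nonneg (J.ur l s))
  linarith

lemma Jet.ut_b2 {J : Jet} {l s X : ℝ} (hl : 0 < l) (h : J.b2 l s ≤ X) :
    |J.ut l s| ≤ X / (1 + l) := by
  unfold Jet.b2 at h
  have h1 := abs_nonneg (J.u l s)
  have h2 := mul_nonneg (by linarith : 0 ≤ 1 + l) (abs_nonneg (J.ur l s))
  have h3 : 0 ≤ l * (|J.urr l s| + |J.urt l s| + |J.utt l s|) := by positivity
  rw [le_div_iff₀ (by linarith)]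
  linarith

lemma Jet.urt_b2 {J : Jet} {l s X : ℝ} (hl : 0 < l) (h : J.b2 l s ≤ X) :
    l * |J.urt l s| ≤ X := by
  unfold Jet.b2 at h
  have h1 := abs_nonneg (J.u l s)
  have h2 : 0 ≤ (1 + l) * (|J.ur l s| + |J.ut l s|) := by positivity
  have h3 : 0 ≤ l * (|J.urr l s|) := by positivity
  have h4 : 0 ≤ l * (|J.utt l s|) := by positivity
  linarith

lemma xi_le {l s : ℝ} (hl : 0 ≤ l) : 1 + l + s ≤ 2 * ((1 + l) * (1 + |l - s|)) := by
  have h1 := neg_abs_le (l - s)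
  have h2 := abs_nonneg (l - s)
  nlinarith [mul_nonneg hl h2]

lemma rho_nonneg (a l s : ℝ) : 0 ≤ rho a l s := by unfold rho; positivity

lemma rho_le_one {a : ℝ} (ha : 1 < a) (l s : ℝ) : rho a l s ≤ 1 := by
  unfold rho
  have h1 : (1 + |l|) ^ (-a) ≤ 1 :=
    rpow_le_one_of_one_le_of_nonpos (by linarith [abs_nonneg l]) (by linarith)
  have h2 : (1 + |(|l| - s)|) ^ (-(1 + a)) ≤ 1 :=
    rpow_le_one_of_one_le_of_nonpos (by linarith [abs_nonneg (|l| - s)]) (by linarith)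
  exact mul_le_one₀ h1 (by positivity) h2

lemma rho_abs (a l s : ℝ) : rho a |l| s = rho a l s := by unfold rho; rw [abs_abs]

lemma wR_le {κ q a a' E l s : ℝ} (ha' : a' = κ * (a - 1) + q * κ - 1) (hE : E = q - 1 - a')
    (hE0 : 0 ≤ E) (hl : 0 < l) (hs : 0 ≤ s) :
    (wZ κ l s / (1 + l)) ^ (q - 1) * wZ (κ * a) l s ≤ 2 ^ E * rho a' l s := by
  unfold wZ rho
  rw [abs_of_pos hl]
  have hT : 0 < 1 + |l - s| := by positivity
  have hL : 0 < 1 + l := by linarith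
  have hX : 0 < 1 + l + s := by linarith
  have hx := xi_le (s := s) hl.le
  generalize 1 + |l - s| = T at *
  generalize 1 + l + s = X at *
  generalize 1 + l = L at *
  have e1 : (X ^ (1 - κ) / T / L) ^ (q - 1) * (X ^ (1 - κ * a) / T)
      = X ^ E * (T ^ (-q) * L ^ (1 - q)) := by
    rw [div_rpow (by positivity) hL.le, div_rpow (by positivity) hT.le, ← rpow_mul hX.le]
    have h1 : X ^ E = X ^ ((1 - κ) * (q - 1)) * X ^ (1 - κ * a) := by
      rw [← rpow_add hX]; congr 1; rw [hE, ha']; ring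
    have h2 : T ^ (-q) = (T ^ (q - 1))⁻¹ * T⁻¹ := by
      rw [← rpow_neg hT.le, ← rpow_neg_one, ← rpow_add hT]; congr 1; ring
    have h3 : L ^ (1 - q) = (L ^ (q - 1))⁻¹ := by
      rw [← rpow_neg hL.le]; congr 1; ring
    rw [h1, h2, h3]
    simp only [div_eq_mul_inv]; ring
  rw [e1]
  have e2 : X ^ E ≤ 2 ^ E * (L ^ E * T ^ E) := by
    rw [← mul_rpow hL.le hT.le, ← mul_rpow (by norm_num) (by positivity)]
    exact rpow_le_rpow hX.le hx hE0
  have h4 : L ^ (-a') = L ^ E * L ^ (1 - q) := by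
    rw [← rpow_add hL]; congr 1; rw [hE]; ring
  have h5 : T ^ (-(1 + a')) = T ^ E * T ^ (-q) := by
    rw [← rpow_add hT]; congr 1; rw [hE]; ring
  rw [h4, h5]
  calc _ ≤ 2 ^ E * (L ^ E * T ^ E) * (T ^ (-q) * L ^ (1 - q)) :=
        mul_le_mul_of_nonneg_right e2 (by positivity)
    _ = _ := by ring

lemma R_step {κ q a C0 : ℝ} (hq : 2 < q) (hκ0 : 0 < κ) (hκ1 : κ < 1) (hκa : κ * a < 1)
    (ha' : 1 < κ * (a - 1) + (q * κ - 1)) (hC0 : 0 < C0) :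
    ∃ C > 0, ∀ (ε B1 B2 : ℝ) (W W' : Jet), 0 < ε → 0 ≤ B1 → 0 ≤ B2 → IsJet W → IsJet W' →
      (∀ r t, 0 < r → 0 ≤ t → W.b2 r t ≤ C0 * ε * wZ κ r t) →
      (∀ r t, 0 < r → 0 ≤ t → W'.b2 r t ≤ C0 * ε * wZ κ r t) →
      (∀ r t, 0 < r → 0 ≤ t → (W.sub W').b1 r t ≤ B1 * wZ (κ * a) r t) →
      (∀ r t, 0 < r → 0 ≤ t → (W.sub W').b2 r t ≤ B2 * wZ (κ * a) r t) →
      ∃ J : Jet, IsJet J ∧ J.u = Rop (NLt q W.u - NLt q W'.u) ∧ ∀ r t, 0 < r → 0 ≤ t →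
        J.b1 r t ≤ C * (ε ^ (q - 1) * B1) * wZ (κ * (a - 1) + (q * κ - 1)) r t ∧
        J.b2 r t ≤ C * (ε ^ (q - 1) * (B1 + B2)) * wZ (κ * (a - 1) + (q * κ - 1)) r t := by
  set a' := κ * (a - 1) + (q * κ - 1) with ha'd
  obtain ⟨CR, hCR, HR⟩ := R_est ha'
  set E := q - 1 - a' with hE
  have hE0 : 0 ≤ E := by
    have : E = (1 - κ) * (q - 1) + (1 - κ * a) := by rw [hE, ha'd]; ring
    rw [this]
    have := mul_nonneg (by linarith : 0 ≤ 1 - κ) (by linarith : 0 ≤ q - 1)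
    linarith
  set D := q * (q + 1) * (2 * C0) ^ (q - 1) * 2 ^ E with hD
  have hq0 : 0 < q := by linarith
  have hD0 : 0 < D := by positivity
  refine ⟨CR * D, by positivity, ?_⟩
  intro ε B1 B2 W W' hε hB1 hB2 hW hW' bW bW' z1 z2
  -- pointwise data
  have key : ∀ l s, 0 < l → 0 ≤ s →
      l * |PhiF q W W' l s| ≤ D * (ε ^ (q - 1) * B1) * rho a' l s ∧
      |PhiF q W W' l s| + l * |PhiD q W W' l s| ≤ D * (ε ^ (q - 1) * B2) * rho a' l s := by
    intro l s hl hs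
    have hLp : 0 < 1 + l := by linarith
    have hwp : 0 < wZ κ l s := by unfold wZ; positivity
    set Wz := wZ (κ * a) l s with hWz
    have hWz0 : 0 ≤ Wz := wZ_nonneg _ _ _ hl.le hs
    set X := C0 * ε * wZ κ l s / (1 + l) with hX
    have hX0 : 0 < X := by positivity
    have x1 := Jet.ut_b2 hl (bW l s hl hs)
    have x2 := Jet.ut_b2 hl (bW' l s hl hs)
    have zt1 := Jet.ut_b1 hl (z1 l s hl hs)
    have zt2 := Jet.ut_b2 hl (z2 l s hl hs)
    have zt2' : |(W.sub W').ut l s| ≤ B2 * Wz :=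
      zt2.trans (div_le_self (by positivity) (by linarith))
    have zrt := Jet.urt_b2 hl (z2 l s hl hs)
    have Wrt := Jet.urt_b2 hl (bW' l s hl hs)
    have wgt := wR_le (κ := κ) (q := q) (a := a) (a' := a') (E := E) (by rw [ha'd]; ring) rfl hE0 hl hs
    have f1 := PhiF_le (by linarith : 1 < q) W W' l s x1 x2
    have f2 := PhiD_le (by linarith : 1 < q) W W' l s
    have f3 := sp_lip hq (W.ut l s) (W'.ut l s)
    set Y := (2 * X) ^ (q - 1) with hY
    have hY0 : 0 < Y := by positivity
    have hYW : Y * Wz ≤ (2 * C0) ^ (q - 1) * ε ^ (q - 1) * (2 ^ E * rho a' l s) := by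
      have : Y = (2 * C0) ^ (q - 1) * ε ^ (q - 1) * (wZ κ l s / (1 + l)) ^ (q - 1) := by
        rw [← mul_rpow (by positivity) hε.le, ← mul_rpow (by positivity) (by positivity), hY, hX]
        congr 1; ring
      rw [this, mul_assoc]
      exact mul_le_mul_of_nonneg_left wgt (by positivity)
    have fin : ∀ B, 0 ≤ B → q * (q + 1) * (Y * (B * Wz)) ≤ D * (ε ^ (q - 1) * B) * rho a' l s := by
      intro B hB
      calc q * (q + 1) * (Y * (B * Wz)) = q * (q + 1) * B * (Y * Wz) := by ring
        _ ≤ q * (q + 1) * B * ((2 * C0) ^ (q - 1) * ε ^ (q - 1) * (2 ^ E * rho a' l s)) :=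
          mul_le_mul_of_nonneg_left hYW (by positivity)
        _ = _ := by rw [hD]; ring
    constructor
    · refine le_trans ?_ (fin B1 hB1)
      calc l * |PhiF q W W' l s| ≤ l * (q * Y * |(W.sub W').ut l s|) := by gcongr
        _ = q * Y * (l * |(W.sub W').ut l s|) := by ring
        _ ≤ q * Y * (B1 * Wz) := by gcongr
        _ ≤ _ := by
          have : 0 ≤ q * q * (Y * (B1 * Wz)) := by positivity
          nlinarith
    · refine le_trans ?_ (fin B2 hB2)
      have g1 : |PhiF q W W' l s| ≤ q * (Y * (B2 * Wz)) := by
        refine f1.trans ?_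
        rw [mul_assoc]; gcongr
      have g2 : |W.ut l s| ^ (q - 1) * (l * |(W.sub W').urt l s|) ≤ Y * (B2 * Wz) := by
        have : |W.ut l s| ^ (q - 1) ≤ Y := by
          apply rpow_le_rpow (abs_nonneg _) _ (by linarith)
          linarith
        gcongr
      have g3 : |sp q (W.ut l s) - sp q (W'.ut l s)| * (l * |W'.urt l s|) ≤
          (q - 1) * (Y * (B2 * Wz)) := by
        have h1 : (|W.ut l s| + |W'.ut l s|) ^ (q - 2) ≤ (2 * X) ^ (q - 2) := by
          apply rpow_le_rpow (by positivity) _ (by linarith)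
          linarith
        have h2 : Y = (2 * X) ^ (q - 2) * (2 * X) := by
          rw [← rpow_add_one (by positivity), hY]; congr 1; ring
        have h0 : 0 ≤ q - 1 := by linarith
        calc _ ≤ ((q - 1) * (2 * X) ^ (q - 2) * (B2 * Wz / (1 + l))) * (C0 * ε * wZ κ l s) := by
              apply mul_le_mul (f3.trans _) Wrt (by positivity) (by positivity)
              apply mul_le_mul (mul_le_mul_of_nonneg_left h1 h0) zt2 (abs_nonneg _) (by positivity)
          _ = (q - 1) * (((2 * X) ^ (q - 2) * X) * (B2 * Wz)) := by rw [hX]; ring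
          _ ≤ (q - 1) * (Y * (B2 * Wz)) := by
              have : (2 * X) ^ (q - 2) * X ≤ Y := by
                rw [h2]; gcongr; linarith
              gcongr
      have g4 : l * |PhiD q W W' l s| ≤ q * (Y * (B2 * Wz) + (q - 1) * (Y * (B2 * Wz))) := by
        calc _ ≤ l * (q * (|W.ut l s| ^ (q - 1) * |(W.sub W').urt l s| +
              |sp q (W.ut l s) - sp q (W'.ut l s)| * |W'.urt l s|)) :=
              mul_le_mul_of_nonneg_left f2 hl.le
          _ = q * (|W.ut l s| ^ (q - 1) * (l * |(W.sub W').urt l s|) +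
              |sp q (W.ut l s) - sp q (W'.ut l s)| * (l * |W'.urt l s|)) := by ring
          _ ≤ _ := mul_le_mul_of_nonneg_left (add_le_add g2 g3) hq0.le
      linarith
  set A1 := D * (ε ^ (q - 1) * B1) with hA1
  set A2 := D * (ε ^ (q - 1) * B2) with hA2
  have hA10 : 0 ≤ A1 := by positivity
  have hA20 : 0 ≤ A2 := by positivity
  have r1 : ∀ A, 0 ≤ A → ∀ l s, A * rho a' l s ≤ A := fun A hA l s =>
    mul_le_of_le_one_right hA (rho_le_one ha' l s)
  have hsrc : Src (PhiF q W W') (PhiD q W W') (A1 + A2) := by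
    refine src_mk (by linarith) hW hW' ?_ ?_ ?_
    · intro l s hl hs
      have := (key l s hl hs).2
      have h3 : 0 ≤ l * |PhiD q W W' l s| := by positivity
      linarith [r1 A2 hA20 l s]
    · intro l s hl hs
      have := (key l s hl hs).1
      linarith [r1 A1 hA10 l s]
    · intro l s hl hs
      have := (key l s hl hs).2
      linarith [r1 A2 hA20 l s, abs_nonneg (PhiF q W W' l s)]
  obtain ⟨J, hJ, hJu, hb⟩ := HR _ _ (NLt q W.u - NLt q W'.u) _ A1 A2 hsrc
    (fun l s hs => HH_src hW hW' l s hs) hA10 hA20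
    (HH_bd hA10 (fun l s _ => rho_nonneg _ _ _) (rho_abs a') (fun l s hl hs => (key l s hl hs).1))
    (HD_bd hA20 (fun l s _ => rho_nonneg _ _ _) (rho_abs a') (fun l s hl hs => (key l s hl hs).2))
  refine ⟨J, hJ, hJu, fun r t hr ht => ⟨(hb r t hr ht).1.trans_eq ?_, (hb r t hr ht).2.trans_eq ?_⟩⟩
  · rw [hA1]; ring
  · rw [hA1, hA2]; ring

def kh (κ y : ℝ) : ℝ := Set.indicator (Set.Ioc (0:ℝ) 1) (fun x : ℝ => x ^ (-κ)) y

def kk (κ y : ℝ) : ℝ := kh κ y + kh κ (-y)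

lemma kh_nonneg (κ y : ℝ) : 0 ≤ kh κ y := by
  unfold kh
  apply Set.indicator_nonneg
  intro x hx
  have : 0 < x := hx.1
  positivity

lemma kk_nonneg (κ y : ℝ) : 0 ≤ kk κ y := add_nonneg (kh_nonneg _ _) (kh_nonneg _ _)

lemma kk_int {κ : ℝ} (h : κ < 1) : Integrable (kk κ) := by
  have h1 : Integrable (kh κ) := by
    have h2 := intervalIntegral.intervalIntegrable_rpow' (a := 0) (b := 1) (r := -κ) (by linarith)
    rw [intervalIntegrable_iff_integrableOn_Ioc_of_le zero_le_one] at h2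
    exact (integrable_indicator_iff measurableSet_Ioc).2 h2
  exact h1.add h1.comp_neg

lemma kk_abs (κ y : ℝ) : kk κ |y| = kk κ y := by
  unfold kk
  rcases abs_cases y with ⟨h, _⟩ | ⟨h, _⟩
  · rw [h]
  · rw [h, neg_neg, add_comm]

lemma kk_ge {κ y : ℝ} (h0 : 0 < y) (h1 : y ≤ 1) : y ^ (-κ) ≤ kk κ y := by
  have h2 : kh κ y = y ^ (-κ) := Set.indicator_of_mem (Set.mem_Ioc.2 ⟨h0, h1⟩) _
  unfold kk
  rw [h2]; linarith [kh_nonneg κ (-y)]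

lemma om_abs {μ δ : ℝ} {k : ℝ → ℝ} (hk : ∀ y, k |y| = k y) (l s : ℝ) :
    om μ δ k |l| s = om μ δ k l s := by
  unfold om; rw [abs_abs, hk]

lemma om_nonneg' {μ δ : ℝ} {k : ℝ → ℝ} (hk : ∀ y, 0 ≤ k y) (l s : ℝ) (hs : 0 ≤ s) :
    0 ≤ om μ δ k l s := by
  unfold om
  have := hk l
  positivity

lemma wL1 {κ K2 a l s : ℝ} (hκ0 : 0 < κ) (hκ1 : κ < 1) (ha : 1 ≤ a) (hl : 0 < l) (hs : 0 ≤ s) :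
    (wX K2 l s / (1 + l)) ^ κ * wZ a l s ≤
      2 ^ κ * om (κ * a) (1 + κ * (K2 - 1)) (fun _ => 0) l s := by
  unfold wX wZ om
  rw [abs_of_pos hl, add_zero]
  have hT : 0 < 1 + |l - s| := by positivity
  have hL : 0 < 1 + l := by linarith
  have hX : 0 < 1 + l + s := by linarith
  have hX1 : 1 ≤ 1 + l + s := by linarith
  have hx := xi_le (s := s) hl.le
  generalize 1 + |l - s| = T at *
  generalize 1 + l + s = X at *
  generalize 1 + l = L at *
  have h1 : L ^ (-κ) ≤ 2 ^ κ * (X ^ (-κ) * T ^ κ) := by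
    have h := pow_scale (c := 2 * T) (x := L) (N := X) (a := κ) (by positivity) hX hκ0.le
      (by linarith)
    rw [mul_rpow (by norm_num) hT.le] at h
    linarith
  have e1 : (T ^ (-K2) / L) ^ κ * (X ^ (1 - a) / T) = T ^ (-K2 * κ) * T⁻¹ * X ^ (1 - a) * L ^ (-κ) := by
    rw [div_rpow (by positivity) hL.le, ← rpow_mul hT.le, rpow_neg hL.le]
    simp only [div_eq_mul_inv]; ring
  have e2 : T ^ (-(1 + κ * (K2 - 1))) = T ^ (-K2 * κ) * T⁻¹ * T ^ κ := by
    rw [← rpow_neg_one, ← rpow_add hT, ← rpow_add hT]; congr 1; ring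
  have e3 : X ^ (1 - a) * X ^ (-κ) ≤ X ^ (-(κ * a)) := by
    rw [← rpow_add hX]
    apply rpow_le_rpow_of_exponent_le hX1
    nlinarith
  rw [e1, e2]
  calc _ ≤ T ^ (-K2 * κ) * T⁻¹ * X ^ (1 - a) * (2 ^ κ * (X ^ (-κ) * T ^ κ)) :=
        mul_le_mul_of_nonneg_left h1 (by positivity)
    _ = 2 ^ κ * (T ^ (-K2 * κ) * T⁻¹ * T ^ κ) * (X ^ (1 - a) * X ^ (-κ)) := by ring
    _ ≤ 2 ^ κ * (T ^ (-K2 * κ) * T⁻¹ * T ^ κ) * X ^ (-(κ * a)) :=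
        mul_le_mul_of_nonneg_left e3 (by positivity)
    _ = _ := by ring

lemma wL2 {κ K2 a l s : ℝ} (hκ0 : 0 < κ) (hκ1 : κ < 1) (hK2 : 1 < K2) (hl : 0 < l)
    (hs : 0 ≤ s) :
    (wZ a l s / l) ^ κ * wX K2 l s ≤ 4 ^ κ * om (κ * a) (1 + κ * (K2 - 1)) (kk κ) l s := by
  unfold wX wZ om
  rw [abs_of_pos hl]
  have hT : 0 < 1 + |l - s| := by positivity
  have hT1 : 1 ≤ 1 + |l - s| := by linarith [abs_nonneg (l - s)]
  have hX : 0 < 1 + l + s := by linarith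
  have hx := xi_le (s := s) hl.le
  have hk0 := kk_nonneg κ l
  have hk1 := fun h : l ≤ 1 => kk_ge (κ := κ) hl h
  generalize 1 + |l - s| = T at *
  generalize 1 + l + s = X at *
  have e1 : (X ^ (1 - a) / T / l) ^ κ * T ^ (-K2) =
      X ^ (-(κ * a)) * (X ^ κ * T ^ (-κ) * l ^ (-κ) * T ^ (-K2)) := by
    rw [div_rpow (by positivity) hl.le, div_rpow (by positivity) hT.le, ← rpow_mul hX.le,
      rpow_neg hl.le, rpow_neg hT.le κ]
    have : X ^ ((1 - a) * κ) = X ^ (-(κ * a)) * X ^ κ := by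
      rw [← rpow_add hX]; congr 1; ring
    rw [this]; simp only [div_eq_mul_inv]; ring
  have eT : T ^ (-κ) * T ^ κ = 1 := by rw [← rpow_add hT]; simp
  rw [e1, mul_left_comm ((4:ℝ) ^ κ)]
  apply mul_le_mul_of_nonneg_left _ (by positivity)
  have hTδ : T ^ (-K2) ≤ T ^ (-(1 + κ * (K2 - 1))) := by
    apply rpow_le_rpow_of_exponent_le hT1
    nlinarith
  rcases le_total 1 l with h | h
  · have h1 : l ^ (-κ) * X ^ κ ≤ 4 ^ κ * T ^ κ := by
      rw [← mul_rpow (by norm_num) hT.le]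
      rw [rpow_neg hl.le, ← inv_rpow hl.le, ← mul_rpow (by positivity) hX.le]
      apply rpow_le_rpow (by positivity) _ hκ0.le
      rw [inv_mul_le_iff₀ hl]
      nlinarith
    calc _ = T ^ (-κ) * T ^ (-K2) * (l ^ (-κ) * X ^ κ) := by ring
      _ ≤ T ^ (-κ) * T ^ (-K2) * (4 ^ κ * T ^ κ) := mul_le_mul_of_nonneg_left h1 (by positivity)
      _ = 4 ^ κ * T ^ (-K2) * (T ^ (-κ) * T ^ κ) := by ring
      _ = 4 ^ κ * T ^ (-K2) := by rw [eT, mul_one]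
      _ ≤ _ := by
        apply mul_le_mul_of_nonneg_left _ (by positivity)
        linarith
  · have h1 : X ^ κ ≤ 4 ^ κ * T ^ κ := by
      rw [← mul_rpow (by norm_num) hT.le]
      apply rpow_le_rpow (by positivity) _ hκ0.le
      nlinarith
    have h2 : T ^ (-K2) ≤ 1 := rpow_le_one_of_one_le_of_nonpos hT1 (by linarith)
    calc _ = T ^ (-κ) * T ^ (-K2) * l ^ (-κ) * X ^ κ := by ring
      _ ≤ T ^ (-κ) * T ^ (-K2) * l ^ (-κ) * (4 ^ κ * T ^ κ) :=
        mul_le_mul_of_nonneg_left h1 (by positivity)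
      _ = 4 ^ κ * l ^ (-κ) * (T ^ (-κ) * T ^ κ) * T ^ (-K2) := by ring
      _ ≤ 4 ^ κ * l ^ (-κ) * (T ^ (-κ) * T ^ κ) * 1 := mul_le_mul_of_nonneg_left h2 (by positivity)
      _ = 4 ^ κ * l ^ (-κ) := by rw [eT, mul_one, mul_one]
      _ ≤ _ := by
        apply mul_le_mul_of_nonneg_left _ (by positivity)
        have : 0 ≤ T ^ (-(1 + κ * (K2 - 1))) := by positivity
        linarith [hk1 h]

lemma wX_le_one {ν : ℝ} (h : 0 ≤ ν) (r t : ℝ) : wX ν r t ≤ 1 :=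
  rpow_le_one_of_one_le_of_nonpos (by linarith [abs_nonneg (r - t)]) (by linarith)

set_option maxHeartbeats 1000000 in
lemma L_step {p K2 a C0 : ℝ} (hp1 : 1 < p) (hp2 : p < 2) (ha : 1 ≤ a) (hκa : (p - 1) * a < 1)
    (hK2 : 1 < K2) (hC0 : 0 < C0) :
    ∃ C > 0, ∀ (ε B1 B2 : ℝ) (V V' : Jet), 0 < ε → 0 ≤ B1 → 0 ≤ B2 → IsJet V → IsJet V' →
      (∀ r t, 0 < r → 0 ≤ t → V.b2 r t ≤ C0 * ε * wX K2 r t) →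
      (∀ r t, 0 < r → 0 ≤ t → V'.b2 r t ≤ C0 * ε * wX K2 r t) →
      (∀ r t, 0 < r → 0 ≤ t → (V.sub V').b1 r t ≤ B1 * wZ a r t) →
      (∀ r t, 0 < r → 0 ≤ t → (V.sub V').b2 r t ≤ B2 * wZ a r t) →
      ∃ J : Jet, IsJet J ∧ J.u = Lop (NLt p V.u - NLt p V'.u) ∧ ∀ r t, 0 < r → 0 ≤ t →
        J.b1 r t ≤ C * (ε ^ (p - 1) * B1) * wZ ((p - 1) * a) r t ∧
        J.b2 r t ≤ C * (ε ^ (p - 1) * B1 + ε ^ (p - 1) * B2 + ε * B1 ^ (p - 1)) *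
          wZ ((p - 1) * a) r t := by
  set κ := p - 1 with hκ
  have hκ0 : 0 < κ := by linarith
  have hκ1 : κ < 1 := by linarith
  set δ := 1 + κ * (K2 - 1) with hδ
  have hδ1 : 1 < δ := by
    have := mul_pos hκ0 (by linarith : 0 < K2 - 1)
    linarith
  set μ := κ * a with hμ
  obtain ⟨CL, hCL, HL⟩ := L_est (kk_int hκ1) (kk_nonneg κ) (by positivity : 0 ≤ μ) hκa hδ1
  set D1 := p * ((2 * C0) ^ κ * 2 ^ κ) with hD1
  set D2 := p * (2 * C0 * 4 ^ κ) with hD2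
  have hp0 : 0 < p := by linarith
  have hD10 : 0 < D1 := by positivity
  have hD20 : 0 < D2 := by positivity
  refine ⟨CL * (2 * D1 + D2), by positivity, ?_⟩
  intro ε B1 B2 V V' hε hB1 hB2 hV hV' bV bV' z1 z2
  have om0 : ∀ l s, 0 ≤ s → 0 ≤ om μ δ (fun _ => 0) l s := om_nonneg' (fun _ => le_rfl)
  have omk : ∀ l s, 0 ≤ s → 0 ≤ om μ δ (kk κ) l s := om_nonneg' (kk_nonneg κ)
  have om0k : ∀ l s, 0 ≤ s → om μ δ (fun _ => 0) l s ≤ om μ δ (kk κ) l s := by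
    intro l s hs
    unfold om
    apply mul_le_mul_of_nonneg_left _ (by positivity)
    linarith [kk_nonneg κ l]
  have om01 : ∀ l s, 0 ≤ s → om μ δ (fun _ => 0) l s ≤ 1 := by
    intro l s hs
    unfold om
    rw [add_zero]
    have h1 : (1 + |l| + s) ^ (-μ) ≤ 1 :=
      rpow_le_one_of_one_le_of_nonpos (by linarith [abs_nonneg l])
        (by have : 0 ≤ μ := by positivity
            linarith)
    have h2 : (1 + |(|l| - s)|) ^ (-δ) ≤ 1 :=
      rpow_le_one_of_one_le_of_nonpos (by linarith [abs_nonneg (|l| - s)]) (by linarith)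
    exact mul_le_one₀ h1 (by positivity) h2
  set c := C0 * ε with hc
  have hc0 : 0 < c := by positivity
  have key : ∀ l s, 0 < l → 0 ≤ s →
      l * |PhiF p V V' l s| ≤ D1 * (ε ^ κ * B1) * om μ δ (fun _ => 0) l s ∧
      |PhiF p V V' l s| ≤ D1 * (ε ^ κ * B2) * om μ δ (fun _ => 0) l s ∧
      l * |PhiD p V V' l s| ≤ D1 * (ε ^ κ * B2) * om μ δ (fun _ => 0) l s +
        D2 * (ε * B1 ^ κ) * om μ δ (kk κ) l s ∧
      l * |PhiD p V V' l s| ≤ D1 * (ε ^ κ * B2) + p * (2 * c ^ κ * c) := by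
    intro l s hl hs
    have hLp : 0 < 1 + l := by linarith
    have hwp : 0 < wX K2 l s := by unfold wX; positivity
    have hw1 := wX_le_one (by linarith : 0 ≤ K2) l s
    set Wz := wZ a l s with hWz
    have hWz0 : 0 ≤ Wz := wZ_nonneg _ _ _ hl.le hs
    set X := c * wX K2 l s / (1 + l) with hX
    have hX0 : 0 < X := by positivity
    have hXc : X ≤ c := by
      rw [hX, div_le_iff₀ hLp]
      nlinarith
    have x1 := Jet.ut_b2 hl (bV l s hl hs)
    have x2 := Jet.ut_b2 hl (bV' l s hl hs)
    have zt1 := Jet.ut_b1 hl (z1 l s hl hs)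
    have zt2 := Jet.ut_b2 hl (z2 l s hl hs)
    have zt2' : |(V.sub V').ut l s| ≤ B2 * Wz :=
      zt2.trans (div_le_self (by positivity) (by linarith))
    have zrt := Jet.urt_b2 hl (z2 l s hl hs)
    have Vrt := Jet.urt_b2 hl (bV' l s hl hs)
    have w1 := wL1 (K2 := K2) hκ0 hκ1 ha hl hs
    have w2 := wL2 (a := a) hκ0 hκ1 hK2 hl hs
    have f1 := PhiF_le hp1 V V' l s x1 x2
    have f2 := PhiD_le hp1 V V' l s
    have f3 := sp_holder hp1 hp2 (V.ut l s) (V'.ut l s)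
    rw [← hκ] at f1 f2 f3
    set Y := (2 * X) ^ κ with hY
    have hY0 : 0 < Y := by positivity
    have hYW : Y * Wz ≤ (2 * C0) ^ κ * ε ^ κ * (2 ^ κ * om μ δ (fun _ => 0) l s) := by
      have : Y = (2 * C0) ^ κ * ε ^ κ * (wX K2 l s / (1 + l)) ^ κ := by
        rw [← mul_rpow (by positivity) hε.le, ← mul_rpow (by positivity) (by positivity), hY, hX, hc]
        congr 1; ring
      rw [this, mul_assoc]
      exact mul_le_mul_of_nonneg_left w1 (by positivity)
    have fin : ∀ B, 0 ≤ B → p * (Y * (B * Wz)) ≤ D1 * (ε ^ κ * B) * om μ δ (fun _ => 0) l s := by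
      intro B hB
      calc p * (Y * (B * Wz)) = p * B * (Y * Wz) := by ring
        _ ≤ p * B * ((2 * C0) ^ κ * ε ^ κ * (2 ^ κ * om μ δ (fun _ => 0) l s)) :=
          mul_le_mul_of_nonneg_left hYW (by positivity)
        _ = _ := by rw [hD1]; ring
    have hPD : l * |PhiD p V V' l s| ≤ p * (|V.ut l s| ^ κ * (l * |(V.sub V').urt l s|) +
              |sp p (V.ut l s) - sp p (V'.ut l s)| * (l * |V'.urt l s|)) := by
      calc _ ≤ l * (p * (|V.ut l s| ^ κ * |(V.sub V').urt l s| +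
              |sp p (V.ut l s) - sp p (V'.ut l s)| * |V'.urt l s|)) :=
              mul_le_mul_of_nonneg_left f2 hl.le
        _ = _ := by ring
    have g2 : p * (|V.ut l s| ^ κ * (l * |(V.sub V').urt l s|)) ≤
        D1 * (ε ^ κ * B2) * om μ δ (fun _ => 0) l s := by
      refine le_trans ?_ (fin B2 hB2)
      have : |V.ut l s| ^ κ ≤ Y := by
        apply rpow_le_rpow (abs_nonneg _) _ (by linarith)
        linarith
      gcongr
    refine ⟨?_, ?_, ?_, ?_⟩
    · refine le_trans ?_ (fin B1 hB1)
      calc l * |PhiF p V V' l s| ≤ l * (p * Y * |(V.sub V').ut l s|) := by gcongr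
        _ = p * (Y * (l * |(V.sub V').ut l s|)) := by ring
        _ ≤ _ := by gcongr
    · refine le_trans ?_ (fin B2 hB2)
      refine f1.trans ?_
      rw [mul_assoc]; gcongr
    · refine hPD.trans ?_
      rw [mul_add]
      refine add_le_add g2 ?_
      have h1 : |V.ut l s - V'.ut l s| ^ κ ≤ B1 ^ κ * (Wz / l) ^ κ := by
        rw [← mul_rpow hB1 (by positivity)]
        apply rpow_le_rpow (abs_nonneg _) _ hκ0.le
        rw [← mul_div_assoc, le_div_iff₀ hl, mul_comm]; exact zt1
      calc _ ≤ p * ((2 * (B1 ^ κ * (Wz / l) ^ κ)) * (c * wX K2 l s)) := by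
            apply mul_le_mul_of_nonneg_left _ hp0.le
            apply mul_le_mul _ Vrt (by positivity) (by positivity)
            linarith
        _ = p * 2 * B1 ^ κ * c * ((Wz / l) ^ κ * wX K2 l s) := by ring
        _ ≤ p * 2 * B1 ^ κ * c * (4 ^ κ * om μ δ (kk κ) l s) :=
            mul_le_mul_of_nonneg_left w2 (by positivity)
        _ = _ := by rw [hD2, hc]; ring
    · refine hPD.trans ?_
      rw [mul_add]
      refine add_le_add (g2.trans ?_) ?_
      · exact mul_le_of_le_one_right (by positivity) (om01 l s hs)
      · have h1 : ∀ x : ℝ, |x| ≤ X → |sp p x| ≤ c ^ κ := by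
          intro x hx
          rw [abs_sp hp1]
          exact rpow_le_rpow (abs_nonneg _) (hx.trans hXc) hκ0.le
        have h2 := abs_sub (sp p (V.ut l s)) (sp p (V'.ut l s))
        have h3 := h1 _ x1
        have h4 := h1 _ x2
        apply mul_le_mul_of_nonneg_left _ hp0.le
        apply mul_le_mul _ (Vrt.trans _) (by positivity) (by positivity)
        · linarith
        · nlinarith
  set A1 := D1 * (ε ^ κ * B1) with hA1
  set A2 := D1 * (ε ^ κ * B2) with hA2
  set A3 := D2 * (ε * B1 ^ κ) with hA3
  have hA10 : 0 ≤ A1 := by positivity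
  have hA20 : 0 ≤ A2 := by positivity
  have hA30 : 0 ≤ A3 := by positivity
  have hM : 0 ≤ p * (2 * c ^ κ * c) := by positivity
  have hsrc : Src (PhiF p V V') (PhiD p V V') (A1 + A2 + p * (2 * c ^ κ * c)) := by
    refine src_mk hp1 hV hV' ?_ ?_ ?_
    · intro l s hl hs
      have := (key l s hl hs).2.1
      linarith [mul_le_of_le_one_right hA20 (om01 l s hs)]
    · intro l s hl hs
      have := (key l s hl hs).1
      linarith [mul_le_of_le_one_right hA10 (om01 l s hs)]
    · intro l s hl hs
      have := (key l s hl hs).2.2.2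
      linarith
  obtain ⟨J, hJ, hJu, hb⟩ := HL _ _ (NLt p V.u - NLt p V'.u) _ A1 (2 * A2 + A3) hsrc
    (fun l s hs => HH_src hV hV' l s hs) hA10 (by positivity)
    (HH_bd hA10 om0 (om_abs (fun _ => rfl)) (fun l s hl hs => (key l s hl hs).1))
    (HD_bd (by positivity) omk (om_abs (kk_abs κ)) (fun l s hl hs => by
      have k1 := (key l s hl hs).2.1
      have k2 := (key l s hl hs).2.2.1
      have k3 := mul_le_mul_of_nonneg_left (om0k l s hs) hA20
      linarith))
  have e0 : 0 ≤ ε ^ κ * B1 := by positivity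
  have e1 : 0 ≤ ε ^ κ * B2 := by positivity
  have e2 : 0 ≤ ε * B1 ^ κ := by positivity
  refine ⟨J, hJ, hJu, fun r t hr ht => ⟨(hb r t hr ht).1.trans ?_, (hb r t hr ht).2.trans ?_⟩⟩
  · apply mul_le_mul_of_nonneg_right _ (wZ_nonneg _ _ _ hr.le ht)
    rw [mul_assoc]
    apply mul_le_mul_of_nonneg_left _ hCL.le
    rw [hA1]
    linarith [mul_nonneg hD10.le e0, mul_nonneg hD20.le e0]
  · apply mul_le_mul_of_nonneg_right _ (wZ_nonneg _ _ _ hr.le ht)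
    rw [mul_assoc]
    apply mul_le_mul_of_nonneg_left _ hCL.le
    rw [hA1, hA2, hA3]
    linarith [mul_nonneg hD10.le e0, mul_nonneg hD10.le e1, mul_nonneg hD10.le e2,
      mul_nonneg hD20.le e0, mul_nonneg hD20.le e1, mul_nonneg hD20.le e2]

def waveOf (α α1 α2 : ℝ → ℝ) : Wave where
  h := fun _ _ => 0
  H := fun _ _ => 0
  m0 := fun r t => α (r + t)
  m1 := fun r t => α1 (r + t)
  m2 := fun r t => α2 (r + t)
  p0 := fun r t => α (t - r)
  p1 := fun r t => - α1 (t - r)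
  p2 := fun r t => α2 (t - r)

lemma isWave_waveOf {α α1 α2 : ℝ → ℝ} (d1 : ∀ x, HasDerivAt α (α1 x) x)
    (d2 : ∀ x, HasDerivAt α1 (α2 x) x) (c2 : Continuous α2) : IsWave (waveOf α α1 α2) := by
  have c0 : Continuous α := continuous_iff_continuousAt.2 fun x => (d1 x).continuousAt
  have c1 : Continuous α1 := continuous_iff_continuousAt.2 fun x => (d2 x).continuousAt
  have ar : ∀ r t : ℝ, HasDerivAt (fun x : ℝ => x + t) 1 r := fun r t =>
    (hasDerivAt_id r).add_const t
  have at' : ∀ r t : ℝ, HasDerivAt (fun s : ℝ => r + s) 1 t := fun r t =>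
    (hasDerivAt_id t).const_add r
  have br : ∀ r t : ℝ, HasDerivAt (fun x : ℝ => t - x) (-1) r := fun r t =>
    (hasDerivAt_id r).const_sub t
  have bt : ∀ r t : ℝ, HasDerivAt (fun s : ℝ => s - r) 1 t := fun r t =>
    (hasDerivAt_id t).sub_const r
  constructor
  · intro r t
    exact ((d1 (r + t)).comp r (ar r t)).congr_deriv (by simp [waveOf])
  · intro r t
    exact ((d1 (t - r)).comp r (br r t)).congr_deriv (by simp [waveOf])
  · intro r t
    exact ((d2 (r + t)).comp r (ar r t)).congr_deriv (by simp [waveOf])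
  · intro r t
    exact ((d2 (t - r)).comp r (br r t)).neg.congr_deriv (by simp [waveOf])
  · intro r t
    exact ((d1 (r + t)).comp t (at' r t)).congr_deriv (by simp [waveOf])
  · intro r t
    exact ((d1 (t - r)).comp t (bt r t)).congr_deriv (by simp [waveOf])
  · intro r t
    exact ((d2 (r + t)).comp t (at' r t)).congr_deriv (by simp [waveOf])
  · intro r t
    exact ((d2 (t - r)).comp t (bt r t)).neg.congr_deriv (by simp [waveOf])
  · simp only [waveOf]; fun_prop
  · simp only [waveOf]; fun_prop
  · simp only [waveOf]; fun_prop
  · simp only [waveOf]; fun_prop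
  · simp only [waveOf]; fun_prop
  · simp only [waveOf]; fun_prop
  · simp only [waveOf]; fun_prop
  · intro r t; simp only [waveOf]; congr 1; ring
  · intro r t; simp only [waveOf]; rw [neg_neg]; congr 1; ring

/-- even extension of a bound to the whole line -/
lemma bound_ext {G : ℝ → ℝ} {c ν : ℝ} (hG : Continuous G) (he : ∀ x, G (-x) = G x)
    (h : ∀ x, 0 < x → G x ≤ c * (1 + x) ^ (-ν)) (x : ℝ) : G x ≤ c * (1 + |x|) ^ (-ν) := by
  have hc : Continuous (fun x : ℝ => c * (1 + |x|) ^ (-ν)) := by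
    apply continuous_const.mul
    apply Continuous.rpow_const (by fun_prop)
    intro x; left; positivity
  have hcl : IsClosed {x : ℝ | G x ≤ c * (1 + |x|) ^ (-ν)} := isClosed_le hG hc
  have hsub : ({0}ᶜ : Set ℝ) ⊆ {x : ℝ | G x ≤ c * (1 + |x|) ^ (-ν)} := by
    intro y hy
    have hy0 : y ≠ 0 := hy
    show G y ≤ c * (1 + |y|) ^ (-ν)
    have h1 := h |y| (abs_pos.2 hy0)
    rcases abs_cases y with ⟨h2, _⟩ | ⟨h2, _⟩
    · rw [h2] at h1 ⊢; exact h1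
    · rw [h2] at h1 ⊢; rw [he] at h1; exact h1
  have := (dense_compl_singleton (0:ℝ)).closure_eq ▸ hcl.closure_subset_iff.2 hsub
  exact this trivial

lemma dd_identity {f : ℝ → ℝ} (hf : ContDiff ℝ 1 f) (hφ : ContDiff ℝ 2 (fun r => r * f r)) :
    (∀ x, deriv (fun r => r * f r) x = f x + x * deriv f x) ∧
    ∀ x, 0 < x → deriv (deriv (fun r => r * f r)) x = 2 * deriv f x + x * deriv (deriv f) x := by
  have hd : ∀ x, HasDerivAt f (deriv f x) x := fun x =>
    (hf.differentiable (by norm_num) x).hasDerivAt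
  have h1 : ∀ x, deriv (fun r => r * f r) x = f x + x * deriv f x := by
    intro x
    exact (((hasDerivAt_id x).mul (hd x)).congr_deriv (by simp)).deriv
  refine ⟨h1, fun x hx => ?_⟩
  have hφ2 : ContDiff ℝ (1 + 1) (fun r => r * f r) := by
    rw [one_add_one_eq_two]; exact hφ
  have hφ1 : ContDiff ℝ 1 (deriv (fun r => r * f r)) := hφ2.deriv'
  have hdd : DifferentiableAt ℝ (deriv f) x := by
    have h2 : deriv f =ᶠ[nhds x] fun y => (deriv (fun r => r * f r) y - f y) / y := by
      filter_upwards [Ioi_mem_nhds hx] with y hy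
      have hy0 : y ≠ 0 := (show 0 < y from hy).ne'
      rw [h1 y]; field_simp; ring
    have h3 : DifferentiableAt ℝ (fun y => (deriv (fun r => r * f r) y - f y) / y) x := by
      apply DifferentiableAt.div _ differentiableAt_id hx.ne'
      exact (hφ1.differentiable (by norm_num) x).sub (hd x).differentiableAt
    exact h3.congr_of_eventuallyEq h2
  have h4 : deriv (fun r => r * f r) = fun x => f x + x * deriv f x := funext h1
  rw [h4]
  have h5 := (hd x).add ((hasDerivAt_id x).mul hdd.hasDerivAt)
  exact (h5.congr_deriv (by simp; ring)).deriv

lemma d_identity {g : ℝ → ℝ} (hψ : ContDiff ℝ 1 (fun r => r * g r)) {x : ℝ} (hx : 0 < x) :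
    deriv (fun r => r * g r) x = g x + x * deriv g x := by
  have hdd : DifferentiableAt ℝ g x := by
    have h2 : g =ᶠ[nhds x] fun y => (y * g y) / y := by
      filter_upwards [Ioi_mem_nhds hx] with y hy
      have hy0 : y ≠ 0 := (show 0 < y from hy).ne'
      field_simp
    have h3 : DifferentiableAt ℝ (fun y => (y * g y) / y) x :=
      DifferentiableAt.div (hψ.differentiable (by norm_num) x) differentiableAt_id hx.ne'
    exact h3.congr_of_eventuallyEq h2
  exact (((hasDerivAt_id x).mul hdd.hasDerivAt).congr_deriv (by simp)).deriv

lemma K_est {ν : ℝ} (hν : 0 ≤ ν) : ∃ C > 0, ∀ (ε : ℝ) (fg : (ℝ → ℝ) × (ℝ → ℝ)), 0 < ε →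
    memY ν ε fg → ∃ J : Jet, IsJet J ∧ J.u = Kop fg ∧ ∀ r t, 0 < r → 0 ≤ t →
      J.b2 r t ≤ C * ε * wX ν r t := by
  refine ⟨(20 * 2 ^ ν + 20) * 5, by positivity, ?_⟩
  rintro ε ⟨f, g⟩ hε ⟨hf, hg, ef, eg, hφ, hψ, hY⟩
  simp only at hf hg ef eg hφ hψ
  set φ : ℝ → ℝ := fun r => r * f r with hφd
  set ψ : ℝ → ℝ := fun r => r * g r with hψd
  have oφ : ∀ x, φ (-x) = - φ x := by intro x; simp only [hφd]; rw [ef]; ring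
  have oψ : ∀ x, ψ (-x) = - ψ x := by intro x; simp only [hψd]; rw [eg]; ring
  have hφ2 : ContDiff ℝ (1 + 1) φ := by rw [one_add_one_eq_two]; exact hφ
  have hφ1 : ContDiff ℝ 1 (deriv φ) := hφ2.deriv'
  have cφ : Continuous φ := hφ.continuous
  have cφ1 : Continuous (deriv φ) := hφ1.continuous
  have cφ2 : Continuous (deriv (deriv φ)) := hφ1.continuous_deriv le_rfl
  have cψ : Continuous ψ := hψ.continuous
  have cψ1 : Continuous (deriv ψ) := hψ.continuous_deriv le_rfl
  have eφ1 : ∀ x, deriv φ (-x) = deriv φ x := by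
    intro x
    have h1 := deriv_comp_neg φ x
    have h2 : (fun x => φ (-x)) = fun x => - φ x := funext oφ
    rw [h2, deriv.fun_neg] at h1
    linarith
  have oφ2 : ∀ x, deriv (deriv φ) (-x) = - deriv (deriv φ) x := by
    intro x
    have h1 := deriv_comp_neg (deriv φ) x
    have h2 : (fun x => deriv φ (-x)) = fun x => deriv φ x := funext eφ1
    rw [h2] at h1
    linarith
  have eψ1 : ∀ x, deriv ψ (-x) = deriv ψ x := by
    intro x
    have h1 := deriv_comp_neg ψ x
    have h2 : (fun x => ψ (-x)) = fun x => - ψ x := funext oψ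
    rw [h2, deriv.fun_neg] at h1
    linarith
  have tn : ∀ x, 0 < x → |f x| + (1 + x) * (|deriv f x| + |g x|) +
      x * (|deriv (deriv f) x| + |deriv g x|) ≤ ε * (1 + x) ^ (-ν) := by
    intro x hx
    have h1 := hY x hx
    have hp : 0 < (1 + x) ^ ν := by positivity
    rw [rpow_neg (by positivity), ← div_eq_mul_inv, le_div_iff₀ hp, mul_comm]
    exact h1
  -- the three basic bounds
  have B0 : ∀ x, |φ x| ≤ |x| * (ε * (1 + |x|) ^ (-ν)) := by
    intro x
    have : |f x| ≤ ε * (1 + |x|) ^ (-ν) := by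
      refine bound_ext (G := fun x => |f x|) (hf.continuous.abs) (fun x => by simp only [ef]) ?_ x
      intro y hy
      have h1 := tn y hy
      have h2 : 0 ≤ (1 + y) * (|deriv f y| + |g y|) := by positivity
      have h3 : 0 ≤ y * (|deriv (deriv f) y| + |deriv g y|) := by positivity
      linarith
    simp only [hφd, abs_mul]
    gcongr
  have B1 : ∀ x, |deriv φ x| + |ψ x| ≤ ε * (1 + |x|) ^ (-ν) := by
    refine bound_ext (cφ1.abs.add cψ.abs) (fun x => by rw [eφ1, oψ, abs_neg]) ?_
    intro y hy
    have h1 := tn y hy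
    have h3 : 0 ≤ y * (|deriv (deriv f) y| + |deriv g y|) := by positivity
    rw [(dd_identity hf hφ).1 y]
    have h4 := abs_add_le (f y) (y * deriv f y)
    rw [abs_mul, abs_of_pos hy] at h4
    have h5 : |ψ y| = y * |g y| := by simp only [hψd, abs_mul, abs_of_pos hy]
    have h6 := abs_nonneg (deriv f y)
    have h7 := abs_nonneg (g y)
    linarith
  have B2 : ∀ x, |deriv (deriv φ) x| + |deriv ψ x| ≤ (2 * ε) * (1 + |x|) ^ (-ν) := by
    refine bound_ext (cφ2.abs.add cψ1.abs) (fun x => by rw [oφ2, eψ1, abs_neg]) ?_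
    intro y hy
    have h1 := tn y hy
    have h0 := abs_nonneg (f y)
    rw [(dd_identity hf hφ).2 y hy, d_identity hψ hy]
    have h4 := abs_add_le (2 * deriv f y) (y * deriv (deriv f) y)
    have h5 := abs_add_le (g y) (y * deriv g y)
    rw [abs_mul, abs_mul, abs_of_pos hy, abs_two] at h4
    rw [abs_mul, abs_of_pos hy] at h5
    have h6 := mul_nonneg hy.le (abs_nonneg (deriv f y))
    have h7 := mul_nonneg hy.le (abs_nonneg (g y))
    have h8 := mul_nonneg hy.le (abs_nonneg (deriv (deriv f) y))
    have h9 := mul_nonneg hy.le (abs_nonneg (deriv g y))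
    have h10 := abs_nonneg (g y)
    linarith
  -- antiderivatives
  set Ψ : ℝ → ℝ := fun x => ∫ y in (0:ℝ)..x, ψ y with hΨd
  have dΨ : ∀ x, HasDerivAt Ψ (ψ x) x := fun x =>
    intervalIntegral.integral_hasDerivAt_right (cψ.intervalIntegrable _ _)
      (cψ.stronglyMeasurableAtFilter _ _) cψ.continuousAt
  have dF : ∀ x, HasDerivAt (fun x => ∫ y in (0:ℝ)..x, φ y) (φ x) x := fun x =>
    intervalIntegral.integral_hasDerivAt_right (cφ.intervalIntegrable _ _)
      (cφ.stronglyMeasurableAtFilter _ _) cφ.continuousAt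
  have eΨ : ∀ x, Ψ (-x) = Ψ x := by
    intro x
    simp only [hΨd]
    have h1 := intervalIntegral.integral_comp_neg (a := 0) (b := x) ψ
    simp only [oψ, intervalIntegral.integral_neg, neg_zero] at h1
    rw [intervalIntegral.integral_symm, ← h1, neg_neg]
  set α : ℝ → ℝ := fun x => Ψ x + φ x with hα
  set α1 : ℝ → ℝ := fun x => ψ x + deriv φ x with hα1
  set α2 : ℝ → ℝ := fun x => deriv ψ x + deriv (deriv φ) x with hα2
  have d1 : ∀ x, HasDerivAt α (α1 x) x := fun x =>
    (dΨ x).add (hφ.differentiable (by norm_num) x).hasDerivAt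
  have d2 : ∀ x, HasDerivAt α1 (α2 x) x := fun x =>
    (hψ.differentiable (by norm_num) x).hasDerivAt.add (hφ1.differentiable (by norm_num) x).hasDerivAt
  have hw := isWave_waveOf d1 d2 (cψ1.add cφ2)
  have hu : ∀ r t, 0 ≤ t → Kop (f, g) r t = 1 / (2 * r) * (α (r + t) - α (t - r)) := by
    intro r t _
    unfold Kop
    congr 1
    have k1 : ∫ l in (r - t)..(r + t), l * g l = Ψ (r + t) - Ψ (r - t) := by
      simp only [hΨd]
      rw [intervalIntegral.integral_interval_sub_left (cψ.intervalIntegrable _ _)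
        (cψ.intervalIntegrable _ _)]
    have k2 : deriv (fun s : ℝ => ∫ l in (r - s)..(r + s), l * f l) t = φ (r + t) + φ (r - t) := by
      have h1 : (fun s : ℝ => ∫ l in (r - s)..(r + s), l * f l) =
          fun s => (∫ y in (0:ℝ)..(r + s), φ y) - ∫ y in (0:ℝ)..(r - s), φ y := by
        funext s
        rw [intervalIntegral.integral_interval_sub_left (cφ.intervalIntegrable _ _)
          (cφ.intervalIntegrable _ _)]
      rw [h1]
      have h2 : HasDerivAt (fun s : ℝ => r + s) 1 t := (hasDerivAt_id t).const_add r
      have h3 : HasDerivAt (fun s : ℝ => r - s) (-1) t := (hasDerivAt_id t).const_sub r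
      exact ((((dF (r + t)).comp t h2).sub ((dF (r - t)).comp t h3)).congr_deriv (by ring)).deriv
    show (∫ l in (r - t)..(r + t), l * g l) + deriv (fun s : ℝ => ∫ l in (r - s)..(r + s), l * f l) t = _
    rw [k1, k2]
    simp only [hα]
    rw [show t - r = -(r - t) by ring, eΨ, oφ]; ring
  have w1 : ∀ r t, 0 < r → 0 ≤ t → (1 + |r + t|) ^ (-ν) ≤ wX ν r t := by
    intro r t hr ht
    unfold wX
    apply rpow_le_rpow_of_nonpos (by positivity) _ (by linarith)
    have := abs_rt_le hr.le ht
    rw [abs_of_nonneg (by linarith : 0 ≤ r + t)]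
    linarith
  have w2 : ∀ r t : ℝ, (1 + |t - r|) ^ (-ν) = wX ν r t := by
    intro r t; unfold wX; rw [abs_sub_comm]
  have a1 : ∀ x, |α1 x| ≤ ε * (1 + |x|) ^ (-ν) := by
    intro x
    have := abs_add_le (ψ x) (deriv φ x)
    linarith [B1 x]
  have a2 : ∀ x, |α2 x| ≤ 2 * ε * (1 + |x|) ^ (-ν) := by
    intro x
    have := abs_add_le (deriv ψ x) (deriv (deriv φ) x)
    linarith [B2 x]
  have hb := hw.bounds (u := Kop (f, g)) hu (shift_wX hν) (A1 := 3 * ε) (A2 := 2 * ε)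
    (by positivity) (by positivity) ?_ ?_ ?_ ?_ ?_ ?_
  · refine ⟨_, hw.isJet hu, rfl, fun r t hr ht => (hb r t hr ht).2.trans_eq ?_⟩
    ring
  · intro r t hr ht
    have h1 := a1 (r + t)
    have h2 := mul_le_mul_of_nonneg_left (w1 r t hr ht) hε.le
    have h3 := mul_nonneg hε.le (wX_nonneg ν r t)
    show |α1 (r + t)| ≤ _
    linarith
  · intro r t hr ht
    have h1 := a1 (t - r)
    rw [w2] at h1
    have h3 := mul_nonneg hε.le (wX_nonneg ν r t)
    show |-α1 (t - r)| ≤ _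
    rw [abs_neg]
    linarith
  · intro r t hr ht
    have h1 := a2 (r + t)
    have h2 := mul_le_mul_of_nonneg_left (w1 r t hr ht) hε.le
    show |α2 (r + t)| ≤ _
    linarith
  · intro r t hr ht
    have h1 := a2 (t - r)
    rw [w2] at h1
    exact h1
  · intro r t hr ht
    show |(0:ℝ)| ≤ _
    rw [abs_zero]
    exact mul_nonneg (by positivity) (wX_nonneg ν r t)
  · intro r t hr ht htr
    show |(α (r + t) - α (t - r)) / 2| ≤ _
    set w := wX ν r t with hwd
    have hw0 : 0 ≤ w := wX_nonneg ν r t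
    have hr0 : 0 < r := by linarith
    have hrt := abs_rt_le hr0.le ht
    have e1 : α (r + t) - α (t - r) = (Ψ (r + t) - Ψ |r - t|) + (φ (r + t) + φ (r - t)) := by
      have : Ψ |r - t| = Ψ (t - r) := by
        rcases abs_cases (r - t) with ⟨h, _⟩ | ⟨h, _⟩
        · rw [h, show t - r = -(r - t) by ring, eΨ]
        · rw [h]; congr 1; ring
      rw [this]
      simp only [hα]
      rw [show φ (t - r) = - φ (r - t) by rw [← oφ]; congr 1; ring]
      ring
    have i1 : |Ψ (r + t) - Ψ (|r - t|)| ≤ ε * w * (2 * r) := by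
      have h := Convex.norm_image_sub_le_of_norm_hasDerivWithin_le (f := Ψ) (f' := ψ)
        (s := Set.Icc |r - t| (r + t)) (C := ε * w) (fun x _ => (dΨ x).hasDerivWithinAt)
        (fun x hx => by
          have h1 := B1 x
          have h2 := abs_nonneg (deriv φ x)
          have h3 : (1 + |x|) ^ (-ν) ≤ w := by
            rw [hwd]; unfold wX
            apply rpow_le_rpow_of_nonpos (by positivity) _ (by linarith)
            have := le_abs_self x
            linarith [hx.1]
          have h4 := mul_le_mul_of_nonneg_left h3 hε.le
          rw [Real.norm_eq_abs]
          linarith)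
        (convex_Icc _ _) (x := |r - t|) (y := r + t) ⟨le_rfl, hrt⟩ ⟨hrt, le_rfl⟩
      rw [Real.norm_eq_abs, Real.norm_eq_abs] at h
      refine h.trans ?_
      apply mul_le_mul_of_nonneg_left _ (by positivity)
      rw [abs_of_nonneg (by linarith)]
      linarith [neg_abs_le (r - t)]
    have i2 : |φ (r + t)| ≤ 3 * r * (ε * w) := by
      refine (B0 _).trans ?_
      have h1 : |r + t| ≤ 3 * r := by rw [abs_of_nonneg (by linarith)]; linarith
      have h2 := mul_le_mul_of_nonneg_left (w1 r t hr0 ht) hε.le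
      exact mul_le_mul h1 h2 (by positivity) (by positivity)
    have i3 : |φ (r - t)| ≤ r * (ε * w) := by
      refine (B0 _).trans ?_
      have h1 : |r - t| ≤ r := abs_le.2 ⟨by linarith, by linarith⟩
      exact mul_le_mul_of_nonneg_right h1 (by positivity)
    rw [e1, abs_div, abs_two, div_le_iff₀ (by norm_num)]
    have j1 := abs_add_le (Ψ (r + t) - Ψ |r - t|) (φ (r + t) + φ (r - t))
    have j2 := abs_add_le (φ (r + t)) (φ (r - t))
    linarith

def bseq (p q : ℝ) (n : ℕ) : ℝ := q + (n : ℝ) * (p + q - 2)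

def InvJ (p q : ℝ) (n : ℕ) (C ε : ℝ) (fg1 fg2 : (ℝ → ℝ) × (ℝ → ℝ)) : Prop :=
  ∃ W V' V : Jet, IsJet W ∧ IsJet V' ∧ IsJet V ∧
    W.u = witer p q fg1 fg2 (n + 1) ∧ V'.u = viter p q fg1 fg2 n ∧
    V.u = viter p q fg1 fg2 (n + 1) ∧ ∀ r t, 0 < r → 0 ≤ t →
    W.b2 r t ≤ C * ε * wZ (p - 1) r t ∧
    V'.b2 r t ≤ C * ε * wX (q * (p - 1) - 1) r t ∧
    V.b2 r t ≤ C * ε * wX (q * (p - 1) - 1) r t ∧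
    (V.sub V').b1 r t ≤ C * ε ^ (bseq p q n) * wZ (aseq (p - 1) (q * (p - 1) - 1) (n + 1)) r t ∧
    (V.sub V').b2 r t ≤ C * ε ^ ((p - 1) * bseq p q n) *
      wZ (aseq (p - 1) (q * (p - 1) - 1) (n + 1)) r t

lemma param {p q : ℝ} (hp1 : 1 < p) (hp2 : p < 2) (hcond : (p - 1) ^ 2 * (q - 1) > 1) :
    2 < q ∧ 1 < q * (p - 1) - 1 := by
  have h1 : 0 < p - 1 := by linarith
  have h2 : p - 1 < 1 := by linarith
  generalize p - 1 = κ at *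
  have hq : 2 < q := by
    by_contra h
    push Not at h
    have h3 : κ ^ 2 < 1 := by nlinarith
    have h4 : 0 ≤ κ ^ 2 := by positivity
    nlinarith
  refine ⟨hq, ?_⟩
  by_contra h
  push Not at h
  have := mul_le_mul_of_nonneg_left h h1.le
  nlinarith [sq_nonneg (1 - κ)]

lemma aseq_ge_one {κ K2 : ℝ} (hκ : 0 < κ) (hK2 : 1 < K2) (n : ℕ) : 1 ≤ aseq κ K2 n := by
  induction n with
  | zero => exact le_rfl
  | succ n ih =>
    show 1 ≤ κ * (aseq κ K2 n - 1) + K2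
    have := mul_nonneg hκ.le (by linarith : 0 ≤ aseq κ K2 n - 1)
    linarith

lemma aseq_ge {κ K2 : ℝ} (hκ : 0 < κ) (hK2 : 1 < K2) (n : ℕ) : K2 ≤ aseq κ K2 (n + 1) := by
  show K2 ≤ κ * (aseq κ K2 n - 1) + K2
  have := mul_nonneg hκ.le (by linarith [aseq_ge_one hκ hK2 n] : 0 ≤ aseq κ K2 n - 1)
  linarith

lemma aseq_mono {κ K2 : ℝ} (hκ : 0 < κ) (hK2 : 1 < K2) : Monotone (aseq κ K2) := by
  apply monotone_nat_of_le_succ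
  intro n
  induction n with
  | zero =>
    show (1:ℝ) ≤ κ * (1 - 1) + K2
    linarith
  | succ n ih =>
    show κ * (aseq κ K2 n - 1) + K2 ≤ κ * (aseq κ K2 (n + 1) - 1) + K2
    have := mul_le_mul_of_nonneg_left ih hκ.le
    linarith

lemma NLt_zero {p : ℝ} (hp : p ≠ 0) : NLt p Jet.zero.u = 0 := by
  funext r t
  show |pdt (fun _ _ => 0) r t| ^ p = 0
  simp [pdt, zero_rpow hp]

lemma inv_base {p q : ℝ} (hp1 : 1 < p) (hp2 : p < 2) (hcond : (p - 1) ^ 2 * (q - 1) > 1) :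
    ∃ C > 0, ∀ (ε : ℝ) (fg1 fg2 : (ℝ → ℝ) × (ℝ → ℝ)), 0 < ε → ε ≤ 1 → memY (p - 1) ε fg1 →
      memY (q * (p - 1) - 1) ε fg2 → InvJ p q 0 C ε fg1 fg2 := by
  obtain ⟨hq, hK2⟩ := param hp1 hp2 hcond
  have hκ0 : 0 < p - 1 := by linarith
  have hκ1 : p - 1 < 1 := by linarith
  obtain ⟨C1, hC1, H1⟩ := K_est hκ0.le
  obtain ⟨C2, hC2, H2⟩ := K_est (by linarith : 0 ≤ q * (p - 1) - 1)
  obtain ⟨CL, hCL, HL⟩ := L_step (a := 1) hp1 hp2 le_rfl (by linarith) hK2 hC2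
  set C3 := C1 + CL * (C2 + C2 + C2 ^ (p - 1)) with hC3d
  have hC3 : 0 < C3 := by positivity
  obtain ⟨CR, hCR, HR⟩ := R_step (q := q) (a := 1) (C0 := C3) hq hκ0 hκ1 (by linarith)
    (by linarith) hC3
  refine ⟨C1 + C2 + C3 + 2 * CR * C3, by positivity, ?_⟩
  intro ε fg1 fg2 hε hε1 hY1 hY2
  have hpow : ∀ x y : ℝ, x ≤ y → ε ^ y ≤ ε ^ x := fun x y h =>
    rpow_le_rpow_of_exponent_ge hε hε1 h
  have hpow1 : ∀ y : ℝ, 1 ≤ y → ε ^ y ≤ ε := fun y h => by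
    have := hpow 1 y h
    rwa [rpow_one] at this
  obtain ⟨W0, hW0, W0u, bW0⟩ := H1 ε fg1 hε hY1
  obtain ⟨V0, hV0, V0u, bV0⟩ := H2 ε fg2 hε hY2
  have z2 : ∀ r t, 0 < r → 0 ≤ t → V0.b2 r t ≤ C2 * ε * wZ 1 r t := by
    intro r t hr ht
    refine (bV0 r t hr ht).trans ?_
    apply mul_le_mul_of_nonneg_left _ (by positivity)
    exact (wX_anti hK2.le).trans (wX_le_wZ le_rfl hr.le ht)
  obtain ⟨J, hJ, Ju, bJ⟩ := HL ε (C2 * ε) (C2 * ε) V0 Jet.zero hε (by positivity) (by positivity)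
    hV0 isJet_zero bV0
    (fun r t hr ht => by
      rw [Jet.zero_b2]; exact mul_nonneg (by positivity) (wX_nonneg _ _ _))
    (fun r t hr ht => by
      rw [Jet.sub_zero]
      exact (Jet.b1_le_b2 _ hr).trans (z2 r t hr ht))
    (fun r t hr ht => by
      rw [Jet.sub_zero]
      exact z2 r t hr ht)
  rw [NLt_zero (by linarith), sub_zero] at Ju
  simp only [mul_one] at bJ
  have bW1 : ∀ r t, 0 < r → 0 ≤ t → (W0.add J).b2 r t ≤ C3 * ε * wZ (p - 1) r t := by
    intro r t hr ht
    have hw := wZ_nonneg (p - 1) r t hr.le ht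
    have h1 := (bW0 r t hr ht).trans
      (mul_le_mul_of_nonneg_left (wX_le_wZ hκ1.le hr.le ht) (by positivity))
    have h2 := (bJ r t hr ht).2
    have h3 := Jet.b2_add W0 J (t := t) hr
    have h4 : ε ^ (p - 1) * (C2 * ε) + ε ^ (p - 1) * (C2 * ε) + ε * (C2 * ε) ^ (p - 1) ≤
        (C2 + C2 + C2 ^ (p - 1)) * ε := by
      rw [mul_rpow hC2.le hε.le]
      have h5 : ε ^ (p - 1) ≤ 1 := rpow_le_one hε.le hε1 hκ0.le
      have h6 := mul_le_mul_of_nonneg_right h5 (by positivity : 0 ≤ C2 * ε)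
      have h7 := mul_le_mul_of_nonneg_right h5 (by positivity : 0 ≤ C2 ^ (p - 1) * ε)
      linarith
    have h5 := mul_le_mul_of_nonneg_right (mul_le_mul_of_nonneg_left h4 hCL.le) hw
    rw [hC3d]
    linarith
  obtain ⟨J2, hJ2, J2u, bJ2⟩ := HR ε (C3 * ε) (C3 * ε) (W0.add J) Jet.zero hε (by positivity)
    (by positivity) (hW0.add hJ) isJet_zero bW1
    (fun r t hr ht => by
      rw [Jet.zero_b2]; exact mul_nonneg (by positivity) (wZ_nonneg _ _ _ hr.le ht))
    (fun r t hr ht => by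
      rw [Jet.sub_zero, mul_one]
      exact (Jet.b1_le_b2 _ hr).trans (bW1 r t hr ht))
    (fun r t hr ht => by
      rw [Jet.sub_zero, mul_one]
      exact bW1 r t hr ht)
  rw [NLt_zero (by linarith), sub_zero] at J2u
  have hsub : (V0.add J2).sub V0 = J2 := Jet.add_sub_cancel _ _
  have eq1 : ε ^ (q - 1) * ε = ε ^ q := by
    rw [← rpow_add_one hε.ne']; congr 1; ring
  have hb0 : bseq p q 0 = q := by simp [bseq]
  have wu : (W0.add J).u = witer p q fg1 fg2 (0 + 1) := by
    show W0.u + J.u = Kop fg1 + Lop (NLt p (Kop fg2))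
    rw [W0u, Ju, V0u]
  have vu : (V0.add J2).u = viter p q fg1 fg2 (0 + 1) := by
    show V0.u + J2.u = Kop fg2 + Rop (NLt q (Kop fg1 + Lop (NLt p (Kop fg2))))
    rw [V0u, J2u, wu]; rfl
  refine ⟨W0.add J, V0, V0.add J2, hW0.add hJ, hV0, hV0.add hJ2, wu, V0u, vu, ?_⟩
  intro r t hr ht
  rw [hsub, hb0]
  have hX := wX_nonneg (q * (p - 1) - 1) r t
  have hZ := wZ_nonneg (p - 1) r t hr.le ht
  have j1 := (bJ2 r t hr ht).1
  have j2 := (bJ2 r t hr ht).2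
  have hA : (p - 1) * ((1:ℝ) - 1) + (q * (p - 1) - 1) = aseq (p - 1) (q * (p - 1) - 1) (0 + 1) := rfl
  rw [hA] at j1 j2
  set a1 := aseq (p - 1) (q * (p - 1) - 1) (0 + 1) with ha1
  have hZ1 := wZ_nonneg a1 r t hr.le ht
  have ha1' : a1 = q * (p - 1) - 1 := by rw [← hA]; ring
  have hq0 : 0 ≤ ε ^ q := by positivity
  have hqp : ε ^ q ≤ ε ^ ((p - 1) * q) := hpow _ _ (by nlinarith)
  have k1 : J2.b1 r t ≤ CR * C3 * (ε ^ q * wZ a1 r t) := by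
    refine j1.trans_eq ?_
    rw [← eq1]; ring
  have k2 : J2.b2 r t ≤ 2 * CR * C3 * (ε ^ q * wZ a1 r t) := by
    refine j2.trans_eq ?_
    rw [← eq1]; ring
  have hCC : 0 < CR * C3 := by positivity
  refine ⟨?_, ?_, ?_, ?_, ?_⟩
  · refine (bW1 r t hr ht).trans ?_
    apply mul_le_mul_of_nonneg_right _ hZ
    apply mul_le_mul_of_nonneg_right _ hε.le
    linarith
  · refine (bV0 r t hr ht).trans ?_
    apply mul_le_mul_of_nonneg_right _ hX
    apply mul_le_mul_of_nonneg_right _ hε.le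
    linarith
  · refine (Jet.b2_add _ _ hr).trans ?_
    have h1 := bV0 r t hr ht
    have h2 : ε ^ q * wZ a1 r t ≤ ε * wX (q * (p - 1) - 1) r t := by
      rw [ha1']
      exact mul_le_mul (hpow1 q (by linarith)) (wZ_le_wX hK2.le hr.le ht)
        (wZ_nonneg _ _ _ hr.le ht) hε.le
    have h3 := mul_le_mul_of_nonneg_left h2 (by positivity : 0 ≤ 2 * CR * C3)
    have h4 : 0 ≤ ε * wX (q * (p - 1) - 1) r t := by positivity
    have h5 := mul_nonneg hC1.le h4
    have h6 := mul_nonneg hC3.le h4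
    linarith
  · refine k1.trans ?_
    rw [mul_assoc _ (ε ^ q)]
    apply mul_le_mul_of_nonneg_right _ (by positivity)
    linarith
  · refine k2.trans ?_
    rw [mul_assoc _ (ε ^ ((p - 1) * q))]
    apply mul_le_mul _ (mul_le_mul_of_nonneg_right hqp hZ1) (by positivity) (by positivity)
    linarith

set_option maxHeartbeats 2000000 in
lemma inv_step {p q : ℝ} (hp1 : 1 < p) (hp2 : p < 2) (hcond : (p - 1) ^ 2 * (q - 1) > 1) {n : ℕ}
    (hn : (p - 1) * aseq (p - 1) (q * (p - 1) - 1) (n + 1) < 1) {C : ℝ} (hC : 0 < C) :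
    ∃ C' > 0, ∀ (ε : ℝ) (fg1 fg2 : (ℝ → ℝ) × (ℝ → ℝ)), 0 < ε → ε ≤ 1 →
      InvJ p q n C ε fg1 fg2 → InvJ p q (n + 1) C' ε fg1 fg2 := by
  obtain ⟨hq, hK2⟩ := param hp1 hp2 hcond
  have hκ0 : 0 < p - 1 := by linarith
  have hκ1 : p - 1 < 1 := by linarith
  set κ := p - 1 with hκ
  set a := aseq κ (q * κ - 1) (n + 1) with ha
  have ha1 : 1 ≤ a := aseq_ge_one hκ0 hK2 _
  have haK : q * κ - 1 ≤ a := aseq_ge hκ0 hK2 _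
  have haK' : q * κ - 1 ≤ aseq κ (q * κ - 1) (n + 1 + 1) := aseq_ge hκ0 hK2 _
  obtain ⟨CL, hCL, HL⟩ := L_step (a := a) hp1 hp2 ha1 hn hK2 hC
  rw [← hκ] at HL
  set D := CL * (2 * C + C ^ κ) with hD
  have hD0 : 0 < D := by positivity
  obtain ⟨CR, hCR, HR⟩ := R_step (q := q) (a := a) (C0 := C + D) hq hκ0 hκ1 hn
    (show 1 < aseq κ (q * κ - 1) (n + 1 + 1) by linarith) (by positivity)
  set D2 := CR * (CL * C + D) with hD2
  have hD20 : 0 < D2 := by positivity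
  refine ⟨C + D + D2, by positivity, ?_⟩
  intro ε fg1 fg2 hε hε1 hI
  have hpow : ∀ x y : ℝ, x ≤ y → ε ^ y ≤ ε ^ x := fun x y h =>
    rpow_le_rpow_of_exponent_ge hε hε1 h
  have hpow1 : ∀ y : ℝ, 1 ≤ y → ε ^ y ≤ ε := fun y h => by
    have := hpow 1 y h
    rwa [rpow_one] at this
  obtain ⟨W, V', V, hW, hV', hV, Wu, Vu', Vu, hb⟩ := hI
  rw [← hκ] at hb
  set b := bseq p q n with hbd
  have hbq : q ≤ b := by
    rw [hbd]; unfold bseq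
    have : 0 ≤ (n:ℝ) * (p + q - 2) := mul_nonneg (Nat.cast_nonneg n) (by linarith)
    linarith
  have hbs : bseq p q (n + 1) = b + (q - 1 + κ) := by
    rw [hbd, hκ]; unfold bseq; push_cast; ring
  obtain ⟨J, hJ, Ju, bJ⟩ := HL ε (C * ε ^ b) (C * ε ^ (κ * b)) V V' hε (by positivity)
    (by positivity) hV hV' (fun r t hr ht => (hb r t hr ht).2.2.1)
    (fun r t hr ht => (hb r t hr ht).2.1) (fun r t hr ht => (hb r t hr ht).2.2.2.1)
    (fun r t hr ht => (hb r t hr ht).2.2.2.2)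
  have hκb : κ * b ≤ b := by nlinarith
  have hκq : 1 ≤ κ * b := by nlinarith
  have e1 : ε ^ κ * (C * ε ^ b) = C * ε ^ (κ + b) := by rw [rpow_add hε]; ring
  have e2 : ε ^ κ * (C * ε ^ (κ * b)) = C * ε ^ (κ + κ * b) := by rw [rpow_add hε]; ring
  have e3 : ε * (C * ε ^ b) ^ κ = C ^ κ * ε ^ (1 + κ * b) := by
    rw [mul_rpow hC.le (by positivity), ← rpow_mul hε.le, rpow_add hε, rpow_one, mul_comm b κ]; ring
  have bJ1 : ∀ r t, 0 < r → 0 ≤ t → J.b1 r t ≤ (CL * C * ε ^ (κ + b)) * wZ (κ * a) r t := by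
    intro r t hr ht
    have h := (bJ r t hr ht).1
    rw [e1] at h
    rw [mul_assoc CL]; exact h
  have bJ2 : ∀ r t, 0 < r → 0 ≤ t → J.b2 r t ≤ (D * ε ^ (κ + κ * b)) * wZ (κ * a) r t := by
    intro r t hr ht
    have h := (bJ r t hr ht).2
    rw [e1, e2, e3] at h
    refine h.trans ?_
    apply mul_le_mul_of_nonneg_right _ (wZ_nonneg _ _ _ hr.le ht)
    rw [hD, mul_assoc]
    apply mul_le_mul_of_nonneg_left _ hCL.le
    have p1 := mul_le_mul_of_nonneg_left (hpow (κ + κ * b) (κ + b) (by linarith)) hC.le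
    have p2 := mul_le_mul_of_nonneg_left (hpow (κ + κ * b) (1 + κ * b) (by linarith))
      (by positivity : 0 ≤ C ^ κ)
    linarith
  have hsubW : (W.add J).sub W = J := Jet.add_sub_cancel _ _
  have bW2 : ∀ r t, 0 < r → 0 ≤ t → (W.add J).b2 r t ≤ (C + D) * ε * wZ κ r t := by
    intro r t hr ht
    refine (Jet.b2_add _ _ hr).trans ?_
    have h1 := (hb r t hr ht).1
    have h2 := bJ2 r t hr ht
    have h3 : ε ^ (κ + κ * b) * wZ (κ * a) r t ≤ ε * wZ κ r t :=
      mul_le_mul (hpow1 _ (by linarith)) (wZ_anti (by nlinarith) hr.le ht)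
        (wZ_nonneg _ _ _ hr.le ht) hε.le
    have h4 := mul_le_mul_of_nonneg_left h3 hD0.le
    linarith
  obtain ⟨J2, hJ2, J2u, bJJ⟩ := HR ε (CL * C * ε ^ (κ + b)) (D * ε ^ (κ + κ * b)) (W.add J) W hε
    (by positivity) (by positivity) (hW.add hJ) hW bW2
    (fun r t hr ht => by
      refine (hb r t hr ht).1.trans ?_
      apply mul_le_mul_of_nonneg_right _ (wZ_nonneg _ _ _ hr.le ht)
      apply mul_le_mul_of_nonneg_right _ hε.le
      linarith)
    (fun r t hr ht => by rw [hsubW]; exact bJ1 r t hr ht)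
    (fun r t hr ht => by rw [hsubW]; exact bJ2 r t hr ht)
  have hA : κ * (a - 1) + (q * κ - 1) = aseq κ (q * κ - 1) (n + 1 + 1) := rfl
  rw [hA] at bJJ
  have hsubV : (V.add J2).sub V = J2 := Jet.add_sub_cancel _ _
  have wu : (W.add J).u = witer p q fg1 fg2 (n + 1 + 1) := by
    show W.u + J.u = _
    rw [Wu, Ju, Vu, Vu']; rfl
  have vu : (V.add J2).u = viter p q fg1 fg2 (n + 1 + 1) := by
    show V.u + J2.u = _
    rw [J2u, wu, Vu, Wu]; rfl
  refine ⟨W.add J, V, V.add J2, hW.add hJ, hV, hV.add hJ2, wu, Vu, vu, ?_⟩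
  rw [← hκ]
  intro r t hr ht
  rw [hsubV, hbs]
  set a2 := aseq κ (q * κ - 1) (n + 1 + 1) with ha2
  have hX := wX_nonneg (q * κ - 1) r t
  have hZ := wZ_nonneg κ r t hr.le ht
  have hZ2 := wZ_nonneg a2 r t hr.le ht
  obtain ⟨h1, h2, h3, -, -⟩ := hb r t hr ht
  obtain ⟨j1, j2⟩ := bJJ r t hr ht
  have k1 : J2.b1 r t ≤ CR * (CL * C) * (ε ^ (b + (q - 1 + κ)) * wZ a2 r t) := by
    refine j1.trans_eq ?_
    rw [show b + (q - 1 + κ) = (q - 1) + (κ + b) by ring, rpow_add hε (q - 1)]; ring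
  have k2 : J2.b2 r t ≤ D2 * (ε ^ (κ * (b + (q - 1 + κ))) * wZ a2 r t) := by
    have o1 : 0 ≤ (1 - κ) * (q - 1) := mul_nonneg (by linarith) (by linarith)
    have o2 : 0 ≤ (1 - κ) * κ := mul_nonneg (by linarith) (by linarith)
    have o3 : 0 ≤ (1 - κ) * b := mul_nonneg (by linarith) (by linarith)
    have m1 : ε ^ (q - 1) * (CL * C * ε ^ (κ + b) + D * ε ^ (κ + κ * b)) ≤
        (CL * C + D) * ε ^ (κ * (b + (q - 1 + κ))) := by
      have n1 : ε ^ (q - 1) * ε ^ (κ + b) ≤ ε ^ (κ * (b + (q - 1 + κ))) := by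
        rw [← rpow_add hε]; apply hpow; linarith
      have n2 : ε ^ (q - 1) * ε ^ (κ + κ * b) ≤ ε ^ (κ * (b + (q - 1 + κ))) := by
        rw [← rpow_add hε]; apply hpow; linarith
      have n3 := mul_le_mul_of_nonneg_left n1 (by positivity : 0 ≤ CL * C)
      have n4 := mul_le_mul_of_nonneg_left n2 hD0.le
      linarith
    have m2 := mul_le_mul_of_nonneg_right (mul_le_mul_of_nonneg_left m1 hCR.le) hZ2
    rw [hD2]
    linarith
  refine ⟨?_, ?_, ?_, ?_, ?_⟩
  · refine (bW2 r t hr ht).trans ?_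
    apply mul_le_mul_of_nonneg_right _ hZ
    apply mul_le_mul_of_nonneg_right _ hε.le
    linarith
  · refine h3.trans ?_
    apply mul_le_mul_of_nonneg_right _ hX
    apply mul_le_mul_of_nonneg_right _ hε.le
    linarith
  · refine (Jet.b2_add _ _ hr).trans ?_
    have l2 : ε ^ (κ * (b + (q - 1 + κ))) * wZ a2 r t ≤ ε * wX (q * κ - 1) r t := by
      refine mul_le_mul (hpow1 _ ?_) ?_ hZ2 hε.le
      · have : 0 ≤ κ * (q - 1 + κ) := mul_nonneg hκ0.le (by linarith)
        linarith
      · exact (wZ_anti haK' hr.le ht).trans (wZ_le_wX hK2.le hr.le ht)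
    have l3 := mul_le_mul_of_nonneg_left l2 hD20.le
    have l4 : 0 ≤ ε * wX (q * κ - 1) r t := by positivity
    have l5 := mul_nonneg hD0.le l4
    linarith
  · refine k1.trans ?_
    rw [mul_assoc _ (ε ^ (b + (q - 1 + κ)))]
    apply mul_le_mul_of_nonneg_right _ (by positivity)
    have : 0 < CR * D := by positivity
    rw [hD2]; linarith
  · refine k2.trans ?_
    rw [mul_assoc _ (ε ^ (κ * (b + (q - 1 + κ))))]
    apply mul_le_mul_of_nonneg_right _ (by positivity)
    linarith

lemma inv_all {p q : ℝ} (hp1 : 1 < p) (hp2 : p < 2) (hcond : (p - 1) ^ 2 * (q - 1) > 1) {ℓ : ℕ}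
    (hl3 : (p - 1) * aseq (p - 1) (q * (p - 1) - 1) ℓ < 1) (n : ℕ) (hn : n ≤ ℓ) :
    ∃ C > 0, ∀ (ε : ℝ) (fg1 fg2 : (ℝ → ℝ) × (ℝ → ℝ)), 0 < ε → ε ≤ 1 → memY (p - 1) ε fg1 →
      memY (q * (p - 1) - 1) ε fg2 → InvJ p q n C ε fg1 fg2 := by
  have hκ0 : 0 < p - 1 := by linarith
  induction n with
  | zero => exact inv_base hp1 hp2 hcond
  | succ n ih =>
    obtain ⟨C, hC, H⟩ := ih (by omega)
    have hmono := aseq_mono hκ0 (param hp1 hp2 hcond).2 hn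
    obtain ⟨C', hC', H'⟩ := inv_step hp1 hp2 hcond (n := n)
      (lt_of_le_of_lt (mul_le_mul_of_nonneg_left hmono hκ0.le) hl3) hC
    exact ⟨C', hC', fun ε fg1 fg2 h1 h2 h3 h4 => H' ε fg1 fg2 h1 h2 (H ε fg1 fg2 h1 h2 h3 h4)⟩

lemma bracketS_nonneg (s : ℕ) (u : ℝ → ℝ → ℝ) {r t : ℝ} (hr : 0 < r) : 0 ≤ bracketS s u r t := by
  unfold bracketS bracket1 bracket2
  split_ifs <;> positivity

lemma Znorm_nonneg (s : ℕ) (ν : ℝ) (u : ℝ → ℝ → ℝ) : 0 ≤ Znorm s ν u := by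
  apply Real.sSup_nonneg
  rintro x ⟨r, t, hr, ht, rfl⟩
  have := bracketS_nonneg s u (t := t) hr
  positivity

lemma b1_of_Znorm {J : Jet} (hJ : IsJet J) {ν : ℝ} (h : BddAbove (ZSet 1 ν J.u)) {r t : ℝ}
    (hr : 0 < r) (ht : 0 ≤ t) : J.b1 r t ≤ Znorm 1 ν J.u * wZ ν r t := by
  refine extend_zero (W := fun r t => Znorm 1 ν J.u * wZ ν r t) hJ.cb1
    (fun r hr => (continuousWithinAt_const).mul (cont_wZ ν hr)) ?_ hr ht
  intro r t hr ht
  show J.b1 r t ≤ _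
  rw [← hJ.bracket1_eq hr ht]
  exact Znorm_pointwise h hr ht.le

lemma b2_of_Znorm {J : Jet} (hJ : IsJet J) {ν : ℝ} (h : BddAbove (ZSet 2 ν J.u)) {r t : ℝ}
    (hr : 0 < r) (ht : 0 ≤ t) : J.b2 r t ≤ Znorm 2 ν J.u * wZ ν r t := by
  refine extend_zero (W := fun r t => Znorm 2 ν J.u * wZ ν r t) hJ.cb2
    (fun r hr => (continuousWithinAt_const).mul (cont_wZ ν hr)) ?_ hr ht
  intro r t hr ht
  show J.b2 r t ≤ _
  rw [← hJ.bracket2_eq hr ht]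
  exact Znorm_pointwise h hr ht.le

lemma Z1_of_b1 {J : Jet} (hJ : IsJet J) {ν B : ℝ} (hB : 0 ≤ B)
    (h : ∀ r t, 0 < r → 0 ≤ t → J.b1 r t ≤ B * wZ ν r t) :
    BddAbove (ZSet 1 ν J.u) ∧ Znorm 1 ν J.u ≤ B := by
  have h1 := ZSet_bound (s := 1) (ν := ν) (B := B) (u := J.u)
    (fun r t hr ht => (hJ.bracket1_le hr ht).trans (h r t hr ht))
  exact ⟨⟨B, h1⟩, Real.sSup_le h1 hB⟩

lemma Z2_of_b2 {J : Jet} (hJ : IsJet J) {ν B : ℝ} (hB : 0 ≤ B)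
    (h : ∀ r t, 0 < r → 0 ≤ t → J.b2 r t ≤ B * wZ ν r t) :
    BddAbove (ZSet 2 ν J.u) ∧ Znorm 2 ν J.u ≤ B := by
  have h1 := ZSet_bound (s := 2) (ν := ν) (B := B) (u := J.u)
    (fun r t hr ht => (hJ.bracket2_le hr ht).trans (h r t hr ht))
  exact ⟨⟨B, h1⟩, Real.sSup_le h1 hB⟩

lemma X2_of_b2 {J : Jet} (hJ : IsJet J) {ν B : ℝ} (hB : 0 ≤ B)
    (h : ∀ r t, 0 < r → 0 ≤ t → J.b2 r t ≤ B * wX ν r t) :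
    BddAbove (XSet 2 ν J.u) ∧ Xnorm 2 ν J.u ≤ B := by
  have h1 := XSet_bound (s := 2) (ν := ν) (B := B) (u := J.u)
    (fun r t hr ht => (hJ.bracket2_le hr ht).trans (h r t hr ht))
  exact ⟨⟨B, h1⟩, Real.sSup_le h1 hB⟩

lemma Jet.sub_add_sub (J K L : Jet) : (J.sub K).add (K.sub L) = J.sub L := by
  cases J; cases K; cases L; simp [Jet.sub, Jet.add]

/-- **Lemma 4.6.** Under the assumptions of Theorem 2.4, with `0 < ε ≤ 1`, every
`(u₁, u₂) ∈ D_ε` satisfies `‖u₁‖_{Z²(κ₁)} + ‖u₂‖_{X²(κ₂)} ≤ C ε`,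
`d₁(u₁, w_{ℓ+1}) ≤ ε^{(p-1)b_ℓ}` and `d₂(u₂, v_ℓ) ≤ C ε^{(p-1)b_ℓ}`. -/
theorem stmt15 (p q : ℝ) (hp1 : 1 < p) (hp2 : p < 2) (hpq : p ≤ q)
    (hcond : (p - 1) ^ 2 * (q - 1) > 1) (ℓ : ℕ)
    (hl1 : 1 / (p - 1) < aseq (p - 1) (q * (p - 1) - 1) (ℓ + 1))
    (hl2 : aseq (p - 1) (q * (p - 1) - 1) ℓ ≤ 1 / (p - 1))
    (hl3 : (p - 1) * aseq (p - 1) (q * (p - 1) - 1) ℓ < 1) :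
    ∃ C > 0, ∀ ε : ℝ, 0 < ε → ε ≤ 1 →
      ∀ fg1 fg2 : (ℝ → ℝ) × (ℝ → ℝ),
        memY (p - 1) ε fg1 → memY (q * (p - 1) - 1) ε fg2 →
      ∀ u₁ u₂ : ℝ → ℝ → ℝ, memD p q ε ℓ fg1 fg2 u₁ u₂ →
        (BddAbove (ZSet 2 (p - 1) u₁) ∧ BddAbove (XSet 2 (q * (p - 1) - 1) u₂) ∧
          Znorm 2 (p - 1) u₁ + Xnorm 2 (q * (p - 1) - 1) u₂ ≤ C * ε) ∧
        dOne p q ℓ (u₁ - witer p q fg1 fg2 (ℓ + 1)) ≤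
          ε ^ ((p - 1) * (q + (ℓ : ℝ) * (p + q - 2))) ∧
        (BddAbove (ZSet 2 (aseq (p - 1) (q * (p - 1) - 1) (ℓ + 1))
            (u₂ - viter p q fg1 fg2 ℓ)) ∧
          BddAbove (ZSet 1 (aseq (p - 1) (q * (p - 1) - 1) (ℓ + 1))
            (u₂ - viter p q fg1 fg2 ℓ)) ∧
          dTwo p q ℓ (u₂ - viter p q fg1 fg2 ℓ) ≤
            C * ε ^ ((p - 1) * (q + (ℓ : ℝ) * (p + q - 2)))) := by
  obtain ⟨hq, hK2⟩ := param hp1 hp2 hcond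
  have hκ0 : 0 < p - 1 := by linarith
  have hκ1 : p - 1 < 1 := by linarith
  obtain ⟨C, hC, H⟩ := inv_all hp1 hp2 hcond hl3 ℓ le_rfl
  refine ⟨2 * (1 + C) + (1 + C) + (1 + C ^ (p - 1)), by positivity, ?_⟩
  intro ε hε hε1 fg1 fg2 hY1 hY2 u₁ u₂ hD
  obtain ⟨W, V', V, hW, hV', hV, Wu, Vu', Vu, hb⟩ := H ε fg1 fg2 hε hε1 hY1 hY2
  obtain ⟨hu1, hu2, B12, B11, B22, B21, hd⟩ := hD
  obtain ⟨U1, hU1, rfl⟩ := hu1.jet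
  obtain ⟨U2, hU2, rfl⟩ := hu2.jet
  have ha1 := aseq_ge_one hκ0 hK2 (ℓ + 1)
  have haK := aseq_ge hκ0 hK2 ℓ
  rw [← Wu, ← Vu] at hd
  rw [← Wu] at B12 B11 ⊢
  rw [← Vu] at B22 B21
  rw [← Vu']
  change _ ≤ ε ^ ((p - 1) * bseq p q ℓ) at hd
  change _ ∧ _ ≤ ε ^ ((p - 1) * bseq p q ℓ) ∧ _ ∧ _ ∧ _ ≤ _ * ε ^ ((p - 1) * bseq p q ℓ)
  unfold dOne dTwo at *
  set a := aseq (p - 1) (q * (p - 1) - 1) (ℓ + 1) with ha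
  set b := bseq p q ℓ with hbd
  have hbq : q ≤ b := by
    rw [hbd]; unfold bseq
    have : 0 ≤ (ℓ:ℝ) * (p + q - 2) := mul_nonneg (Nat.cast_nonneg ℓ) (by linarith)
    linarith
  have hκb : 1 ≤ (p - 1) * b := by
    have := mul_le_mul_of_nonneg_left hbq hκ0.le
    linarith
  set e := ε ^ ((p - 1) * b) with he
  have he0 : 0 ≤ e := by positivity
  have heε : e ≤ ε := by
    have := rpow_le_rpow_of_exponent_ge hε hε1 hκb
    rwa [rpow_one] at this
  change BddAbove (ZSet 2 _ (U1.sub W).u) at B12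
  change BddAbove (ZSet 1 _ (U1.sub W).u) at B11
  change BddAbove (ZSet 2 _ (U2.sub V).u) at B22
  change BddAbove (ZSet 1 _ (U2.sub V).u) at B21
  change Znorm 2 ((p - 1) * a) (U1.sub W).u + Znorm 1 ((p - 1) * a) (U1.sub W).u ^ (p - 1) +
    (Znorm 2 a (U2.sub V).u + Znorm 1 a (U2.sub V).u ^ (p - 1)) ≤ e at hd
  have n1 := Znorm_nonneg 2 ((p - 1) * a) (U1.sub W).u
  have n2 := Znorm_nonneg 1 ((p - 1) * a) (U1.sub W).u
  have n3 := Znorm_nonneg 2 a (U2.sub V).u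
  have n4 := Znorm_nonneg 1 a (U2.sub V).u
  have n5 := rpow_nonneg n2 (p - 1)
  have n6 := rpow_nonneg n4 (p - 1)
  have jD1 := hU1.sub hW
  have jD2 := hU2.sub hV
  obtain ⟨z1, z1'⟩ := Z2_of_b2 hU1 (ν := p - 1) (B := (1 + C) * ε) (by positivity)
    (fun r t hr ht => by
      have h1 := b2_of_Znorm jD1 B12 hr ht
      have h2 := (hb r t hr ht).1
      have h3 := Jet.b2_add (U1.sub W) W (t := t) hr
      rw [Jet.ext_add_sub] at h3
      have h4 : Znorm 2 ((p - 1) * a) (U1.sub W).u * wZ ((p - 1) * a) r t ≤ ε * wZ (p - 1) r t :=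
        mul_le_mul (by linarith) (wZ_anti (le_mul_of_one_le_right hκ0.le ha1) hr.le ht)
          (wZ_nonneg _ _ _ hr.le ht) hε.le
      linarith)
  obtain ⟨z2, z2'⟩ := X2_of_b2 hU2 (ν := q * (p - 1) - 1) (B := (1 + C) * ε) (by positivity)
    (fun r t hr ht => by
      have h1 := b2_of_Znorm jD2 B22 hr ht
      have h2 := (hb r t hr ht).2.2.1
      have h3 := Jet.b2_add (U2.sub V) V (t := t) hr
      rw [Jet.ext_add_sub] at h3
      have h4 : Znorm 2 a (U2.sub V).u * wZ a r t ≤ ε * wX (q * (p - 1) - 1) r t :=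
        mul_le_mul (by linarith) ((wZ_anti haK hr.le ht).trans (wZ_le_wX hK2.le hr.le ht))
          (wZ_nonneg _ _ _ hr.le ht) hε.le
      linarith)
  obtain ⟨z3, z3'⟩ := Z2_of_b2 (hU2.sub hV') (ν := a) (B := (1 + C) * e) (by positivity)
    (fun r t hr ht => by
      have h1 := b2_of_Znorm jD2 B22 hr ht
      have h2 := (hb r t hr ht).2.2.2.2
      have h3 := Jet.b2_add (U2.sub V) (V.sub V') (t := t) hr
      rw [Jet.sub_add_sub] at h3
      have h4 : Znorm 2 a (U2.sub V).u * wZ a r t ≤ e * wZ a r t :=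
        mul_le_mul_of_nonneg_right (by linarith) (wZ_nonneg _ _ _ hr.le ht)
      linarith)
  obtain ⟨z4, z4'⟩ := Z1_of_b1 (hU2.sub hV') (ν := a)
    (B := Znorm 1 a (U2.sub V).u + C * ε ^ b) (by positivity)
    (fun r t hr ht => by
      have h1 := b1_of_Znorm jD2 B21 hr ht
      have h2 := (hb r t hr ht).2.2.2.1
      have h3 := Jet.b1_add (U2.sub V) (V.sub V') (t := t) hr
      rw [Jet.sub_add_sub] at h3
      linarith)
  have z5 : Znorm 1 a (U2.sub V').u ^ (p - 1) ≤ (1 + C ^ (p - 1)) * e := by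
    have h1 := rpow_le_rpow (Znorm_nonneg 1 a (U2.sub V').u) z4' hκ0.le
    have h2 := Real.rpow_add_le_add_rpow n4 (by positivity : 0 ≤ C * ε ^ b) hκ0.le hκ1.le
    have h3 : (C * ε ^ b) ^ (p - 1) = C ^ (p - 1) * e := by
      rw [mul_rpow hC.le (by positivity), ← rpow_mul hε.le, mul_comm b, he]
    rw [h3] at h2
    linarith
  have c0 : 0 < C ^ (p - 1) := by positivity
  refine ⟨⟨z1, z2, ?_⟩, ?_, z3, z4, ?_⟩
  · have h1 : 0 ≤ ((1 + C) + (1 + C ^ (p - 1))) * ε := by positivity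
    linarith
  · change Znorm 2 ((p - 1) * a) (U1.sub W).u + Znorm 1 ((p - 1) * a) (U1.sub W).u ^ (p - 1) ≤ e
    linarith
  · change Znorm 2 a (U2.sub V').u + Znorm 1 a (U2.sub V').u ^ (p - 1) ≤ _
    have h1 : 0 ≤ (2 * (1 + C)) * e := by positivity
    linarith
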